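/- For every integer n > 2 there exist a constant c = c(n) and an absolute constant κ such that the following holds. Let f ∈ ℤ[x_0,…,x_n] be a homogeneous polynomial of degree 3 that is irreducible in ℚ[x_0,…,x_n], and let X ⊂ ℙ^n_ℚ be the hypersurface f = 0. Then for every real H ≥ 2, the number of rational points of X of height at most H is at most c·H^{(n−1) − 1 + 2/√3}·(log H)^κ. -/

import Mathlib

namespace DG
open MvPolynomial

/-! ### Resultants -/

theorem res_ne_zero {A : Type*} [CommRing A] [IsDomain A] [UniqueFactorizationMonoid A]
    (g h : Polynomial A) (hg : Irreducible g) (hd : g.natDegree ≠ 0) (hnd : ¬ g ∣ h) :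
    Polynomial.resultant g h ≠ 0 := by
  classical
  let _ : NormalizedGCDMonoid A := Classical.choice inferInstance
  let K := FractionRing A
  have hprim : g.IsPrimitive := hg.isPrimitive hd
  have hirr : Irreducible (g.map (algebraMap A K)) :=
    (hprim.irreducible_iff_irreducible_map_fraction_map (K := K)).1 hg
  have hnd' : ¬ g.map (algebraMap A K) ∣ h.map (algebraMap A K) := by
    intro hdvd
    exact hnd ((hprim.dvd_iff_fraction_map_dvd_fraction_map K).2 hdvd)
  have hcop : IsCoprime (g.map (algebraMap A K)) (h.map (algebraMap A K)) :=
    (hirr.coprime_iff_not_dvd).2 hnd'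
  have hinj : Function.Injective (algebraMap A K) := IsFractionRing.injective A K
  have := Polynomial.resultant_ne_zero _ _ hcop
  rw [Polynomial.natDegree_map_eq_of_injective hinj, Polynomial.natDegree_map_eq_of_injective hinj,
    Polynomial.resultant_map_map] at this
  intro h0
  exact this (by rw [h0, map_zero])

theorem res_vanish {A K : Type*} [CommRing A] [CommRing K] (φ : A →+* K) (z : K)
    (g h : Polynomial A) (hd : g.natDegree ≠ 0)
    (h1 : Polynomial.eval₂ φ z g = 0) (h2 : Polynomial.eval₂ φ z h = 0) :
    φ (Polynomial.resultant g h) = 0 := by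
  obtain ⟨p, q, -, -, e⟩ := Polynomial.exists_mul_add_mul_eq_C_resultant g h le_rfl le_rfl
    (Or.inl hd)
  have := congrArg (Polynomial.eval₂ φ z) e
  simpa [Polynomial.eval₂_add, Polynomial.eval₂_mul, h1, h2] using this.symm

theorem totalDegree_det_le {σ R : Type*} [CommRing R] {k : ℕ} (D : ℕ)
    (M : Matrix (Fin k) (Fin k) (MvPolynomial σ R)) (hM : ∀ i j, (M i j).totalDegree ≤ D) :
    M.det.totalDegree ≤ k * D := by
  rw [Matrix.det_apply]
  apply totalDegree_finsetSum_le
  intro s _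
  have h1 : (∏ i, M (s i) i).totalDegree ≤ k * D := by
    refine (totalDegree_finsetProd _ _).trans ?_
    refine (Finset.sum_le_card_nsmul _ _ D (fun i _ => hM _ _)).trans ?_
    simp
  rcases Int.units_eq_one_or (Equiv.Perm.sign s) with h | h <;> rw [h]
  · simpa using h1
  · rw [Units.neg_smul, one_smul, totalDegree_neg]; exact h1

theorem res_totalDegree {σ R : Type*} [CommRing R] (D : ℕ) (g h : Polynomial (MvPolynomial σ R))
    (hg : ∀ i, (g.coeff i).totalDegree ≤ D) (hh : ∀ i, (h.coeff i).totalDegree ≤ D) (m n : ℕ) :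
    (Polynomial.resultant g h m n).totalDegree ≤ (m + n) * D := by
  apply totalDegree_det_le
  intro i j
  unfold Polynomial.sylvester
  refine Fin.addCases (fun j => ?_) (fun j => ?_) j
  · simp only [Matrix.of_apply, Fin.addCases_left]
    split_ifs
    · exact hh _
    · simp
  · simp only [Matrix.of_apply, Fin.addCases_right]
    split_ifs
    · exact hg _
    · simp

/-! ### finSuccEquiv -/

theorem aeval_fse {R K : Type*} [CommRing R] [CommRing K] [Algebra R K] {n : ℕ}
    (x : Fin (n+1) → K) (f : MvPolynomial (Fin (n+1)) R) :
    aeval x f = Polynomial.eval₂ (aeval (Fin.tail x) : MvPolynomial (Fin n) R →ₐ[R] K).toRingHom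
      (x 0) (finSuccEquiv R n f) := by
  induction f using MvPolynomial.induction_on with
  | C a => simp [finSuccEquiv_apply]
  | add p q hp hq => rw [map_add, map_add, Polynomial.eval₂_add, hp, hq]
  | mul_X p i hp =>
    rw [map_mul, map_mul, Polynomial.eval₂_mul, hp]
    congr 1
    refine Fin.cases ?_ (fun j => ?_) i
    · simp [finSuccEquiv_X_zero]
    · simp [finSuccEquiv_X_succ, Fin.tail]

theorem totalDegree_coeff_fse_le {R : Type*} [CommRing R] {n : ℕ}
    (f : MvPolynomial (Fin (n+1)) R) (i : ℕ) :
    ((finSuccEquiv R n f).coeff i).totalDegree ≤ f.totalDegree := by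
  by_cases h : (finSuccEquiv R n f).coeff i = 0
  · simp [h]
  · have := totalDegree_coeff_finSuccEquiv_add_le f i h
    omega

theorem natDegree_fse_le {R : Type*} [CommRing R] {n : ℕ}
    (f : MvPolynomial (Fin (n+1)) R) : (finSuccEquiv R n f).natDegree ≤ f.totalDegree := by
  rw [natDegree_finSuccEquiv]; exact degreeOf_le_totalDegree _ _

theorem fse_map {n : ℕ} (f : MvPolynomial (Fin (n+1)) ℤ) :
    finSuccEquiv ℚ n (map (Int.castRingHom ℚ) f) =
      (finSuccEquiv ℤ n f).map (map (Int.castRingHom ℚ)) := by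
  induction f using MvPolynomial.induction_on with
  | C a => simp [finSuccEquiv_apply]
  | add p q hp hq => simp only [map_add, hp, hq, Polynomial.map_add]
  | mul_X p i hp =>
    simp only [map_mul, hp, Polynomial.map_mul, map_X]
    congr 1
    refine Fin.cases ?_ (fun j => ?_) i
    · simp [finSuccEquiv_X_zero]
    · simp [finSuccEquiv_X_succ]

/-! ### Counting zeros -/

/-- Schwartz-Zippel in the form used here. -/
theorem sz_count {n : ℕ} (p : MvPolynomial (Fin (n+1)) ℤ) (hp : p ≠ 0) (S : Finset ℤ)
    (T : Finset (Fin (n+1) → ℤ)) (hT : ∀ x ∈ T, (∀ i, x i ∈ S) ∧ eval x p = 0) :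
    T.card ≤ p.totalDegree * S.card ^ n := by
  classical
  rcases T.eq_empty_or_nonempty with rfl | ⟨x0, hx0⟩
  · simp
  have hS : 0 < S.card := Finset.card_pos.2 ⟨x0 0, (hT x0 hx0).1 0⟩
  have h := schwartz_zippel_totalDegree hp S
  have hsub : T ⊆ Finset.filter (fun f => eval f p = 0) (Fintype.piFinset fun _ => S) := by
    intro x hx
    simp only [Finset.mem_filter, Fintype.mem_piFinset]
    exact hT x hx
  have hc := Finset.card_le_card hsub
  have hS' : (0:ℚ≥0) < S.card := by exact_mod_cast hS
  rw [div_le_div_iff₀ (by positivity) hS'] at h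
  have h' : (Finset.filter (fun f => eval f p = 0) (Fintype.piFinset fun _ => S)).card * S.card
      ≤ p.totalDegree * S.card ^ (n+1) := by exact_mod_cast h
  have h2 : T.card * S.card ≤ (p.totalDegree * S.card ^ n) * S.card := by
    calc _ ≤ _ := Nat.mul_le_mul_right _ hc
      _ ≤ _ := h'
      _ = _ := by ring
  exact Nat.le_of_mul_le_mul_right h2 hS

theorem uni_count (p : MvPolynomial (Fin 1) ℤ) (hp : p ≠ 0) (T : Finset ℤ)
    (hT : ∀ t ∈ T, eval (fun _ => t) p = 0) : T.card ≤ p.totalDegree := by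
  classical
  have := sz_count p hp T (T.image (fun t => fun _ => t)) (by
    intro x hx
    obtain ⟨t, ht, rfl⟩ := Finset.mem_image.1 hx
    exact ⟨fun _ => ht, hT t ht⟩)
  rw [Finset.card_image_of_injective _ (fun a b h => congrFun h 0)] at this
  simpa using this

theorem eval_fse {n : ℕ} (x : Fin (n+1) → ℤ) (f : MvPolynomial (Fin (n+1)) ℤ) :
    eval x f = Polynomial.eval₂ (eval (Fin.tail x)) (x 0) (finSuccEquiv ℤ n f) := by
  have := aeval_fse (K := ℤ) x f
  rw [aeval_eq_eval] at this
  exact this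

/-- Common zeros of an irreducible plane curve and another curve: values of the coordinate `1`. -/
theorem cz_aux (B : ℕ) (p R : MvPolynomial (Fin 2) ℤ) (hp : Irreducible p) (hnd : ¬ p ∣ R)
    (hpB : p.totalDegree ≤ B) (hRB : R.totalDegree ≤ B) (T : Finset (Fin 2 → ℤ))
    (hT : ∀ x ∈ T, eval x p = 0 ∧ eval x R = 0) :
    (T.image (fun x => x 1)).card ≤ 2 * B * B + B := by
  classical
  have htail : ∀ x : Fin 2 → ℤ, Fin.tail x = fun _ => x 1 := by
    intro x; funext i; fin_cases i; rfl
  by_cases hd : (finSuccEquiv ℤ 1 p).natDegree = 0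
  · obtain ⟨a, ha⟩ := Polynomial.natDegree_eq_zero.1 hd
    have ha0 : a ≠ 0 := by
      rintro rfl
      apply hp.ne_zero
      apply (finSuccEquiv ℤ 1).injective
      rw [← ha]; simp
    have : a.totalDegree ≤ B := by
      have := totalDegree_coeff_fse_le p 0
      rw [← ha] at this
      simp only [Polynomial.coeff_C_zero] at this
      omega
    have h2 := uni_count a ha0 (T.image (fun x => x 1)) (by
      intro t ht
      obtain ⟨x, hx, rfl⟩ := Finset.mem_image.1 ht
      have := (hT x hx).1
      rw [eval_fse, ← ha, htail] at this
      simpa using this)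
    omega
  · have hirr : Irreducible (finSuccEquiv ℤ 1 p) := by
      rwa [MulEquiv.irreducible_iff]
    have hnd' : ¬ finSuccEquiv ℤ 1 p ∣ finSuccEquiv ℤ 1 R := by
      rwa [map_dvd_iff]
    have h0 := res_ne_zero _ _ hirr hd hnd'
    have hdeg := res_totalDegree B (finSuccEquiv ℤ 1 p) (finSuccEquiv ℤ 1 R)
      (fun i => (totalDegree_coeff_fse_le p i).trans hpB)
      (fun i => (totalDegree_coeff_fse_le R i).trans hRB)
      (finSuccEquiv ℤ 1 p).natDegree (finSuccEquiv ℤ 1 R).natDegree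
    have h2 := uni_count _ h0 (T.image (fun x => x 1)) (by
      intro t ht
      obtain ⟨x, hx, rfl⟩ := Finset.mem_image.1 ht
      have h1 := (hT x hx).1
      have h2 := (hT x hx).2
      rw [eval_fse, htail] at h1 h2
      exact res_vanish _ _ _ _ hd h1 h2)
    have h3 : ((finSuccEquiv ℤ 1 p).natDegree + (finSuccEquiv ℤ 1 R).natDegree) * B ≤
        2 * B * B := by
      apply Nat.mul_le_mul_right
      have := natDegree_fse_le p
      have := natDegree_fse_le R
      omega
    omega

/-- Bezout-type bound. -/
theorem cz (B : ℕ) (p R : MvPolynomial (Fin 2) ℤ) (hp : Irreducible p) (hnd : ¬ p ∣ R)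
    (hpB : p.totalDegree ≤ B) (hRB : R.totalDegree ≤ B) (T : Finset (Fin 2 → ℤ))
    (hT : ∀ x ∈ T, eval x p = 0 ∧ eval x R = 0) :
    T.card ≤ (2 * B * B + B) ^ 2 := by
  classical
  have h1 := cz_aux B p R hp hnd hpB hRB T hT
  let e : Fin 2 ≃ Fin 2 := Equiv.swap 0 1
  have h2 := cz_aux B (renameEquiv ℤ e p) (renameEquiv ℤ e R)
    ((MulEquiv.irreducible_iff _).2 hp) (by rwa [map_dvd_iff])
    (by rw [totalDegree_renameEquiv]; exact hpB) (by rw [totalDegree_renameEquiv]; exact hRB)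
    (T.image (fun x => x ∘ e)) (by
      intro y hy
      obtain ⟨x, hx, rfl⟩ := Finset.mem_image.1 hy
      have : (x ∘ e) ∘ e = x := by
        funext i; simp [e]
      simp only [renameEquiv_apply, eval_rename, this]
      exact hT x hx)
  rw [Finset.image_image] at h2
  have h3 : T ⊆ ((T.image (fun x => x 1)) ×ˢ (T.image (fun x => x 0))).image
      (fun a => ![a.2, a.1]) := by
    intro x hx
    refine Finset.mem_image.2 ⟨(x 1, x 0), ?_, ?_⟩
    · exact Finset.mem_product.2 ⟨Finset.mem_image_of_mem _ hx, Finset.mem_image_of_mem _ hx⟩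
    · funext i; fin_cases i <;> rfl
  have h4 := (Finset.card_le_card h3).trans Finset.card_image_le
  rw [Finset.card_product] at h4
  have h5 : (fun x : Fin 2 → ℤ => x 1) ∘ (fun x => x ∘ e) = fun x => x 0 := by
    funext x; simp [e]
  rw [h5] at h2
  calc _ ≤ _ := h4
    _ ≤ _ := Nat.mul_le_mul h1 h2
    _ = _ := by ring

end DG


namespace DG
open MvPolynomial

/-! ### Newton approximation -/

theorem newton {B ι : Type*} [CommRing B] (ev : ι → B →+* ℤ) (G : Polynomial B) (w : ι → ℤ)
    (r c w1 : ℤ) (hz : ∀ P, (G.map (ev P)).eval (w P) = 0) (hw : ∀ P, r ∣ w1 - w P)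
    (hc : ∀ P, r ∣ 1 - c * (G.map (ev P)).derivative.eval (w P)) (k : ℕ) :
    ∃ ψ : B, ∀ P, r ^ (k+1) ∣ ev P ψ - w P := by
  induction k with
  | zero => exact ⟨(w1 : B), fun P => by simpa using hw P⟩
  | succ k ih =>
    obtain ⟨ψ, hψ⟩ := ih
    refine ⟨ψ - (c : B) * G.eval ψ, fun P => ?_⟩
    have h1 : ev P (ψ - (c : B) * G.eval ψ) = ev P ψ - c * (G.map (ev P)).eval (ev P ψ) := by
      rw [map_sub, map_mul, map_intCast, Polynomial.eval_map, Polynomial.eval₂_hom, Int.cast_id]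
    obtain ⟨kk, hkk⟩ := Polynomial.binomExpansion (G.map (ev P)) (w P) (ev P ψ - w P)
    rw [add_sub_cancel, hz P] at hkk
    rw [h1, hkk]
    obtain ⟨d, hd⟩ := hψ P
    obtain ⟨e, he⟩ := hc P
    rw [hd]
    have h2 : ev P ψ = r ^ (k+1) * d + w P := by linarith
    refine ⟨d * e - c * kk * d ^ 2 * r ^ k, ?_⟩
    have h3 : c * (G.map (ev P)).derivative.eval (w P) = 1 - r * e := by linarith
    rw [h2]
    calc _ = r ^ (k+1) * d - (c * (G.map (ev P)).derivative.eval (w P)) * (r ^ (k+1) * d)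
          - c * kk * (r ^ (k+1) * d)^2 := by ring
      _ = _ := by rw [h3]; ring

/-! ### Pigeonhole -/

theorem pigeon {d t : ℕ} {ι J : Type*} [Fintype J] (m : ℕ) (hm : 0 < m)
    (Φ : J → MvPolynomial (Fin d) ℤ) (u : ι → Fin d → ℤ) (u1 : Fin d → ℤ)
    (hu : ∀ P i, (m : ℤ) ∣ u P i - u1 i) (val : J → ι → ℤ)
    (hval : ∀ j P, (m : ℤ) ^ t ∣ val j P - eval (u P) (Φ j)) (A V : J → ℕ)
    (hV : ∀ j P, |val j P| ≤ V j)
    (hcard : m ^ (∑ α : Fin d → Fin t, (t - ∑ i, (α i : ℕ))) < ∏ j, (A j + 1))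
    (hsmall : ∑ j, A j * V j < m ^ t) :
    ∃ a : J → ℤ, a ≠ 0 ∧ (∀ j, |a j| ≤ A j) ∧ ∀ P, ∑ j, a j * val j P = 0 := by
  classical
  let Ψ : J → MvPolynomial (Fin d) ℤ := fun j => aeval (fun i => X i + C (u1 i)) (Φ j)
  have hΨ : ∀ j v, eval v (Ψ j) = eval (fun i => v i + u1 i) (Φ j) := by
    intro j v
    simp only [Ψ]
    rw [← aeval_eq_eval, ← AlgHom.comp_apply, comp_aeval]
    simp [aeval_eq_eval]
  let ex : (Fin d → Fin t) → (Fin d →₀ ℕ) := fun α => Finsupp.equivFunOnFinite.symm (fun i => (α i : ℕ))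
  let M : (Fin d → Fin t) → ℕ := fun α => m ^ (t - ∑ i, (α i : ℕ))
  have hM : ∀ α, 0 < M α := fun α => pow_pos hm _
  let dom : Finset (J → ℕ) := Fintype.piFinset (fun j => Finset.range (A j + 1))
  let cod : Finset ((Fin d → Fin t) → ℕ) := Fintype.piFinset (fun α => Finset.range (M α))
  let F : (J → ℕ) → ((Fin d → Fin t) → ℕ) := fun a α =>
    ((∑ j, (a j : ℤ) * coeff (ex α) (Ψ j)) % (M α : ℤ)).toNat
  have hFm : ∀ a ∈ dom, F a ∈ cod := by
    intro a _
    rw [Fintype.mem_piFinset]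
    intro α
    rw [Finset.mem_range]
    have h1 : (0:ℤ) < M α := by exact_mod_cast hM α
    have := Int.emod_lt_of_pos (∑ j, (a j : ℤ) * coeff (ex α) (Ψ j)) h1
    have h2 := Int.emod_nonneg (∑ j, (a j : ℤ) * coeff (ex α) (Ψ j)) h1.ne'
    simp only [F]
    omega
  have hc : cod.card < dom.card := by
    simp only [cod, dom, Fintype.card_piFinset, Finset.card_range, M]
    rwa [Finset.prod_pow_eq_pow_sum]
  obtain ⟨a, ha, b, hb, hab, hF⟩ := Finset.exists_ne_map_eq_of_card_lt_of_maps_to hc hFm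
  have hdiv : ∀ α : Fin d → Fin t, (M α : ℤ) ∣ ∑ j, ((a j : ℤ) - b j) * coeff (ex α) (Ψ j) := by
    intro α
    have h := congrFun hF α
    simp only [F] at h
    have h1 : (0:ℤ) < M α := by exact_mod_cast hM α
    have h2 := Int.emod_nonneg (∑ j, (a j : ℤ) * coeff (ex α) (Ψ j)) h1.ne'
    have h3 := Int.emod_nonneg (∑ j, (b j : ℤ) * coeff (ex α) (Ψ j)) h1.ne'
    have h4 : (∑ j, (a j : ℤ) * coeff (ex α) (Ψ j)) % (M α : ℤ) =
      (∑ j, (b j : ℤ) * coeff (ex α) (Ψ j)) % (M α : ℤ) := by omega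
    have h5 := Int.ModEq.dvd (show _ ≡ _ [ZMOD (M α : ℤ)] from h4.symm)
    simpa [sub_mul, Finset.sum_sub_distrib] using h5
  refine ⟨fun j => (a j : ℤ) - b j, ?_, ?_, ?_⟩
  · intro h0
    apply hab
    funext j
    have := congrFun h0 j
    simp only [Pi.zero_apply] at this
    omega
  · intro j
    have h1 := Finset.mem_range.1 ((Fintype.mem_piFinset.1 ha) j)
    have h2 := Finset.mem_range.1 ((Fintype.mem_piFinset.1 hb) j)
    show |(a j : ℤ) - b j| ≤ A j
    rw [abs_le]; constructor <;> omega
  · intro P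
    have hbd : ∀ j, |(a j : ℤ) - b j| ≤ A j := by
      intro j
      have h1 := Finset.mem_range.1 ((Fintype.mem_piFinset.1 ha) j)
      have h2 := Finset.mem_range.1 ((Fintype.mem_piFinset.1 hb) j)
      rw [abs_le]; constructor <;> omega
    -- divisibility
    choose w hw using fun i => hu P i
    have hev : ∀ j, eval (u P) (Φ j) = eval (fun i => (m:ℤ) * w i) (Ψ j) := by
      intro j
      rw [hΨ]
      congr 2
      funext i
      have := hw i
      linarith
    have hd1 : (m:ℤ) ^ t ∣ ∑ j, ((a j : ℤ) - b j) * eval (u P) (Φ j) := by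
      have : ∑ j, ((a j : ℤ) - b j) * eval (u P) (Φ j) =
          eval (fun i => (m:ℤ) * w i) (∑ j, C ((a j : ℤ) - b j) * Ψ j) := by
        rw [map_sum]
        exact Finset.sum_congr rfl (fun j _ => by rw [map_mul, eval_C, hev])
      rw [this, eval_eq']
      apply Finset.dvd_sum
      intro e _
      simp only [coeff_sum, coeff_C_mul, mul_pow, Finset.prod_mul_distrib]
      rw [Finset.prod_pow_eq_pow_sum]
      by_cases he : ∀ i, e i < t
      · have h := hdiv (fun i => ⟨e i, he i⟩)
        have hex : ex (fun i => ⟨e i, he i⟩) = e := by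
          ext i; simp [ex]
        rw [hex] at h
        simp only [M] at h
        push_cast at h
        have h6 : (m:ℤ) ^ t ∣ (m:ℤ) ^ (t - ∑ i, e i) * (m:ℤ) ^ (∑ i, e i) := by
          rw [← pow_add]
          exact pow_dvd_pow _ (by omega)
        refine h6.trans ?_
        exact mul_dvd_mul h (Dvd.intro _ rfl)
      · push Not at he
        obtain ⟨i, hi⟩ := he
        have : t ≤ ∑ i, e i := hi.trans (Finset.single_le_sum (f := fun i => e i) (fun _ _ => Nat.zero_le _) (Finset.mem_univ i))
        exact Dvd.dvd.mul_left ((pow_dvd_pow _ this).trans (Dvd.intro _ rfl)) _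
    have hd2 : (m:ℤ) ^ t ∣ ∑ j, ((a j : ℤ) - b j) * val j P := by
      have h7 : ∑ j, ((a j : ℤ) - b j) * val j P = ∑ j, ((a j : ℤ) - b j) * eval (u P) (Φ j) +
          ∑ j, ((a j : ℤ) - b j) * (val j P - eval (u P) (Φ j)) := by
        rw [← Finset.sum_add_distrib]
        exact Finset.sum_congr rfl (fun j _ => by ring)
      rw [h7]
      exact dvd_add hd1 (Finset.dvd_sum (fun j _ => Dvd.dvd.mul_left (hval j P) _))
    apply Int.eq_zero_of_abs_lt_dvd hd2
    calc |∑ j, ((a j : ℤ) - b j) * val j P| ≤ ∑ j, |((a j : ℤ) - b j) * val j P| :=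
          Finset.abs_sum_le_sum_abs _ _
      _ ≤ ∑ j, (A j : ℤ) * V j := by
          apply Finset.sum_le_sum
          intro j _
          rw [abs_mul]
          exact mul_le_mul (hbd j) (hV j P) (abs_nonneg _) (by positivity)
      _ < (m:ℤ) ^ t := by exact_mod_cast hsmall

/-! ### Siegel -/

attribute [local instance] Matrix.seminormedAddCommGroup in
theorem siegel {β : Type*} [Fintype β] (S : Finset (β → ℤ)) (B : ℕ) (hB : 1 ≤ B)
    (hS : ∀ v ∈ S, ∀ b, |v b| ≤ B) (a : β → ℚ) (ha : a ≠ 0)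
    (hav : ∀ v ∈ S, ∑ b, a b * v b = 0) :
    ∃ a0 : β → ℤ, a0 ≠ 0 ∧ (∀ v ∈ S, ∑ b, a0 b * v b = 0) ∧
      ∀ b, |a0 b| ≤ ((Fintype.card β * B) ^ (Fintype.card β) : ℕ) := by
  classical
  let q : (β → ℤ) → (β → ℚ) := fun v b => (v b : ℚ)
  obtain ⟨T, hTS, hTspan, hTli⟩ := exists_linearIndependent ℚ ((S.image q : Finset (β → ℚ)) : Set (β → ℚ))
  have hTfin : T.Finite := (Finset.finite_toSet _).subset hTS
  have hcn : 0 < Fintype.card β := by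
    rw [Fintype.card_pos_iff]
    by_contra h
    rw [not_nonempty_iff] at h
    exact ha (Subsingleton.elim _ _)
  let _ := hTfin.fintype
  -- card bound
  have hcard : Fintype.card T < Fintype.card β := by
    let L : (β → ℚ) →ₗ[ℚ] ℚ := Fintype.linearCombination ℚ a
    have hL : ∀ v, L v = ∑ b, v b * a b := fun v => by simp [L, Fintype.linearCombination_apply]
    have hsub : Submodule.span ℚ T ≤ LinearMap.ker L := by
      rw [Submodule.span_le]
      intro x hx
      have := hTS hx
      rw [Finset.mem_coe, Finset.mem_image] at this
      obtain ⟨v, hv, rfl⟩ := this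
      have h := hav v hv
      simp only [SetLike.mem_coe, LinearMap.mem_ker, hL]
      rw [← h]
      exact Finset.sum_congr rfl (fun b _ => by simp only [q]; ring)
    have h1 : Fintype.card T = Module.finrank ℚ (Submodule.span ℚ T) := by
      have := finrank_span_eq_card hTli
      rw [Subtype.range_coe] at this
      exact this.symm
    have h2 := Submodule.finrank_mono hsub
    have h3 : LinearMap.ker L < ⊤ := by
      rw [lt_top_iff_ne_top]
      intro h
      apply ha
      funext b
      have : L (Pi.single b 1) = 0 := by
        have : (Pi.single b 1 : β → ℚ) ∈ LinearMap.ker L := by rw [h]; trivial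
        exact this
      rw [hL] at this
      simpa [Pi.single_apply] using this
    have h4 := Submodule.finrank_lt h3.ne
    rw [Module.finrank_fintype_fun_eq_card] at h4
    omega
  by_cases hT0 : Fintype.card T = 0
  · -- no conditions
    have hspan0 : ∀ v ∈ S, q v = 0 := by
      intro v hv
      have : q v ∈ Submodule.span ℚ T := by
        rw [hTspan]; exact Submodule.subset_span (Finset.mem_coe.2 (Finset.mem_image_of_mem _ hv))
      have hTe : T = ∅ := by
        rw [Fintype.card_eq_zero_iff] at hT0
        exact Set.isEmpty_coe_sort.1 hT0
      rw [hTe, Submodule.span_empty] at this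
      exact this
    refine ⟨fun _ => 1, ?_, ?_, ?_⟩
    · obtain ⟨b⟩ := Fintype.card_pos_iff.1 hcn
      intro h
      have := congrFun h b
      simp at this
    · intro v hv
      apply Finset.sum_eq_zero
      intro b _
      have := congrFun (hspan0 v hv) b
      simp only [q, Pi.zero_apply] at this
      have h : v b = 0 := by exact_mod_cast this
      rw [h, mul_zero]
    · intro b
      simp only [abs_one]
      have : 1 ≤ (Fintype.card β * B) ^ (Fintype.card β) := Nat.one_le_pow _ _ (by positivity)
      exact_mod_cast this
  have hch : ∀ x : T, ∃ v ∈ S, q v = x := by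
    intro x
    have := hTS x.2
    rw [Finset.mem_coe, Finset.mem_image] at this
    exact this
  choose vv hvS hvq using hch
  let A : Matrix T β ℤ := fun x b => vv x b
  obtain ⟨t, ht0, htA, htn⟩ := Int.Matrix.exists_ne_zero_int_vec_norm_le A hcard (by omega)
  refine ⟨t, ht0, ?_, ?_⟩
  · intro v hv
    let L : (β → ℚ) →ₗ[ℚ] ℚ := Fintype.linearCombination ℚ (fun b => (t b : ℚ))
    have hL : ∀ v, L v = ∑ b, v b * t b := fun v => by simp [L, Fintype.linearCombination_apply]
    have hsub : Submodule.span ℚ T ≤ LinearMap.ker L := by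
      rw [Submodule.span_le]
      intro x hx
      have h1 := congrFun htA ⟨x, hx⟩
      have h2 := hvq ⟨x, hx⟩
      simp only [SetLike.mem_coe, LinearMap.mem_ker, hL]
      simp only at h2
      rw [← h2]
      simp only [q]
      have h3 : ∑ b, vv ⟨x, hx⟩ b * t b = 0 := by
        simpa [Matrix.mulVec, dotProduct, A] using h1
      exact_mod_cast h3
    have hm : q v ∈ Submodule.span ℚ T := by
      rw [hTspan]; exact Submodule.subset_span (Finset.mem_coe.2 (Finset.mem_image_of_mem _ hv))
    have := hsub hm
    simp only [LinearMap.mem_ker, hL, q] at this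
    have h3 : ∑ b, v b * t b = 0 := by exact_mod_cast this
    rw [← h3]
    exact Finset.sum_congr rfl (fun b _ => by ring)
  · intro b
    have h1 : ‖t b‖ ≤ ‖t‖ := norm_le_pi_norm t b
    have hAn : max 1 ‖A‖ ≤ B := by
      apply max_le (by exact_mod_cast hB)
      rw [Matrix.norm_le_iff (Nat.cast_nonneg B)]
      intro i j
      rw [Int.norm_eq_abs]
      exact_mod_cast hS _ (hvS i) j
    have hbase : (1:ℝ) ≤ Fintype.card β * B := by
      have : 1 ≤ Fintype.card β * B := Nat.one_le_iff_ne_zero.2 (by positivity)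
      exact_mod_cast this
    have h2 : ‖t‖ ≤ (Fintype.card β * B : ℝ) ^ (Fintype.card β : ℝ) := by
      refine htn.trans ?_
      have hc1 : (Fintype.card T : ℝ) + 1 ≤ Fintype.card β := by exact_mod_cast hcard
      calc _ ≤ (Fintype.card β * B : ℝ) ^ ((Fintype.card T : ℝ) / (Fintype.card β - Fintype.card T)) := by
            apply Real.rpow_le_rpow (by positivity) (by gcongr)
            apply div_nonneg (by positivity); linarith
        _ ≤ _ := by
            apply Real.rpow_le_rpow_of_exponent_le hbase
            rw [div_le_iff₀ (by linarith)]
            have : (0:ℝ) ≤ Fintype.card T := by positivity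
            nlinarith
    rw [Real.rpow_natCast] at h2
    have h3 := h1.trans h2
    rw [Int.norm_eq_abs] at h3
    exact_mod_cast h3

end DG


namespace DG
open MvPolynomial

/-! ### Cubic surfaces monic in the variable `0` -/

/-- Affine cubic surfaces, irreducible over `ℚ`, with nonzero coefficient of `X₀³`. -/
def Surf (g : MvPolynomial (Fin 3) ℤ) : Prop :=
  g.totalDegree ≤ 3 ∧ coeff (Finsupp.single 0 3) g ≠ 0 ∧
    Irreducible (map (Int.castRingHom ℚ) g)

/-- Integer points in the box. -/
def Box {n : ℕ} (N : ℕ) (x : Fin n → ℤ) : Prop := ∀ i, |x i| ≤ N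

theorem Box.mem {n N : ℕ} {x : Fin n → ℤ} (h : Box N x) (i : Fin n) :
    x i ∈ Finset.Icc (-(N:ℤ)) N := Finset.mem_Icc.2 (abs_le.1 (h i))

theorem card_Icc_box (N : ℕ) : (Finset.Icc (-(N:ℤ)) N).card = 2 * N + 1 := by
  rw [Int.card_Icc]; omega

noncomputable abbrev qm {n : ℕ} (f : MvPolynomial (Fin n) ℤ) : MvPolynomial (Fin n) ℚ := map (Int.castRingHom ℚ) f

theorem td_qm_le {n : ℕ} (f : MvPolynomial (Fin n) ℤ) : (qm f).totalDegree ≤ f.totalDegree :=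
  Finset.sup_mono (support_map_subset (Int.castRingHom ℚ) f)

theorem eval_qm {n : ℕ} (x : Fin n → ℤ) (f : MvPolynomial (Fin n) ℤ) :
    eval (fun i => (x i : ℚ)) (qm f) = ((eval x f : ℤ) : ℚ) := by
  unfold qm
  induction f using MvPolynomial.induction_on with
  | C a => simp
  | add p q hp hq => simp only [map_add, hp, hq, Int.cast_add]
  | mul_X p i hp => simp only [map_mul, hp, map_X, eval_X, Int.cast_mul]

theorem qm_injective {n : ℕ} : Function.Injective (qm (n := n)) :=
  map_injective _ Int.cast_injective

theorem fse_coeff_three {g : MvPolynomial (Fin 3) ℤ} (hg : g.totalDegree ≤ 3) :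
    (finSuccEquiv ℤ 2 g).coeff 3 = C (coeff (Finsupp.single 0 3) g) := by
  have h1 : ((finSuccEquiv ℤ 2 g).coeff 3).totalDegree = 0 := by
    by_cases h : (finSuccEquiv ℤ 2 g).coeff 3 = 0
    · simp [h]
    · have := totalDegree_coeff_finSuccEquiv_add_le g 3 h
      omega
  rw [totalDegree_eq_zero_iff_eq_C] at h1
  rw [h1, finSuccEquiv_coeff_coeff]
  congr 2
  ext i
  refine Fin.cases ?_ (fun j => ?_) i
  · simp
  · simp

theorem Surf.natDegree {g : MvPolynomial (Fin 3) ℤ} (hg : Surf g) :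
    (finSuccEquiv ℤ 2 g).natDegree = 3 := by
  apply le_antisymm ((natDegree_fse_le g).trans hg.1)
  apply Polynomial.le_natDegree_of_ne_zero
  rw [fse_coeff_three hg.1]
  simpa using hg.2.1

theorem Surf.totalDegree_q {g : MvPolynomial (Fin 3) ℤ} (hg : Surf g) :
    (qm g).totalDegree = 3 := by
  apply le_antisymm ((td_qm_le _).trans hg.1)
  have : Finsupp.single 0 3 ∈ (qm g).support := by
    rw [mem_support_iff, coeff_map]
    simpa using hg.2.1
  have := le_totalDegree this
  simpa using this

theorem Surf.res_ne_zero {g h : MvPolynomial (Fin 3) ℤ} (hg : Surf g) (hnd : ¬ qm g ∣ qm h) :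
    Polynomial.resultant (finSuccEquiv ℤ 2 g) (finSuccEquiv ℤ 2 h) ≠ 0 := by
  have hinj : Function.Injective (map (Int.castRingHom ℚ) : MvPolynomial (Fin 2) ℤ →+* _) :=
    map_injective _ Int.cast_injective
  have h1 : Irreducible (finSuccEquiv ℚ 2 (qm g)) := (MulEquiv.irreducible_iff _).2 hg.2.2
  have hd : (finSuccEquiv ℚ 2 (qm g)).natDegree = 3 := by
    rw [fse_map, Polynomial.natDegree_map_eq_of_injective hinj, hg.natDegree]
  have h2 := DG.res_ne_zero (finSuccEquiv ℚ 2 (qm g)) (finSuccEquiv ℚ 2 (qm h)) h1 (by omega)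
    (by rwa [map_dvd_iff])
  rw [fse_map, fse_map, Polynomial.natDegree_map_eq_of_injective hinj,
    Polynomial.natDegree_map_eq_of_injective hinj, Polynomial.resultant_map_map] at h2
  intro h0
  exact h2 (by rw [h0, map_zero])

theorem Surf.res_vanish {K : Type*} [CommRing K] {g h : MvPolynomial (Fin 3) ℤ} (hg : Surf g)
    (x : Fin 3 → K) (h1 : aeval x g = 0) (h2 : aeval x h = 0) :
    aeval (Fin.tail x) (Polynomial.resultant (finSuccEquiv ℤ 2 g) (finSuccEquiv ℤ 2 h)) = 0 := by
  rw [aeval_fse] at h1 h2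
  exact DG.res_vanish _ _ _ _ (by rw [hg.natDegree]; norm_num) h1 h2

theorem Surf.res_deg {g h : MvPolynomial (Fin 3) ℤ} (hg : Surf g) {D : ℕ}
    (hh : h.totalDegree ≤ D) :
    (Polynomial.resultant (finSuccEquiv ℤ 2 g) (finSuccEquiv ℤ 2 h)).totalDegree ≤
      (3 + D) * (3 + D) := by
  refine (res_totalDegree (3 + D) _ _ (fun i => ?_) (fun i => ?_) _ _).trans ?_
  · have := totalDegree_coeff_fse_le g i
    have := hg.1
    omega
  · have := totalDegree_coeff_fse_le h i
    omega
  · apply Nat.mul_le_mul_right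
    rw [hg.natDegree]
    have := natDegree_fse_le h
    omega

theorem Surf.not_dvd {g h : MvPolynomial (Fin 3) ℤ} (hg : Surf g) (h0 : h ≠ 0)
    (hd : h.degreeOf 0 ≤ 2) : ¬ qm g ∣ qm h := by
  have hinj : Function.Injective (map (Int.castRingHom ℚ) : MvPolynomial (Fin 2) ℤ →+* _) :=
    map_injective _ Int.cast_injective
  rintro hdvd
  have h1 : finSuccEquiv ℚ 2 (qm g) ∣ finSuccEquiv ℚ 2 (qm h) := by rwa [map_dvd_iff]
  have h2 : finSuccEquiv ℚ 2 (qm h) ≠ 0 := by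
    rw [Ne, EmbeddingLike.map_eq_zero_iff]
    intro h; exact h0 (qm_injective (by rw [h]; simp [qm]))
  have h3 := Polynomial.natDegree_le_of_dvd h1 h2
  rw [fse_map, fse_map, Polynomial.natDegree_map_eq_of_injective hinj,
    Polynomial.natDegree_map_eq_of_injective hinj, hg.natDegree, natDegree_finSuccEquiv] at h3
  omega

theorem Surf.column {K : Type*} [CommRing K] [IsDomain K] [CharZero K]
    {g : MvPolynomial (Fin 3) ℤ} (hg : Surf g) (t : Fin 2 → K) (T : Finset K)
    (hT : ∀ z ∈ T, aeval (Fin.cons z t : Fin 3 → K) g = 0) : T.card ≤ 3 := by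
  classical
  let p := (finSuccEquiv ℤ 2 g).map (aeval t : MvPolynomial (Fin 2) ℤ →ₐ[ℤ] K).toRingHom
  have hp0 : p ≠ 0 := by
    intro h
    have : p.coeff 3 = 0 := by rw [h]; simp
    simp only [p, Polynomial.coeff_map, fse_coeff_three hg.1] at this
    simp at this
    exact hg.2.1 this
  have hd : p.natDegree ≤ 3 := Polynomial.natDegree_map_le.trans hg.natDegree.le
  have : T.val ≤ p.roots := by
    rw [Multiset.le_iff_subset T.nodup]
    intro z hz
    rw [Polynomial.mem_roots hp0, Polynomial.IsRoot, Polynomial.eval_map]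
    have h := hT z hz
    rw [aeval_fse] at h
    simpa using h
  calc T.card ≤ Multiset.card p.roots := Multiset.card_le_card this
    _ ≤ p.natDegree := p.card_roots'
    _ ≤ 3 := hd

theorem Surf.column_int {g : MvPolynomial (Fin 3) ℤ} (hg : Surf g) (t : Fin 2 → ℤ)
    (T : Finset (Fin 3 → ℤ)) (hT : ∀ x ∈ T, eval x g = 0 ∧ Fin.tail x = t) : T.card ≤ 3 := by
  classical
  have h1 : (T.image (fun x => x 0)).card ≤ 3 := by
    apply hg.column t
    intro z hz
    obtain ⟨x, hx, rfl⟩ := Finset.mem_image.1 hz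
    rw [← (hT x hx).2, Fin.cons_self_tail, aeval_eq_eval]
    exact (hT x hx).1
  rwa [Finset.card_image_of_injOn] at h1
  intro x hx y hy hxy
  rw [← Fin.cons_self_tail x, ← Fin.cons_self_tail y, (hT x hx).2, (hT y hy).2]
  simp only at hxy
  rw [hxy]

/-- Trivial bound for the intersection of a surface with another surface. -/
theorem Surf.t1 {g h : MvPolynomial (Fin 3) ℤ} (hg : Surf g) (hnd : ¬ qm g ∣ qm h) {D N : ℕ}
    (hD : h.totalDegree ≤ D) (T : Finset (Fin 3 → ℤ))
    (hT : ∀ x ∈ T, Box N x ∧ eval x g = 0 ∧ eval x h = 0) :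
    T.card ≤ 3 * ((3 + D) * (3 + D)) * (2 * N + 1) := by
  classical
  have h1 : (T.image Fin.tail).card ≤ ((3 + D) * (3 + D)) * (2 * N + 1) := by
    have := sz_count _ (hg.res_ne_zero hnd) (Finset.Icc (-(N:ℤ)) N)
      (T.image Fin.tail) (by
      intro y hy
      obtain ⟨x, hx, rfl⟩ := Finset.mem_image.1 hy
      obtain ⟨hb, h1, h2⟩ := hT x hx
      refine ⟨fun i => hb.mem i.succ, ?_⟩
      have := hg.res_vanish (K := ℤ) x (by rwa [aeval_eq_eval]) (h := h) (by rwa [aeval_eq_eval])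
      rwa [aeval_eq_eval] at this)
    rw [card_Icc_box, pow_one] at this
    exact this.trans (Nat.mul_le_mul_right _ (hg.res_deg hD))
  have h2 := Finset.card_le_mul_card_image T 3 (f := Fin.tail) (by
    intro b _
    apply hg.column_int b
    intro x hx
    rw [Finset.mem_filter] at hx
    exact ⟨(hT x hx.1).2.1, hx.2⟩)
  calc _ ≤ _ := h2
    _ ≤ 3 * (((3 + D) * (3 + D)) * (2 * N + 1)) := Nat.mul_le_mul_left _ h1
    _ = _ := by ring

/-- Trivial bound for the number of points of a surface. -/
theorem Surf.t0 {g : MvPolynomial (Fin 3) ℤ} (hg : Surf g) {N : ℕ} (T : Finset (Fin 3 → ℤ))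
    (hT : ∀ x ∈ T, Box N x ∧ eval x g = 0) : T.card ≤ 3 * (2 * N + 1) ^ 2 := by
  classical
  have h1 : (T.image Fin.tail).card ≤ (2 * N + 1) ^ 2 := by
    have : T.image Fin.tail ⊆ Fintype.piFinset (fun _ : Fin 2 => Finset.Icc (-(N:ℤ)) N) := by
      intro y hy
      obtain ⟨x, hx, rfl⟩ := Finset.mem_image.1 hy
      rw [Fintype.mem_piFinset]
      exact fun i => (hT x hx).1.mem i.succ
    have := Finset.card_le_card this
    rw [Fintype.card_piFinset] at this
    simp only [card_Icc_box, Finset.prod_const, Finset.card_univ, Fintype.card_fin] at this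
    exact this
  have h2 := Finset.card_le_mul_card_image T 3 (f := Fin.tail) (by
    intro b _
    apply hg.column_int b
    intro x hx
    rw [Finset.mem_filter] at hx
    exact ⟨(hT x hx.1).2, hx.2⟩)
  exact h2.trans (Nat.mul_le_mul_left _ h1)

/-- Degree considerations: a multiple of `g` of degree at most `3` is proportional to `g`. -/
theorem Surf.dvd_const {g h : MvPolynomial (Fin 3) ℤ} (hg : Surf g) (h0 : h ≠ 0)
    (hd : h.totalDegree ≤ 3) (hdvd : qm g ∣ qm h) : ∃ l : ℚ, l ≠ 0 ∧ qm h = C l * qm g := by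
  obtain ⟨q, hq⟩ := hdvd
  have hq0 : qm h ≠ 0 := by
    intro h; exact h0 (qm_injective (by rw [h]; simp [qm]))
  have hg0 : qm g ≠ 0 := hg.2.2.ne_zero
  have hqn : q ≠ 0 := by rintro rfl; simp at hq; exact hq0 hq
  have h1 := totalDegree_mul_of_isDomain hg0 hqn
  rw [← hq, hg.totalDegree_q] at h1
  have h2 : (qm h).totalDegree ≤ 3 := (td_qm_le _).trans hd
  have h3 : q.totalDegree = 0 := by omega
  rw [totalDegree_eq_zero_iff_eq_C] at h3
  refine ⟨coeff 0 q, ?_, ?_⟩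
  · intro h; rw [h, map_zero] at h3; exact hqn h3
  · rw [hq, ← h3, mul_comm]

theorem surf_support_card {g : MvPolynomial (Fin 3) ℤ} (hg : g.totalDegree ≤ 3) :
    g.support.card ≤ 64 := by
  classical
  have h : (g.support.image (fun e : Fin 3 →₀ ℕ => (⇑e : Fin 3 → ℕ))) ⊆
      Fintype.piFinset (fun _ : Fin 3 => Finset.range 4) := by
    intro f hf
    obtain ⟨e, he, rfl⟩ := Finset.mem_image.1 hf
    rw [Fintype.mem_piFinset]
    intro i
    have h1 := le_totalDegree he
    rw [Finsupp.sum_fintype _ _ (by simp)] at h1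
    have h2 := Finset.single_le_sum (f := fun i => e i) (fun _ _ => Nat.zero_le _) (Finset.mem_univ i)
    rw [Finset.mem_range]
    omega
  have h2 := Finset.card_le_card h
  rw [Finset.card_image_of_injective _ DFunLike.coe_injective] at h2
  simpa using h2

theorem eval_monomial_le {N D : ℕ} (hN : 1 ≤ N) {n : ℕ} {x : Fin n → ℤ} (hx : Box N x)
    (e : Fin n →₀ ℕ) (he : ∑ i, e i ≤ D) : |∏ i, x i ^ e i| ≤ (N:ℤ) ^ D := by
  rw [Finset.abs_prod]
  calc ∏ i, |x i ^ e i| ≤ ∏ i, (N:ℤ) ^ e i := by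
        apply Finset.prod_le_prod (fun i _ => abs_nonneg _)
        intro i _
        rw [abs_pow]
        exact pow_le_pow_left₀ (abs_nonneg _) (hx i) _
    _ = (N:ℤ) ^ (∑ i, e i) := Finset.prod_pow_eq_pow_sum _ _ _
    _ ≤ _ := pow_le_pow_right₀ (by exact_mod_cast hN) he

/-- Reduction to small height. -/
theorem Surf.small_height {g : MvPolynomial (Fin 3) ℤ} (hg : Surf g) {N : ℕ} (hN : 1 ≤ N)
    (T : Finset (Fin 3 → ℤ)) (hT : ∀ x ∈ T, Box N x ∧ eval x g = 0) :
    T.card ≤ 108 * (2 * N + 1) ∨ ∃ g0, Surf g0 ∧ (∀ x : Fin 3 → ℤ, eval x g0 = 0 ↔ eval x g = 0) ∧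
      ∀ e, |coeff e g0| ≤ (((64 * N ^ 3) ^ 64 : ℕ) : ℤ) := by
  classical
  let β := {e // e ∈ g.support}
  let q : (Fin 3 → ℤ) → (β → ℤ) := fun x e => ∏ i, x i ^ (e.1 i)
  have hdeg : ∀ e ∈ g.support, ∑ i, e i ≤ 3 := by
    intro e he
    have h1 := le_totalDegree he
    rw [Finsupp.sum_fintype _ _ (by simp)] at h1
    exact h1.trans hg.1
  have hg0 : g ≠ 0 := by rintro rfl; exact hg.2.1 (by simp)
  have hev : ∀ x, eval x g = ∑ e : β, coeff e.1 g * q x e := by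
    intro x
    rw [eval_eq', ← Finset.sum_coe_sort]
  obtain ⟨a, ha0, hav, hab⟩ := siegel (T.image q) (N ^ 3) (Nat.one_le_pow _ _ hN) (by
    intro v hv b
    obtain ⟨x, hx, rfl⟩ := Finset.mem_image.1 hv
    have := eval_monomial_le hN (hT x hx).1 b.1 (hdeg _ b.2)
    exact_mod_cast this) (fun e : β => ((coeff e.1 g : ℤ) : ℚ)) (by
    intro h
    obtain ⟨e, he⟩ := support_nonempty.2 hg0
    have := congrFun h ⟨e, he⟩
    simp only [Pi.zero_apply, Int.cast_eq_zero] at this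
    exact (mem_support_iff.1 he) this) (by
    intro v hv
    obtain ⟨x, hx, rfl⟩ := Finset.mem_image.1 hv
    have h1 := (hT x hx).2
    rw [hev] at h1
    exact_mod_cast h1)
  let g0 : MvPolynomial (Fin 3) ℤ := ∑ e : β, monomial e.1 (a e)
  have hc : ∀ e, coeff e g0 = if h : e ∈ g.support then a ⟨e, h⟩ else 0 := by
    intro e
    simp only [g0, coeff_sum, coeff_monomial]
    split_ifs with h
    · rw [Finset.sum_eq_single ⟨e, h⟩]
      · simp
      · rintro b - hb
        rw [if_neg]
        rintro rfl
        exact hb rfl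
      · simp
    · apply Finset.sum_eq_zero
      intro b _
      rw [if_neg]
      rintro rfl
      exact h b.2
  have hg00 : g0 ≠ 0 := by
    intro h
    apply ha0
    funext e
    have := hc e.1
    rw [h, dif_pos e.2] at this
    simpa using this.symm
  have hev0 : ∀ x, eval x g0 = ∑ e : β, a e * q x e := by
    intro x
    simp only [g0, map_sum, eval_monomial, q]
    refine Finset.sum_congr rfl (fun e _ => ?_)
    rw [Finsupp.prod_fintype _ _ (by simp)]
  have hd0 : g0.totalDegree ≤ 3 := by
    apply totalDegree_finsetSum_le
    intro e _
    refine (totalDegree_monomial_le _ _).trans ?_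
    have := hdeg e.1 e.2
    rw [Finsupp.sum_fintype _ _ (by simp)]
    exact this
  by_cases hdvd : qm g ∣ qm g0
  · right
    obtain ⟨l, hl, hlg⟩ := hg.dvd_const hg00 hd0 hdvd
    have hco : ∀ e, ((coeff e g0 : ℤ) : ℚ) = l * (coeff e g : ℤ) := by
      intro e
      have := congrArg (coeff e) hlg
      simpa [qm, coeff_map] using this
    refine ⟨g0, ⟨hd0, ?_, ?_⟩, ?_, ?_⟩
    · intro h
      have := hco (Finsupp.single 0 3)
      rw [h] at this
      simp only [Int.cast_zero, zero_eq_mul, hl, false_or, Int.cast_eq_zero] at this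
      exact hg.2.1 this
    · have : Associated (qm g) (qm g0) := by
        rw [hlg]
        have hu : IsUnit (C l : MvPolynomial (Fin 3) ℚ) := (isUnit_iff_ne_zero.2 hl).map C
        exact (associated_isUnit_mul_right_iff hu).2 (Associated.refl _)
      exact this.irreducible hg.2.2
    · intro x
      have h1 := congrArg (eval (fun i => (x i : ℚ))) hlg
      rw [map_mul, eval_C, eval_qm, eval_qm] at h1
      constructor
      · intro h
        rw [h] at h1
        simp only [Int.cast_zero, zero_eq_mul, hl, false_or, Int.cast_eq_zero] at h1
        exact h1
      · intro h
        rw [h] at h1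
        simpa using h1
    · intro e
      rw [hc]
      split_ifs with h
      · refine (hab _).trans ?_
        have h1 : Fintype.card β ≤ 64 := by
          rw [Fintype.card_coe]; exact surf_support_card hg.1
        have h2 : 1 ≤ N ^ 3 := Nat.one_le_pow _ _ hN
        have : (Fintype.card β * N ^ 3) ^ (Fintype.card β) ≤ (64 * N ^ 3) ^ 64 :=
          (Nat.pow_le_pow_left (Nat.mul_le_mul_right _ h1) _).trans
            (Nat.pow_le_pow_right (by omega) h1)
        exact_mod_cast this
      · simp
  · left
    have := hg.t1 hdvd hd0 T (N := N) (by
      intro x hx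
      refine ⟨(hT x hx).1, (hT x hx).2, ?_⟩
      rw [hev0]
      exact hav _ (Finset.mem_image_of_mem _ hx))
    omega

end DG


namespace DG
open MvPolynomial

theorem eval_cong {n : ℕ} (m : ℤ) (x y : Fin n → ℤ) (h : ∀ i, m ∣ x i - y i)
    (f : MvPolynomial (Fin n) ℤ) : m ∣ eval x f - eval y f := by
  induction f using MvPolynomial.induction_on with
  | C a => simp
  | add p q hp hq =>
    simp only [map_add]
    have := dvd_add hp hq
    ring_nf at this ⊢
    exact this
  | mul_X p i hp =>
    simp only [map_mul, eval_X]
    have h1 : eval x p * x i - eval y p * y i = (eval x p - eval y p) * x i + eval y p * (x i - y i) := by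
      ring
    rw [h1]
    exact dvd_add (Dvd.dvd.mul_right hp _) (Dvd.dvd.mul_left (h i) _)

theorem fse_pderiv {n : ℕ} (f : MvPolynomial (Fin (n+1)) ℤ) :
    finSuccEquiv ℤ n (pderiv 0 f) = (finSuccEquiv ℤ n f).derivative := by
  induction f using MvPolynomial.induction_on with
  | C a => simp
  | add p q hp hq => simp only [map_add, hp, hq]
  | mul_X p i hp =>
    have hX : finSuccEquiv ℤ n (pderiv 0 (X i)) =
        Polynomial.derivative (finSuccEquiv ℤ n (X i)) := by
      refine Fin.cases ?_ (fun j => ?_) i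
      · rw [pderiv_X_self, map_one, finSuccEquiv_X_zero, Polynomial.derivative_X]
      · rw [pderiv_X_of_ne (Fin.succ_ne_zero j), map_zero, finSuccEquiv_X_succ,
          Polynomial.derivative_C]
    have e1 : pderiv 0 (p * X i) = pderiv 0 p * X i + p * pderiv 0 (X i) := pderiv_mul
    have e2 : finSuccEquiv ℤ n (p * X i) = finSuccEquiv ℤ n p * finSuccEquiv ℤ n (X i) :=
      map_mul _ _ _
    have e3 : finSuccEquiv ℤ n (pderiv 0 p * X i + p * pderiv 0 (X i)) =
      finSuccEquiv ℤ n (pderiv 0 p) * finSuccEquiv ℤ n (X i) +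
        finSuccEquiv ℤ n p * finSuccEquiv ℤ n (pderiv 0 (X i)) := by
      rw [map_add (finSuccEquiv ℤ n), map_mul (finSuccEquiv ℤ n), map_mul (finSuccEquiv ℤ n)]
    rw [e1, e2, e3, Polynomial.derivative_mul, hp, hX]

/-- The auxiliary polynomial for points in one residue class. -/
theorem aux {d t : ℕ} (G : MvPolynomial (Fin (d+1)) ℤ) (m : ℕ) (hm : 0 < m)
    (T : Finset (Fin (d+1) → ℤ)) (κ : Fin (d+1) → ℤ) (hz : ∀ x ∈ T, eval x G = 0)
    (hcong : ∀ x ∈ T, ∀ i, (m:ℤ) ∣ x i - κ i)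
    (hcop : ∀ x ∈ T, IsCoprime (eval x (pderiv 0 G)) (m:ℤ))
    (E : Finset (Fin (d+1) →₀ ℕ)) (N D : ℕ) (hN : 1 ≤ N) (hbox : ∀ x ∈ T, Box N x)
    (hE : ∀ e ∈ E, ∑ i, e i ≤ D) (hEne : E.Nonempty) (ht : 0 < t)
    (h1 : E.card * N ^ D < m ^ t)
    (h2 : m ^ (∑ α : Fin d → Fin t, (t - ∑ i, (α i : ℕ))) ≤ N ^ (∑ e ∈ E, (D - ∑ i, e i))) :
    ∃ h : MvPolynomial (Fin (d+1)) ℤ, h ≠ 0 ∧ h.support ⊆ E ∧ (∀ e, |coeff e h| ≤ (N:ℤ) ^ D) ∧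
      ∀ x ∈ T, eval x h = 0 := by
  classical
  let ι := {x // x ∈ T}
  let J := {e // e ∈ E}
  -- common inverse
  obtain ⟨c, hc⟩ : ∃ c : ℤ, ∀ x ∈ T, (m:ℤ) ∣ 1 - c * eval x (pderiv 0 G) := by
    rcases T.eq_empty_or_nonempty with rfl | ⟨x0, hx0⟩
    · exact ⟨0, by simp⟩
    · obtain ⟨a, b, hab⟩ := hcop x0 hx0
      refine ⟨a, fun x hx => ?_⟩
      have h3 : (m:ℤ) ∣ eval x0 (pderiv 0 G) - eval x (pderiv 0 G) := by
        apply eval_cong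
        intro i
        have := dvd_sub (hcong x0 hx0 i) (hcong x hx i)
        simpa using this
      obtain ⟨k, hk⟩ := h3
      exact ⟨b + a * k, by linear_combination (-1 : ℤ) * hab + a * hk⟩
  obtain ⟨ψ, hψ⟩ := newton (ι := ι) (fun P => (eval (Fin.tail P.1) : MvPolynomial (Fin d) ℤ →+* ℤ))
    (finSuccEquiv ℤ d G) (fun P => P.1 0) (m:ℤ) c (κ 0)
    (by
      intro P
      have := hz P.1 P.2
      rw [eval_fse] at this
      rw [Polynomial.eval_map]; exact this)
    (by
      intro P
      rw [dvd_sub_comm]; exact hcong P.1 P.2 0)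
    (by
      intro P
      have := hc P.1 P.2
      rw [eval_fse, fse_pderiv] at this
      rw [Polynomial.derivative_map, Polynomial.eval_map]; exact this) (t-1)
  have htt : t - 1 + 1 = t := by omega
  rw [htt] at hψ
  obtain ⟨a, ha0, hab, hav⟩ := pigeon (d := d) (t := t) (ι := ι) (J := J) m hm
    (fun e => ψ ^ (e.1 0) * ∏ i : Fin d, X i ^ (e.1 i.succ)) (fun P => Fin.tail P.1) (Fin.tail κ)
    (fun P i => hcong P.1 P.2 i.succ) (fun e P => ∏ i, P.1 i ^ (e.1 i))
    (by
      intro e P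
      have h3 : eval (Fin.tail P.1) (ψ ^ (e.1 0) * ∏ i : Fin d, X i ^ (e.1 i.succ)) =
          (eval (Fin.tail P.1) ψ) ^ (e.1 0) * ∏ i : Fin d, P.1 i.succ ^ (e.1 i.succ) := by
        simp [map_prod, Fin.tail]
      simp only [h3]
      rw [Fin.prod_univ_succ, ← sub_mul]
      apply Dvd.dvd.mul_right
      have h4 := hψ P
      rw [dvd_sub_comm] at h4
      exact h4.trans (sub_dvd_pow_sub_pow _ _ _))
    (fun e => N ^ (D - ∑ i, e.1 i)) (fun e => N ^ (∑ i, e.1 i))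
    (by
      intro e P
      have := eval_monomial_le hN (hbox P.1 P.2) e.1 le_rfl
      exact_mod_cast this)
    (by
      refine h2.trans_lt ?_
      rw [← Finset.prod_pow_eq_pow_sum, ← Finset.prod_coe_sort]
      apply Finset.prod_lt_prod_of_nonempty
      · intro i _; positivity
      · intro i _; exact Nat.lt_succ_self _
      · obtain ⟨e, he⟩ := hEne
        exact ⟨⟨e, he⟩, Finset.mem_univ _⟩)
    (by
      refine lt_of_le_of_lt (le_of_eq ?_) h1
      have : ∀ e : J, N ^ (D - ∑ i, e.1 i) * N ^ (∑ i, e.1 i) = N ^ D := by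
        intro e
        rw [← pow_add, Nat.sub_add_cancel (hE e.1 e.2)]
      simp only [this, Finset.sum_const, Finset.card_univ, smul_eq_mul]
      rw [Fintype.card_coe])
  let h : MvPolynomial (Fin (d+1)) ℤ := ∑ e : J, monomial e.1 (a e)
  have hco : ∀ e, coeff e h = if h : e ∈ E then a ⟨e, h⟩ else 0 := by
    intro e
    simp only [h, coeff_sum, coeff_monomial]
    split_ifs with h
    · rw [Finset.sum_eq_single ⟨e, h⟩]
      · simp
      · rintro b - hb
        rw [if_neg]
        rintro rfl
        exact hb rfl
      · simp
    · apply Finset.sum_eq_zero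
      intro b _
      rw [if_neg]
      rintro rfl
      exact h b.2
  refine ⟨h, ?_, ?_, ?_, ?_⟩
  · intro h0
    apply ha0
    funext e
    have := hco e.1
    rw [h0, dif_pos e.2] at this
    simpa using this.symm
  · intro e he
    rw [mem_support_iff, hco] at he
    by_contra h3
    rw [dif_neg h3] at he
    exact he rfl
  · intro e
    rw [hco]
    split_ifs with h3
    · refine (hab _).trans ?_
      have : N ^ (D - ∑ i, e i) ≤ N ^ D := Nat.pow_le_pow_right hN (by omega)
      exact_mod_cast this
    · simp
  · intro x hx
    have := hav ⟨x, hx⟩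
    rw [← this]
    simp only [h, map_sum, eval_monomial]
    refine Finset.sum_congr rfl (fun e _ => ?_)
    rw [Finsupp.prod_fintype _ _ (by simp)]

/-! ### Sums -/

theorem sum_tri (c t : ℕ) (h : c ≤ t) : 2 * ∑ b ∈ Finset.range t, (c - b) = c * (c+1) := by
  have h1 : ∑ b ∈ Finset.range t, (c - b) = ∑ b ∈ Finset.range c, (c - b) := by
    symm
    apply Finset.sum_subset (Finset.range_mono h)
    intro x _ hx
    rw [Finset.mem_range] at hx
    omega
  rw [h1]
  clear h1 h
  induction c with
  | zero => simp
  | succ c ih =>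
    rw [Finset.sum_range_succ']
    have : ∑ k ∈ Finset.range c, (c + 1 - (k + 1)) = ∑ k ∈ Finset.range c, (c - k) :=
      Finset.sum_congr rfl (fun k _ => by omega)
    rw [this, mul_add, ih]
    simp only [Nat.sub_zero]
    ring

theorem sum_tet (t : ℕ) : 6 * ∑ a ∈ Finset.range t, ∑ b ∈ Finset.range t, (t - (a + b)) =
    t * (t+1) * (t+2) := by
  have h1 : 2 * ∑ a ∈ Finset.range t, ∑ b ∈ Finset.range t, (t - (a + b)) =
      ∑ a ∈ Finset.range t, (t - a) * (t - a + 1) := by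
    rw [Finset.mul_sum]
    refine Finset.sum_congr rfl (fun a _ => ?_)
    have h2 := sum_tri (t - a) t (by omega)
    rw [← h2]
    congr 1
    exact Finset.sum_congr rfl (fun b _ => by omega)
  have h2 : 3 * ∑ a ∈ Finset.range t, (t - a) * (t - a + 1) = t * (t+1) * (t+2) := by
    clear h1
    induction t with
    | zero => simp
    | succ t ih =>
      rw [Finset.sum_range_succ']
      have : ∑ k ∈ Finset.range t, (t + 1 - (k + 1)) * (t + 1 - (k + 1) + 1) =
          ∑ k ∈ Finset.range t, (t - k) * (t - k + 1) :=
        Finset.sum_congr rfl (fun k _ => by rw [show t + 1 - (k+1) = t - k by omega])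
      rw [this, mul_add, ih]
      simp only [Nat.sub_zero]
      ring
  omega

theorem sum_alpha_one (t : ℕ) : 2 * ∑ α : Fin 1 → Fin t, (t - ∑ i, (α i : ℕ)) = t * (t+1) := by
  rw [← sum_tri t t le_rfl, Finset.sum_range]
  congr 1
  refine Fintype.sum_equiv (Equiv.funUnique (Fin 1) (Fin t)) _ _ (fun α => ?_)
  simp

theorem sum_alpha_two (t : ℕ) : 6 * ∑ α : Fin 2 → Fin t, (t - ∑ i, (α i : ℕ)) =
    t * (t+1) * (t+2) := by
  rw [← sum_tet t, Finset.sum_range]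
  congr 1
  rw [Fintype.sum_equiv (finTwoArrowEquiv (Fin t)) _
    (fun p => (t - ((p.1 : ℕ) + p.2))) (fun α => by simp [Fin.sum_univ_two]), Fintype.sum_prod_type]
  refine Finset.sum_congr rfl (fun a _ => ?_)
  rw [Finset.sum_range]

end DG


namespace DG
open MvPolynomial

theorem assoc_pm {n : ℕ} {p q : MvPolynomial (Fin n) ℤ} (h : Associated p q) : q = p ∨ q = -p := by
  obtain ⟨u, hu⟩ := h
  have h1 := MvPolynomial.isUnit_iff_eq_C_of_isReduced.1 u.isUnit
  obtain ⟨r, hr, hru⟩ := h1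
  rcases Int.isUnit_iff.1 hr with rfl | rfl
  · left; rw [← hu, hru]; simp
  · right; rw [← hu, hru]; simp

theorem totalDegree_multiset_prod {n : ℕ} (s : Multiset (MvPolynomial (Fin n) ℤ)) (hs : (0 : MvPolynomial (Fin n) ℤ) ∉ s) :
    s.prod.totalDegree = (s.map totalDegree).sum := by
  induction s using Multiset.induction with
  | empty => simp
  | cons a s ih =>
    rw [Multiset.mem_cons, not_or] at hs
    rw [Multiset.prod_cons, totalDegree_mul_of_isDomain (Ne.symm hs.1) (by
      rw [Ne, Multiset.prod_eq_zero_iff]; exact hs.2), ih hs.2, Multiset.map_cons, Multiset.sum_cons]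

theorem totalDegree_eq_of_assoc {n : ℕ} {p q : MvPolynomial (Fin n) ℤ} (h : Associated p q) :
    p.totalDegree = q.totalDegree := by
  rcases assoc_pm h with rfl | rfl
  · rfl
  · rw [totalDegree_neg]

/-- Bounded number of relevant irreducible factors. -/
theorem factor_cover {α : Type*} {n : ℕ} (R : MvPolynomial (Fin n) ℤ) (hR : R ≠ 0) (B k : ℕ)
    (hB : R.totalDegree ≤ B) (T : Finset α) (pt : α → Fin n → ℤ)
    (Q : MvPolynomial (Fin n) ℤ → α → Prop) (hQ : ∀ p P, Q p P → Q (-p) P)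
    (hT : ∀ P ∈ T, ∃ p, Irreducible p ∧ p ∣ R ∧ eval (pt P) p = 0 ∧ Q p P)
    (hk : ∀ p, Irreducible p → p ∣ R → ∀ T' ⊆ T, (∀ P ∈ T', eval (pt P) p = 0 ∧ Q p P) →
      T'.card ≤ k) : T.card ≤ B * k := by
  classical
  let F := (UniqueFactorizationMonoid.factors R).filter (fun p => p.totalDegree ≠ 0)
  have h0 : (0 : MvPolynomial (Fin n) ℤ) ∉ UniqueFactorizationMonoid.factors R :=
    fun h => (UniqueFactorizationMonoid.irreducible_of_factor _ h).ne_zero rfl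
  have hF : F.toFinset.card ≤ B := by
    refine (Multiset.toFinset_card_le _).trans (le_trans ?_ hB)
    rw [← totalDegree_eq_of_assoc (UniqueFactorizationMonoid.factors_prod hR),
      totalDegree_multiset_prod _ h0]
    have h1 : (F.map totalDegree).sum ≤ ((UniqueFactorizationMonoid.factors R).map totalDegree).sum := by
      conv_rhs => rw [← Multiset.filter_add_not (fun p => p.totalDegree ≠ 0) (UniqueFactorizationMonoid.factors R),
        Multiset.map_add, Multiset.sum_add]
      exact Nat.le_add_right _ _
    refine le_trans ?_ h1
    have h2 := Multiset.card_nsmul_le_sum (s := F.map totalDegree) (a := 1) (by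
      intro x hx
      obtain ⟨p, hp, rfl⟩ := Multiset.mem_map.1 hx
      have := (Multiset.mem_filter.1 hp).2
      omega)
    simpa using h2
  have hcov : T ⊆ F.toFinset.biUnion (fun p => T.filter (fun P => eval (pt P) p = 0 ∧ Q p P)) := by
    intro P hP
    obtain ⟨p, hp, hpR, hp0, hpQ⟩ := hT P hP
    obtain ⟨q, hq, hpq⟩ := UniqueFactorizationMonoid.exists_mem_factors_of_dvd hR hp hpR
    have hq2 : eval (pt P) q = 0 ∧ Q q P := by
      rcases assoc_pm hpq with rfl | rfl
      · exact ⟨hp0, hpQ⟩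
      · exact ⟨by rw [map_neg, hp0, neg_zero], hQ _ _ hpQ⟩
    rw [Finset.mem_biUnion]
    refine ⟨q, ?_, Finset.mem_filter.2 ⟨hP, hq2⟩⟩
    rw [Multiset.mem_toFinset, Multiset.mem_filter]
    refine ⟨hq, fun h => ?_⟩
    rw [totalDegree_eq_zero_iff_eq_C] at h
    have h3 := hq2.1
    rw [h, eval_C] at h3
    rw [h3, C_0] at h
    rw [h] at hq
    exact h0 hq
  calc T.card ≤ _ := Finset.card_le_card hcov
    _ ≤ F.toFinset.card * k := by
      apply Finset.card_biUnion_le_card_mul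
      intro p hp
      have hp1 := (Multiset.mem_filter.1 (Multiset.mem_toFinset.1 hp)).1
      exact hk p (UniqueFactorizationMonoid.irreducible_of_factor _ hp1)
        (UniqueFactorizationMonoid.dvd_of_mem_factors hp1) _ (Finset.filter_subset _ _)
        (fun P hP => (Finset.mem_filter.1 hP).2)
    _ ≤ _ := Nat.mul_le_mul_right _ hF

/-- Siegel for polynomials. -/
theorem siegel_poly {n N D : ℕ} (hN : 1 ≤ N) (g : MvPolynomial (Fin n) ℤ) (hg0 : g ≠ 0)
    (hD : g.totalDegree ≤ D) (T : Finset (Fin n → ℤ)) (hT : ∀ x ∈ T, Box N x ∧ eval x g = 0) :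
    ∃ g0 : MvPolynomial (Fin n) ℤ, g0 ≠ 0 ∧ g0.support ⊆ g.support ∧ (∀ x ∈ T, eval x g0 = 0) ∧
      ∀ e, |coeff e g0| ≤ (((g.support.card * N ^ D) ^ g.support.card : ℕ) : ℤ) := by
  classical
  let β := {e // e ∈ g.support}
  let q : (Fin n → ℤ) → (β → ℤ) := fun x e => ∏ i, x i ^ (e.1 i)
  have hdeg : ∀ e ∈ g.support, ∑ i, e i ≤ D := by
    intro e he
    have h1 := le_totalDegree he
    rw [Finsupp.sum_fintype _ _ (by simp)] at h1
    exact h1.trans hD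
  have hev : ∀ x, eval x g = ∑ e : β, coeff e.1 g * q x e := by
    intro x
    rw [eval_eq', ← Finset.sum_coe_sort]
  obtain ⟨a, ha0, hav, hab⟩ := siegel (T.image q) (N ^ D) (Nat.one_le_pow _ _ hN) (by
    intro v hv b
    obtain ⟨x, hx, rfl⟩ := Finset.mem_image.1 hv
    have := eval_monomial_le hN (hT x hx).1 b.1 (hdeg _ b.2)
    exact_mod_cast this) (fun e : β => ((coeff e.1 g : ℤ) : ℚ)) (by
    intro h
    obtain ⟨e, he⟩ := support_nonempty.2 hg0
    have := congrFun h ⟨e, he⟩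
    simp only [Pi.zero_apply, Int.cast_eq_zero] at this
    exact (mem_support_iff.1 he) this) (by
    intro v hv
    obtain ⟨x, hx, rfl⟩ := Finset.mem_image.1 hv
    have h1 := (hT x hx).2
    rw [hev] at h1
    exact_mod_cast h1)
  let g0 : MvPolynomial (Fin n) ℤ := ∑ e : β, monomial e.1 (a e)
  have hc : ∀ e, coeff e g0 = if h : e ∈ g.support then a ⟨e, h⟩ else 0 := by
    intro e
    simp only [g0, coeff_sum, coeff_monomial]
    split_ifs with h
    · rw [Finset.sum_eq_single ⟨e, h⟩]
      · simp
      · rintro b - hb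
        rw [if_neg]
        rintro rfl
        exact hb rfl
      · simp
    · apply Finset.sum_eq_zero
      intro b _
      rw [if_neg]
      rintro rfl
      exact h b.2
  have hg00 : g0 ≠ 0 := by
    intro h
    apply ha0
    funext e
    have := hc e.1
    rw [h, dif_pos e.2] at this
    simpa using this.symm
  have hev0 : ∀ x, eval x g0 = ∑ e : β, a e * q x e := by
    intro x
    simp only [g0, map_sum, eval_monomial, q]
    refine Finset.sum_congr rfl (fun e _ => ?_)
    rw [Finsupp.prod_fintype _ _ (by simp)]
  refine ⟨g0, hg00, ?_, ?_, ?_⟩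
  · intro e he
    by_contra h
    rw [mem_support_iff, hc, dif_neg h] at he
    exact he rfl
  · intro x hx
    rw [hev0]
    exact hav _ (Finset.mem_image_of_mem _ hx)
  · intro e
    rw [hc]
    split_ifs with h
    · refine (hab _).trans ?_
      rw [Fintype.card_coe]
    · rw [abs_zero]; positivity

theorem support_card_le {n D : ℕ} (g : MvPolynomial (Fin n) ℤ) (hg : g.totalDegree ≤ D) :
    g.support.card ≤ (D+1)^n := by
  classical
  have h : (g.support.image (fun e : Fin n →₀ ℕ => (⇑e : Fin n → ℕ))) ⊆
      Fintype.piFinset (fun _ : Fin n => Finset.range (D+1)) := by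
    intro f hf
    obtain ⟨e, he, rfl⟩ := Finset.mem_image.1 hf
    rw [Fintype.mem_piFinset]
    intro i
    have h1 := le_totalDegree he
    rw [Finsupp.sum_fintype _ _ (by simp)] at h1
    have h2 : e i ≤ ∑ i, e i := Finset.single_le_sum (fun _ _ => Nat.zero_le _) (Finset.mem_univ i)
    rw [Finset.mem_range]
    omega
  have h2 := Finset.card_le_card h
  rw [Finset.card_image_of_injective _ DFunLike.coe_injective] at h2
  simpa using h2

theorem eval_bound {n N D A : ℕ} (hN : 1 ≤ N) (g : MvPolynomial (Fin n) ℤ)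
    (hD : g.totalDegree ≤ D) (hA : ∀ e, |coeff e g| ≤ A) (x : Fin n → ℤ) (hx : Box N x) :
    |eval x g| ≤ (((D+1)^n * (A * N ^ D) : ℕ) : ℤ) := by
  rw [eval_eq']
  refine (Finset.abs_sum_le_sum_abs _ _).trans ?_
  have h1 : ∀ e ∈ g.support, |coeff e g * ∏ i, x i ^ e i| ≤ ((A * N ^ D : ℕ) : ℤ) := by
    intro e he
    rw [abs_mul]
    have h1 := le_totalDegree he
    rw [Finsupp.sum_fintype _ _ (by simp)] at h1
    push_cast
    exact mul_le_mul (hA e) (eval_monomial_le hN hx e (h1.trans hD)) (abs_nonneg _) (by positivity)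
  refine (Finset.sum_le_card_nsmul _ _ _ h1).trans ?_
  rw [nsmul_eq_mul]
  have := Nat.mul_le_mul_right (A * N ^ D) (support_card_le g hD)
  exact_mod_cast this

theorem td_pderiv_le {n : ℕ} (i : Fin n) (g : MvPolynomial (Fin n) ℤ) :
    (pderiv i g).totalDegree ≤ g.totalDegree := by
  apply Finset.sup_le
  intro e he
  rw [mem_support_iff, coeff_pderiv] at he
  have h1 : coeff (e + Finsupp.single i 1) g ≠ 0 := fun h => he (by rw [h]; simp)
  have h2 := le_totalDegree (mem_support_iff.2 h1)
  rw [Finsupp.sum_fintype _ _ (by simp)] at h2 ⊢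
  refine le_trans (Finset.sum_le_sum (fun j _ => ?_)) h2
  simp

theorem coeff_pderiv_bound {n D A : ℕ} (i : Fin n) (g : MvPolynomial (Fin n) ℤ)
    (hD : g.totalDegree ≤ D) (hA : ∀ e, |coeff e g| ≤ A) (e : Fin n →₀ ℕ) :
    |coeff e (pderiv i g)| ≤ ((A * D : ℕ) : ℤ) := by
  rw [coeff_pderiv]
  by_cases h : coeff (e + Finsupp.single i 1) g = 0
  · rw [h, zero_mul, abs_zero]; positivity
  · have h2 := le_totalDegree (mem_support_iff.2 h)
    rw [Finsupp.sum_fintype _ _ (by simp)] at h2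
    have h4 : e i + 1 ≤ D := by
      set e' : Fin n →₀ ℕ := e + Finsupp.single i 1 with he'
      have h3 : e' i ≤ ∑ j, e' j :=
        Finset.single_le_sum (f := fun j => e' j) (fun _ _ => Nat.zero_le _) (Finset.mem_univ i)
      have : e' i = e i + 1 := by simp [he']
      omega
    rw [abs_mul]
    push_cast
    refine mul_le_mul (hA _) ?_ (abs_nonneg _) (by positivity)
    rw [abs_of_nonneg (by positivity)]
    exact_mod_cast h4

end DG


namespace DG
open MvPolynomial

theorem td_pderiv_lt {n : ℕ} (i : Fin n) (g : MvPolynomial (Fin n) ℤ) (h0 : pderiv i g ≠ 0) :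
    (pderiv i g).totalDegree + 1 ≤ g.totalDegree := by
  obtain ⟨e, he, hes⟩ := Finset.exists_mem_eq_sup _ (support_nonempty.2 h0)
    (fun s : Fin n →₀ ℕ => s.sum fun _ e => e)
  have hes' : (pderiv i g).totalDegree = e.sum fun _ e => e := hes
  rw [hes']
  rw [mem_support_iff, coeff_pderiv] at he
  have h1 : coeff (e + Finsupp.single i 1) g ≠ 0 := fun h => he (by rw [h]; simp)
  have h2 := le_totalDegree (mem_support_iff.2 h1)
  rw [Finsupp.sum_fintype _ _ (by simp)] at h2 ⊢
  refine le_trans ?_ h2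
  simp [Finset.sum_add_distrib, Finsupp.single_apply]

theorem td_le_of_dvd {n : ℕ} {R : Type*} [CommRing R] [IsDomain R] {p q : MvPolynomial (Fin n) R} (h : p ∣ q) (hq : q ≠ 0) :
    p.totalDegree ≤ q.totalDegree := by
  obtain ⟨r, rfl⟩ := h
  rw [totalDegree_mul_of_isDomain (left_ne_zero_of_mul hq) (right_ne_zero_of_mul hq)]
  omega

theorem exists_pderiv_ne {n : ℕ} (p : MvPolynomial (Fin n) ℤ) (h : p.totalDegree ≠ 0) :
    ∃ i, pderiv i p ≠ 0 := by
  by_contra hc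
  push Not at hc
  apply h
  rw [totalDegree_eq_zero_iff]
  intro e he i
  by_contra hi
  have h1 := congrArg (coeff (e - Finsupp.single i 1)) (hc i)
  have h2 : e - Finsupp.single i 1 + Finsupp.single i 1 = e := by
    apply tsub_add_cancel_of_le
    rw [Finsupp.single_le_iff]; omega
  rw [coeff_pderiv, h2, coeff_zero, mul_eq_zero] at h1
  rcases h1 with h1 | h1
  · exact (mem_support_iff.1 he) h1
  · have : (0:ℤ) ≤ ((e - Finsupp.single i 1 : Fin n →₀ ℕ) i : ℤ) := Int.natCast_nonneg _
    omega

theorem irr_nonconst {n : ℕ} {p : MvPolynomial (Fin n) ℤ} (hp : Irreducible p) {x : Fin n → ℤ}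
    (h : eval x p = 0) : p.totalDegree ≠ 0 := by
  intro h1
  rw [totalDegree_eq_zero_iff_eq_C] at h1
  rw [h1, eval_C] at h
  rw [h, C_0] at h1
  exact hp.ne_zero h1

theorem pderiv_not_dvd {n : ℕ} {p : MvPolynomial (Fin n) ℤ} {i : Fin n} (h : pderiv i p ≠ 0) :
    ¬ p ∣ pderiv i p := by
  intro hd
  have := td_le_of_dvd hd h
  have := td_pderiv_lt i p h
  omega

theorem curve_height {N B : ℕ} (hN : 1 ≤ N) (p : MvPolynomial (Fin 2) ℤ) (hp : Irreducible p)
    (hB : p.totalDegree ≤ B) (T : Finset (Fin 2 → ℤ)) (hT : ∀ x ∈ T, Box N x ∧ eval x p = 0)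
    (hc : (2 * B * B + B) ^ 2 < T.card) (e : Fin 2 →₀ ℕ) :
    |coeff e p| ≤ ((((B+1)^2 * N ^ B) ^ ((B+1)^2) : ℕ) : ℤ) := by
  obtain ⟨g, hg0, hgs, hgT, hgc⟩ := siegel_poly hN p hp.ne_zero hB T hT
  have hgd : g.totalDegree ≤ p.totalDegree := Finset.sup_mono hgs
  have hdvd : p ∣ g := by
    by_contra h
    have := cz B p g hp h hB (hgd.trans hB) T (fun x hx => ⟨(hT x hx).2, hgT x hx⟩)
    omega
  obtain ⟨r, hr⟩ := hdvd
  have hr0 : r ≠ 0 := by rintro rfl; simp at hr; exact hg0 hr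
  have h1 := totalDegree_mul_of_isDomain hp.ne_zero hr0
  rw [← hr] at h1
  have h2 : r.totalDegree = 0 := by omega
  rw [totalDegree_eq_zero_iff_eq_C] at h2
  set l := coeff 0 r
  have hl : l ≠ 0 := by intro h; rw [h, C_0] at h2; exact hr0 h2
  have h3 : coeff e g = coeff e p * l := by
    rw [hr, h2, mul_comm, coeff_C_mul, mul_comm]
  have h4 : |coeff e p| ≤ |coeff e g| := by
    rw [h3, abs_mul]
    exact le_mul_of_one_le_right (abs_nonneg _) (Int.one_le_abs hl)
  refine (h4.trans (hgc e)).trans ?_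
  have h5 := support_card_le p hB
  have h6 : 1 ≤ N ^ B := Nat.one_le_pow _ _ hN
  have h7 : 1 ≤ (B+1)^2 * N^B := Nat.mul_pos (by positivity) h6
  have : (p.support.card * N ^ B) ^ p.support.card ≤ ((B+1)^2 * N ^ B) ^ ((B+1)^2) :=
    (Nat.pow_le_pow_left (Nat.mul_le_mul_right _ h5) _).trans (Nat.pow_le_pow_right h7 h5)
  exact_mod_cast this

/-- height bound for the partial derivatives -/
def Ub (N B : ℕ) : ℕ := (B+1)^2 * ((((B+1)^2 * N ^ B) ^ ((B+1)^2) * B) * N ^ B)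

theorem sing_count {N B : ℕ} (hN : 1 ≤ N) (p : MvPolynomial (Fin 2) ℤ) (hp : Irreducible p)
    (hB : p.totalDegree ≤ B) (T : Finset (Fin 2 → ℤ)) (hT : ∀ x ∈ T, Box N x ∧ eval x p = 0)
    (hs : ∀ x ∈ T, ∀ i, eval x (pderiv i p) = 0 ∨ (Ub N B : ℤ) < |eval x (pderiv i p)|) :
    T.card ≤ (2 * B * B + B) ^ 2 := by
  by_contra hc
  push Not at hc
  have hco := curve_height hN p hp hB T hT hc
  obtain ⟨x0, hx0⟩ : T.Nonempty := by
    rw [← Finset.card_pos]; omega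
  obtain ⟨i, hi⟩ := exists_pderiv_ne p (irr_nonconst hp (hT x0 hx0).2)
  have h1 : ∀ x ∈ T, eval x (pderiv i p) = 0 := by
    intro x hx
    rcases hs x hx i with h | h
    · exact h
    · exfalso
      have h2 := eval_bound hN (pderiv i p) ((td_pderiv_le i p).trans hB)
        (fun e => coeff_pderiv_bound i p hB hco e) x (hT x hx).1
      exact absurd (h.trans_le h2) (lt_irrefl _)
  have := cz B p _ hp (pderiv_not_dvd hi) hB ((td_pderiv_le i p).trans hB) T
    (fun x hx => ⟨(hT x hx).2, h1 x hx⟩)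
  omega

/-- number of primes dividing a nonzero integer -/
theorem exists_prime_not_dvd (PP : Finset ℕ) (hPP : ∀ p ∈ PP, p.Prime) (k : ℕ) (hk : k < PP.card)
    (u : ℤ) (hu : u ≠ 0) (hu2 : |u| ≤ 2 ^ k) : ∃ p ∈ PP, ¬ (p:ℤ) ∣ u := by
  by_contra hc
  push Not at hc
  have h1 : (∏ p ∈ PP, p) ∣ u.natAbs := by
    apply Finset.prod_primes_dvd
    · intro p hp; exact (hPP p hp).prime
    · intro p hp
      exact Int.natCast_dvd.1 (hc p hp)
  have h2 : ∏ p ∈ PP, p ≤ u.natAbs := Nat.le_of_dvd (Int.natAbs_pos.2 hu) h1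
  have h3 : 2 ^ PP.card ≤ ∏ p ∈ PP, p := by
    rw [← Finset.prod_const]
    exact Finset.prod_le_prod' (fun p hp => (hPP p hp).two_le)
  have h4 : 2 ^ k < 2 ^ PP.card := Nat.pow_lt_pow_right (by norm_num) hk
  have h5 : (u.natAbs : ℤ) ≤ 2 ^ k := by rw [Int.natCast_natAbs]; exact hu2
  have h6 : u.natAbs ≤ 2 ^ k := by exact_mod_cast h5
  omega

/-- plenty of small primes -/
theorem many_primes (k : ℕ) (hk : 1 ≤ k) : k < ((Finset.range (16 * k ^ 2 + 1)).filter Nat.Prime).card := by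
  have h := Chebyshev.pi_ge (16 * k ^ 2)
  have h2 : ((Finset.range (16 * k ^ 2 + 1)).filter Nat.Prime).card = Nat.primeCounting (16 * k ^ 2) := by
    rw [Nat.primeCounting, Nat.primeCounting', Nat.count_eq_card_filter_range]
  rw [h2]
  have hk' : (1:ℝ) ≤ k := by exact_mod_cast hk
  have hn : ((16 * k ^ 2 : ℕ) : ℝ) = (4 * k) ^ 2 := by push_cast; ring
  rw [hn] at h
  have hlog : Real.log ((4 * k : ℝ) ^ 2) = 2 * Real.log (4 * k) := by rw [Real.log_pow]; norm_num
  have hpos : 0 < Real.log (4 * k) := Real.log_pos (by linarith)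
  have hl1 : Real.log (4 * k) ≤ 4 * k / Real.exp 1 := by
    have := Real.add_one_le_exp (Real.log (4 * k) - 1)
    rw [Real.exp_sub, Real.exp_log (by positivity)] at this
    linarith
  have hl2 : Real.log ((4 * k : ℝ) ^ 2 + 1) ≤ 2 * Real.log (4*k) + 1 := by
    have : (4 * k : ℝ) ^ 2 + 1 ≤ (4*k)^2 * Real.exp 1 := by
      have := Real.exp_one_gt_d9
      nlinarith
    calc _ ≤ Real.log ((4*k)^2 * Real.exp 1) := Real.log_le_log (by positivity) this
      _ = _ := by rw [Real.log_mul (by positivity) (by positivity), Real.log_exp, hlog]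
  have hl3 : Real.log (4 * k) ≤ 1.5 * k := by
    refine hl1.trans ?_
    have := Real.exp_one_gt_d9
    rw [div_le_iff₀ (by positivity)]
    nlinarith
  have hk2 : (k:ℝ) < ((4 * k : ℝ) ^ 2 * Real.log 2 - Real.log ((4 * k : ℝ) ^ 2 + 1)) / Real.log ((4 * k : ℝ) ^ 2) := by
    rw [hlog, lt_div_iff₀ (by positivity)]
    have := Real.log_two_gt_d9
    nlinarith
  exact_mod_cast hk2.trans_le h

end DG


namespace DG
open MvPolynomial

theorem sum_gauss (n : ℕ) : 2 * ∑ d ∈ Finset.range (n+1), (d+1) = (n+1)*(n+2) := by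
  induction n with
  | zero => simp
  | succ n ih => rw [Finset.sum_range_succ, mul_add, ih]; ring

theorem sum_tet2 (n : ℕ) : 6 * ∑ d ∈ Finset.range (n+1), (d+1)*(n-d) = n*(n+1)*(n+2) := by
  induction n with
  | zero => simp
  | succ n ih =>
    rw [Finset.sum_range_succ, Nat.sub_self, mul_zero, add_zero]
    have h : ∑ d ∈ Finset.range (n+1), (d+1)*(n+1-d) =
        ∑ d ∈ Finset.range (n+1), (d+1)*(n-d) + ∑ d ∈ Finset.range (n+1), (d+1) := by
      rw [← Finset.sum_add_distrib]
      refine Finset.sum_congr rfl (fun d hd => ?_)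
      rw [Finset.mem_range] at hd
      have : n + 1 - d = (n - d) + 1 := by omega
      rw [this]; ring
    rw [h, mul_add, ih]
    have := sum_gauss n
    linarith

def idx (M : ℕ) : Finset (Σ _ : ℕ, Σ _ : ℕ, ℕ) :=
  (Finset.range 3).sigma (fun k => (Finset.range (M-k+1)).sigma (fun d => Finset.range (d+1)))

noncomputable def idf (a : Σ _ : ℕ, Σ _ : ℕ, ℕ) : Fin 3 →₀ ℕ :=
  Finsupp.equivFunOnFinite.symm ![a.1, a.2.2, a.2.1 - a.2.2]

theorem idf_sum (M : ℕ) (a) (ha : a ∈ idx M) : ∑ i, idf a i = a.1 + a.2.1 := by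
  simp only [idx, Finset.mem_sigma, Finset.mem_range] at ha
  simp only [idf, Finsupp.equivFunOnFinite_symm_apply_apply, Fin.sum_univ_three]
  simp
  omega

theorem idf_inj (M : ℕ) : Set.InjOn idf (idx M) := by
  rintro ⟨k, d, j⟩ h1 ⟨k', d', j'⟩ h2 h
  simp only [idx, Finset.mem_coe, Finset.mem_sigma, Finset.mem_range] at h1 h2
  have h3 := fun i => DFunLike.congr_fun h i
  have a0 := h3 0
  have a1 := h3 1
  have a2 := h3 2
  simp [idf] at a0 a1 a2
  obtain rfl := a0
  obtain rfl := a1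
  have : d = d' := by omega
  subst this
  rfl

noncomputable def Eset (M : ℕ) : Finset (Fin 3 →₀ ℕ) := by
  classical exact (idx M).image idf

theorem Eset_mem (M : ℕ) (hM : 2 ≤ M) (e) (he : e ∈ Eset M) : e 0 ≤ 2 ∧ ∑ i, e i ≤ M := by
  classical
  obtain ⟨a, ha, rfl⟩ := Finset.mem_image.1 he
  rw [idf_sum M a ha]
  simp only [idx, Finset.mem_sigma, Finset.mem_range] at ha
  refine ⟨?_, by omega⟩
  simp [idf]; omega

theorem Eset_card (M : ℕ) : (Eset M).card ≤ 3 * (M+1)^2 := by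
  classical
  refine Finset.card_image_le.trans ?_
  rw [idx, Finset.card_sigma]
  have : ∀ k ∈ Finset.range 3, ((Finset.range (M-k+1)).sigma (fun d => Finset.range (d+1))).card ≤ (M+1)^2 := by
    intro k _
    rw [Finset.card_sigma]
    have : ∀ d ∈ Finset.range (M-k+1), (Finset.range (d+1)).card ≤ M + 1 := by
      intro d hd
      rw [Finset.mem_range] at hd
      rw [Finset.card_range]; omega
    refine (Finset.sum_le_card_nsmul _ _ _ this).trans ?_
    rw [Finset.card_range, smul_eq_mul, pow_two]
    exact Nat.mul_le_mul_right _ (by omega)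
  refine (Finset.sum_le_card_nsmul _ _ _ this).trans ?_
  simp

theorem Eset_sum (M : ℕ) (hM : 2 ≤ M) : 2 * ∑ e ∈ Eset M, (M - ∑ i, e i) = M^3 + M := by
  classical
  rw [Eset, Finset.sum_image (idf_inj M)]
  rw [Finset.sum_congr rfl (fun a ha => by rw [idf_sum M a ha])]
  rw [idx, Finset.sum_sigma]
  have h : ∀ k ∈ Finset.range 3, ∑ s ∈ (Finset.range (M-k+1)).sigma (fun d => Finset.range (d+1)), (M - (k + s.1))
      = ∑ d ∈ Finset.range (M-k+1), (d+1)*(M-k-d) := by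
    intro k _
    rw [Finset.sum_sigma]
    refine Finset.sum_congr rfl (fun d _ => ?_)
    simp only [Finset.sum_const, Finset.card_range, smul_eq_mul]
    congr 1; omega
  rw [Finset.sum_congr rfl h]
  obtain ⟨n, rfl⟩ : ∃ n, M = n + 2 := ⟨M - 2, by omega⟩
  have a0 := sum_tet2 (n+2)
  have a1 := sum_tet2 (n+1)
  have a2 := sum_tet2 n
  simp only [Finset.sum_range_succ _ 2, Finset.sum_range_succ _ 1, Finset.sum_range_succ _ 0, Finset.sum_range_zero]
  simp only [Nat.sub_zero, Nat.add_sub_cancel, show n + 2 - 1 = n + 1 by omega]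
  nlinarith

theorem Eset_nonempty (M : ℕ) : (Eset M).Nonempty := by
  classical
  refine ⟨idf ⟨0,0,0⟩, Finset.mem_image_of_mem _ ?_⟩
  simp [idx]

theorem sq_small (k : ℕ) (hk : 9 ≤ k) : 3 * (k+2)^2 ≤ 2 ^ k := by
  induction k, hk using Nat.le_induction with
  | base => norm_num
  | succ k hk ih => rw [pow_succ 2 k]; nlinarith

set_option maxHeartbeats 1000000 in
/-- The numerical heart: choice of t. -/
theorem choose_t {N m M : ℕ} (hN : 512 ≤ N) (hM : M = Nat.log 2 N + 1)
    (hm1 : Real.exp 11 * (N:ℝ)^(1/√3) ≤ m) (hm2 : m ≤ N) (s : ℕ) (hs1 : 1 ≤ s) (hs : s ≤ 3 * (M+1)^2) :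
    ∃ t : ℕ, 0 < t ∧ s * N ^ M < m ^ t ∧ m ^ (t * (t+1) * (t+2)) ≤ N ^ (3 * (M^3 + M)) := by
  have hNpos : (0:ℝ) < N := by exact_mod_cast (by omega : 0 < N)
  have hmpos : (0:ℝ) < m := lt_of_lt_of_le (by positivity) hm1
  set L := Real.log N with hL
  set l := Real.log m with hl
  have h3 : 0 < √(3:ℝ) := by positivity
  have hsq : √(3:ℝ) * √3 = 3 := Real.mul_self_sqrt (by norm_num)
  have hlL : 11 + L / √3 ≤ l := by
    have := Real.log_le_log (by positivity) hm1
    rw [Real.log_mul (by positivity) (by positivity), Real.log_exp, Real.log_rpow hNpos] at this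
    rw [hl, hL]
    calc _ = 11 + 1 / √3 * Real.log N := by ring
      _ ≤ _ := this
  have hlL2 : l ≤ L := Real.log_le_log hmpos (by exact_mod_cast hm2)
  have hkk : 9 ≤ Nat.log 2 N := by
    apply Nat.le_log_of_pow_le (by norm_num); norm_num; omega
  have hNk : 2 ^ Nat.log 2 N ≤ N := Nat.pow_log_le_self 2 (by omega)
  have hsN : s ≤ N := by
    subst hM
    exact (hs.trans (sq_small _ hkk)).trans hNk
  have hsL : Real.log s ≤ L := Real.log_le_log (by exact_mod_cast hs1) (by exact_mod_cast hsN)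
  have hs0 : 0 ≤ Real.log s := Real.log_nonneg (by exact_mod_cast hs1)
  have hML : L ≤ M := by
    have h1 : N < 2 ^ M := by rw [hM]; exact Nat.lt_pow_succ_log_self (by norm_num) N
    have h2 : L ≤ Real.log ((2:ℝ)^M) := Real.log_le_log hNpos (by exact_mod_cast h1.le)
    rw [Real.log_pow] at h2
    have := Real.log_two_lt_d9
    nlinarith
  have hL6 : 6 ≤ L := by
    have h1 : Real.log ((2:ℝ)^9) ≤ L := Real.log_le_log (by positivity) (by norm_num; exact_mod_cast hN)
    rw [Real.log_pow] at h1
    have := Real.log_two_gt_d9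
    push_cast at h1
    linarith
  have hlpos : 0 < l := by
    have : 0 ≤ L / √3 := by positivity
    linarith
  set t := ⌊(M * L + Real.log s) / l⌋₊ + 1 with ht
  have hx0 : 0 ≤ (M * L + Real.log s) / l := by positivity
  refine ⟨t, by omega, ?_, ?_⟩
  · have h1 : (M * L + Real.log s) / l < t := by
      rw [ht]; push_cast; exact Nat.lt_floor_add_one _
    rw [div_lt_iff₀ hlpos] at h1
    have hspos : (0:ℝ) < s := by exact_mod_cast hs1
    have : Real.log (s * (N:ℝ)^M) < Real.log ((m:ℝ)^t) := by
      rw [Real.log_mul (by positivity) (by positivity), Real.log_pow, Real.log_pow]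
      linarith
    have := (Real.log_lt_log_iff (by positivity) (by positivity)).1 this
    exact_mod_cast this
  · have h1 : (t:ℝ) ≤ (M * L + Real.log s) / l + 1 := by
      rw [ht]; push_cast; linarith [Nat.floor_le hx0]
    have h2 : ((t:ℝ) + 1) * l ≤ L * (M + 3) := by
      have : (t:ℝ) * l ≤ M * L + Real.log s + l := by
        calc (t:ℝ) * l ≤ ((M * L + Real.log s) / l + 1) * l := by gcongr
          _ = _ := by field_simp
      nlinarith
    have h4 : (t:ℝ) * (t+1) * (t+2) ≤ (t+1)^3 := by nlinarith [(Nat.cast_nonneg t : (0:ℝ) ≤ t)]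
    have h5 : (((t:ℝ)+1) * l)^3 ≤ (L * (M+3))^3 := by gcongr
    -- key
    have h6 : (M+3:ℝ)^3 * L^2 ≤ 3 * l^2 * M^3 := by
      have ha : L^2 + 38 * L ≤ 3 * l^2 := by
        have hb : (11 + L / √3)^2 ≤ l^2 := by gcongr
        have hc : (11 + L / √3)^2 = 121 + 22 * (L / √3) + L^2/3 := by
          have : (L / √3)^2 = L^2/3 := by rw [div_pow, Real.sq_sqrt (by norm_num)]
          linear_combination this
        have hd : L * 0.577 ≤ L / √3 := by
          rw [le_div_iff₀ h3]
          have : √(3:ℝ) ≤ 1.7321 := by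
            rw [Real.sqrt_le_left (by norm_num)]; norm_num
          nlinarith
        nlinarith
      have he : (M+3:ℝ)^3 * L ≤ (L + 38) * M^3 := by
        have hM0 : (0:ℝ) ≤ M := by positivity
        have hM6 : (6:ℝ) ≤ M := by linarith
        have q1 : L * (M:ℝ)^2 ≤ M * (M:ℝ)^2 := by gcongr
        have q2 : L * (M:ℝ) ≤ M * (M:ℝ) := by gcongr
        have q3 : 6 * (M:ℝ)^2 ≤ M * (M:ℝ)^2 := by gcongr
        have q4 : 6 * (M:ℝ) ≤ M * (M:ℝ) := by gcongr
        linear_combination 9 * q1 + 27 * q2 + 27 * hML + 5.25 * q3 + 4.5 * q4 + 23.75 * (by positivity : (0:ℝ) ≤ M * (M:ℝ)^2)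
      have hM0 : (0:ℝ) ≤ (M:ℝ)^3 := by positivity
      nlinarith
    have h7 : ((t:ℝ)+1)^3 * l ≤ 3 * L * M^3 := by
      have hl2 : 0 < l^2 := by positivity
      have : ((t:ℝ)+1)^3 * l * l^2 ≤ (3 * L * M^3) * l^2 := by
        calc ((t:ℝ)+1)^3 * l * l^2 = (((t:ℝ)+1) * l)^3 := by ring
          _ ≤ _ := h5
          _ = L * ((M+3:ℝ)^3 * L^2) := by ring
          _ ≤ L * (3 * l^2 * M^3) := by gcongr
          _ = _ := by ring
      exact le_of_mul_le_mul_right this hl2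
    have h8 : Real.log ((m:ℝ)^(t * (t+1) * (t+2))) ≤ Real.log ((N:ℝ)^(3 * (M^3 + M))) := by
      rw [Real.log_pow, Real.log_pow]
      push_cast
      have : (0:ℝ) ≤ L * M := by positivity
      nlinarith
    have := (Real.log_le_log_iff (by positivity) (by positivity)).1 h8
    exact_mod_cast this

theorem aux3 {g : MvPolynomial (Fin 3) ℤ} (hg : Surf g) {N m : ℕ} (hN : 512 ≤ N)
    (hm1 : Real.exp 11 * (N:ℝ)^(1/√3) ≤ m) (hm2 : m ≤ N)
    (T : Finset (Fin 3 → ℤ)) (κ : Fin 3 → ℤ) (hz : ∀ x ∈ T, eval x g = 0)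
    (hcong : ∀ x ∈ T, ∀ i, (m:ℤ) ∣ x i - κ i)
    (hcop : ∀ x ∈ T, IsCoprime (eval x (pderiv 0 g)) (m:ℤ)) (hbox : ∀ x ∈ T, Box N x) :
    ∃ R : MvPolynomial (Fin 2) ℤ, R ≠ 0 ∧ R.totalDegree ≤ (Nat.log 2 N + 4)^2 ∧
      ∀ x ∈ T, eval (Fin.tail x) R = 0 := by
  set M := Nat.log 2 N + 1 with hM
  have hM2 : 2 ≤ M := by
    have : 1 ≤ Nat.log 2 N := Nat.le_log_of_pow_le (by norm_num) (by omega)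
    omega
  have hmpos : 0 < m := by
    have : (0:ℝ) < m := lt_of_lt_of_le (by have : (0:ℝ) < N := by { exact_mod_cast (by omega : 0 < N) }; positivity) hm1
    exact_mod_cast this
  obtain ⟨t, ht, h1, h2⟩ := choose_t hN hM hm1 hm2 (Eset M).card
    (Finset.card_pos.2 (Eset_nonempty M)) (Eset_card M)
  obtain ⟨h, h0, hsup, -, hv⟩ := aux (t := t) g m hmpos T κ hz hcong hcop (Eset M) N M (by omega) hbox
    (fun e he => (Eset_mem M hM2 e he).2) (Eset_nonempty M) ht h1 (by
      have a1 := sum_alpha_two t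
      have a2 := Eset_sum M hM2
      have a3 : N ^ (3 * (M^3 + M)) = (N ^ (∑ e ∈ Eset M, (M - ∑ i, e i)))^6 := by
        rw [← pow_mul, ← a2]; congr 1; ring
      have a4 : m ^ (t * (t+1) * (t+2)) = (m ^ (∑ α : Fin 2 → Fin t, (t - ∑ i, (α i : ℕ))))^6 := by
        rw [← pow_mul, ← a1]; congr 1; ring
      rw [a3, a4] at h2
      exact (Nat.pow_le_pow_iff_left (by norm_num)).1 h2)
  have hdeg : h.degreeOf 0 ≤ 2 := by
    rw [degreeOf_le_iff]
    intro e he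
    exact (Eset_mem M hM2 e (hsup he)).1
  have htd : h.totalDegree ≤ M := by
    apply Finset.sup_le
    intro e he
    rw [Finsupp.sum_fintype _ _ (by simp)]
    exact (Eset_mem M hM2 e (hsup he)).2
  refine ⟨_, hg.res_ne_zero (hg.not_dvd h0 hdeg), (hg.res_deg htd).trans ?_, fun x hx => ?_⟩
  · rw [hM, pow_two]; apply le_of_eq; ring
  · have := hg.res_vanish (K := ℤ) x (h := h) (by rw [aeval_eq_eval]; exact hz x hx)
      (by rw [aeval_eq_eval]; exact hv x hx)
    rwa [aeval_eq_eval] at this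

end DG


namespace DG
open MvPolynomial

theorem Surf.tail_count {g : MvPolynomial (Fin 3) ℤ} (hg : Surf g) (T : Finset (Fin 3 → ℤ))
    (hT : ∀ x ∈ T, eval x g = 0) (k : ℕ) (hk : (T.image Fin.tail).card ≤ k) : T.card ≤ 3 * k := by
  classical
  refine (Finset.card_le_mul_card_image (f := Fin.tail) T 3 ?_).trans (Nat.mul_le_mul_left _ hk)
  intro t _
  apply hg.column_int t
  intro x hx
  rw [Finset.mem_filter] at hx
  exact ⟨hT x hx.1, hx.2⟩

theorem hensel {n : ℕ} (g : MvPolynomial (Fin (n+1)) ℤ) (x x' : Fin (n+1) → ℤ) (hx : eval x g = 0)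
    (hx' : eval x' g = 0) (r m : ℤ) (hr : r ∣ x' 0 - x 0)
    (hcop : IsCoprime (eval x (pderiv 0 g)) r) (k : ℕ) (hm : m ∣ r ^ k)
    (h1 : ∀ i : Fin n, m ∣ x' i.succ - x i.succ) : m ∣ x' 0 - x 0 := by
  set A := (finSuccEquiv ℤ n g).map (eval (Fin.tail x)) with hA
  have hA0 : A.eval (x 0) = 0 := by rw [hA, Polynomial.eval_map, ← eval_fse]; exact hx
  have hA1 : A.derivative.eval (x 0) = eval x (pderiv 0 g) := by
    rw [hA, Polynomial.derivative_map, Polynomial.eval_map, eval_fse, fse_pderiv]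
  have hA2 : m ∣ A.eval (x' 0) := by
    have h2 : A.eval (x' 0) = eval (Fin.cons (x' 0) (Fin.tail x) : Fin (n+1) → ℤ) g := by
      rw [hA, Polynomial.eval_map, eval_fse]; simp
    rw [h2]
    have := eval_cong m x' (Fin.cons (x' 0) (Fin.tail x) : Fin (n+1) → ℤ) (by
      intro i
      refine Fin.cases ?_ (fun j => ?_) i
      · simp
      · simpa [Fin.tail] using h1 j) g
    rw [hx', zero_sub, dvd_neg] at this
    exact this
  obtain ⟨q, hq⟩ := Polynomial.binomExpansion A (x 0) (x' 0 - x 0)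
  rw [add_sub_cancel, hA0, hA1, zero_add] at hq
  have h3 : A.eval (x' 0) = (x' 0 - x 0) * (eval x (pderiv 0 g) + q * (x' 0 - x 0)) := by
    rw [hq]; ring
  rw [h3] at hA2
  have h4 : IsCoprime (eval x (pderiv 0 g) + q * (x' 0 - x 0)) r := by
    obtain ⟨w, hw⟩ := hr
    obtain ⟨a, b, hab⟩ := hcop
    exact ⟨a, b - a * q * w, by rw [hw]; linear_combination hab⟩
  have h5 : IsCoprime m (eval x (pderiv 0 g) + q * (x' 0 - x 0)) :=
    (IsCoprime.of_isCoprime_of_dvd_left (h4.pow_right (n := k)).symm hm)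
  exact h5.dvd_of_dvd_mul_right hA2

theorem class_count (g : MvPolynomial (Fin 3) ℤ) (T : Finset (Fin 3 → ℤ))
    (hT : ∀ x ∈ T, eval x g = 0) (r m : ℕ) (hr : 0 < r) (hm0 : 0 < m) (j : ℕ) (hm : m ∣ r ^ j)
    (hcop : ∀ x ∈ T, IsCoprime (eval x (pderiv 0 g)) (r:ℤ)) (k : ℕ)
    (hk : ∀ T' ⊆ T, (∀ x ∈ T', ∀ y ∈ T', ∀ i, (m:ℤ) ∣ x i - y i) → T'.card ≤ k) :
    T.card ≤ m ^ 2 * r * k := by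
  classical
  let f : (Fin 3 → ℤ) → ℤ × ℤ × ℤ := fun x => (x 1 % m, x 2 % m, x 0 % r)
  let S : Finset (ℤ × ℤ × ℤ) := Finset.Ico 0 (m:ℤ) ×ˢ Finset.Ico 0 (m:ℤ) ×ˢ Finset.Ico 0 (r:ℤ)
  have hm1 : (0:ℤ) < m := by exact_mod_cast hm0
  have hr1 : (0:ℤ) < r := by exact_mod_cast hr
  have h := Finset.card_le_mul_card_image_of_maps_to (s := T) (t := S) (f := f) (by
    intro x _
    simp only [S, f, Finset.mem_product, Finset.mem_Ico]
    exact ⟨⟨Int.emod_nonneg _ hm1.ne', Int.emod_lt_of_pos _ hm1⟩,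
      ⟨Int.emod_nonneg _ hm1.ne', Int.emod_lt_of_pos _ hm1⟩,
      ⟨Int.emod_nonneg _ hr1.ne', Int.emod_lt_of_pos _ hr1⟩⟩) k (by
    intro b _
    apply hk _ (Finset.filter_subset _ _)
    intro x hx y hy
    rw [Finset.mem_filter] at hx hy
    have he : f x = f y := hx.2.trans hy.2.symm
    simp only [f, Prod.mk.injEq] at he
    have e1 : (m:ℤ) ∣ x 1 - y 1 := (Int.ModEq.dvd (Int.ModEq.symm he.1))
    have e2 : (m:ℤ) ∣ x 2 - y 2 := (Int.ModEq.dvd (Int.ModEq.symm he.2.1))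
    have e0 : (r:ℤ) ∣ x 0 - y 0 := (Int.ModEq.dvd (Int.ModEq.symm he.2.2))
    have h0 := hensel g y x (hT y hy.1) (hT x hx.1) r m e0 (hcop y hy.1) j (by exact_mod_cast hm)
      (by intro i; fin_cases i; exacts [e1, e2])
    intro i
    fin_cases i
    exacts [h0, e1, e2])
  refine h.trans (le_of_eq ?_)
  simp [S]
  ring

end DG


namespace DG
open MvPolynomial

noncomputable def fs2 (q : Fin 9 × Fin 9) : Fin 2 →₀ ℕ :=
  Finsupp.equivFunOnFinite.symm ![(q.1 : ℕ), (q.2 : ℕ)]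

theorem fs2_inj : Function.Injective fs2 := by
  rintro ⟨a, b⟩ ⟨c, d⟩ h
  have h0 := DFunLike.congr_fun h 0
  have h1 := DFunLike.congr_fun h 1
  simp [fs2] at h0 h1
  ext <;> simp [h0, h1]

theorem fs2_sum (q) : ∑ i, fs2 q i = (q.1 : ℕ) + q.2 := by
  simp [fs2, Fin.sum_univ_two]

theorem fs2_zero (q) : fs2 q 0 = q.1 := by simp [fs2]
theorem fs2_one (q) : fs2 q 1 = q.2 := by simp [fs2]

/-- Curve count in one residue class, given a suitable set of monomials. -/
theorem core_gen (p : MvPolynomial (Fin 2) ℤ) (hp : Irreducible p) (N m B : ℕ) (hB8 : 8 ≤ B)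
    (hB : p.totalDegree ≤ B) (hN : 1 ≤ N) (hm : 0 < m)
    (h1 : 17 * N ^ 8 < m ^ 14) (h2 : m ^ 105 ≤ N ^ 64)
    (I : Finset (Fin 9 × Fin 9)) (hI1 : I.card = 17) (hI2 : ∀ q ∈ I, (q.1 : ℕ) + q.2 ≤ 8)
    (hI3 : ∑ q ∈ I, (8 - ((q.1 : ℕ) + q.2)) = 64)
    (hnd : ∀ h : MvPolynomial (Fin 2) ℤ, h ≠ 0 → (∀ e ∈ h.support, ∃ q ∈ I, fs2 q = e) → ¬ p ∣ h)
    (T : Finset (Fin 2 → ℤ)) (hz : ∀ x ∈ T, eval x p = 0)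
    (hcong : ∀ x ∈ T, ∀ y ∈ T, ∀ i, (m:ℤ) ∣ x i - y i)
    (hcop : ∀ x ∈ T, IsCoprime (eval x (pderiv 0 p)) (m:ℤ)) (hbox : ∀ x ∈ T, Box N x) :
    T.card ≤ (2 * B * B + B) ^ 2 := by
  classical
  rcases T.eq_empty_or_nonempty with rfl | ⟨x0, hx0⟩
  · simp
  obtain ⟨h, h0, hs, -, hv⟩ := aux (d := 1) (t := 14) p m hm T x0 hz (fun x hx => hcong x hx x0 hx0) hcop
    (I.image fs2) N 8 hN hbox (by
      intro e he
      obtain ⟨q, hq, rfl⟩ := Finset.mem_image.1 he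
      rw [fs2_sum]; exact hI2 q hq) (by
      rw [Finset.image_nonempty, ← Finset.card_pos]; omega) (by norm_num)
    (by rw [Finset.card_image_of_injective _ fs2_inj, hI1]; exact h1)
    (by
      have := sum_alpha_one 14
      have h3 : ∑ α : Fin 1 → Fin 14, (14 - ∑ i, (α i : ℕ)) = 105 := by omega
      rw [h3, Finset.sum_image (fun a _ b _ h => fs2_inj h), Finset.sum_congr rfl (fun q _ => by rw [fs2_sum]), hI3]
      exact h2)
  have hdvd : ¬ p ∣ h := hnd h h0 (fun e he => by
    obtain ⟨q, hq, hqe⟩ := Finset.mem_image.1 (hs he)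
    exact ⟨q, hq, hqe⟩)
  refine cz B p h hp hdvd hB ?_ T (fun x hx => ⟨hz x hx, hv x hx⟩)
  apply Finset.sup_le
  intro e he
  obtain ⟨q, hq, rfl⟩ := Finset.mem_image.1 (hs he)
  rw [Finsupp.sum_fintype _ _ (by simp), fs2_sum]
  exact (hI2 q hq).trans hB8

theorem degreeOf_le_of_dvd' {n : ℕ} (i : Fin n) {p q : MvPolynomial (Fin n) ℤ} (h : p ∣ q) (hq : q ≠ 0) :
    p.degreeOf i ≤ q.degreeOf i := by
  obtain ⟨r, rfl⟩ := h
  rw [degreeOf_mul_eq (left_ne_zero_of_mul hq) (right_ne_zero_of_mul hq)]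
  omega

theorem mixed_nd (p h : MvPolynomial (Fin 2) ℤ) (hp : p ≠ 0) (h0 : h ≠ 0)
    (hd0 : p.degreeOf 0 ≤ 1) (hc : coeff (Finsupp.single 0 1 + Finsupp.single 1 1) p ≠ 0)
    (hs : ∀ e ∈ h.support, e 0 = 0 ∨ e 1 = 0) : ¬ p ∣ h := by
  rintro ⟨r, rfl⟩
  have hr : r ≠ 0 := right_ne_zero_of_mul h0
  set P := finSuccEquiv ℤ 1 p with hP
  set R := finSuccEquiv ℤ 1 r with hR
  have hcons : (Finsupp.single 0 1 + Finsupp.single 1 1 : Fin 2 →₀ ℕ) = (Finsupp.single 0 1 : Fin 1 →₀ ℕ).cons 1 := by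
    ext i; fin_cases i
    · simp
    · change _ = (Finsupp.cons 1 (Finsupp.single (0 : Fin 1) 1)) (Fin.succ 0)
      rw [Finsupp.cons_succ]; simp
  have hcf : coeff (Finsupp.single 0 1) (P.coeff 1) ≠ 0 := by
    rw [hP, finSuccEquiv_coeff_coeff, ← hcons]; exact hc
  have hPd : P.natDegree = 1 := by
    apply le_antisymm
    · rw [hP, natDegree_finSuccEquiv]; exact hd0
    · apply Polynomial.le_natDegree_of_ne_zero
      intro h; rw [h] at hcf; simp at hcf
  have hPl : 1 ≤ P.leadingCoeff.totalDegree := by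
    rw [Polynomial.leadingCoeff, hPd]
    have := le_totalDegree (mem_support_iff.2 hcf)
    simpa using this
  have hP0 : P ≠ 0 := by intro h; rw [h] at hPd; simp at hPd
  have hR0 : R ≠ 0 := by rw [hR, Ne, EmbeddingLike.map_eq_zero_iff]; exact hr
  have hl : (P * R).leadingCoeff.totalDegree ≠ 0 := by
    rw [Polynomial.leadingCoeff_mul, totalDegree_mul_of_isDomain (by simpa using hP0) (by simpa using hR0)]
    omega
  have hnd : (P * R).natDegree ≠ 0 := by rw [Polynomial.natDegree_mul hP0 hR0]; omega
  obtain ⟨e, he, hei⟩ : ∃ e ∈ (P * R).leadingCoeff.support, e 0 ≠ 0 := by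
    by_contra hcon
    push Not at hcon
    apply hl
    rw [totalDegree_eq_zero_iff]
    intro e he i
    fin_cases i
    exact hcon e he
  have hpr : P * R = finSuccEquiv ℤ 1 (p * r) := by rw [map_mul]
  rw [Polynomial.leadingCoeff, mem_support_iff] at he
  rw [hpr, finSuccEquiv_coeff_coeff, ← hpr] at he
  rcases hs _ (mem_support_iff.2 he) with h | h
  · rw [Finsupp.cons_zero] at h; exact hnd h
  · have : (Finsupp.cons (P * R).natDegree e) (Fin.succ 0) = 0 := h
    rw [Finsupp.cons_succ] at this
    exact hei this

def I1 : Finset (Fin 9 × Fin 9) := Finset.univ.filter (fun q => (q.1:ℕ) ≤ 1 ∧ (q.1:ℕ) + q.2 ≤ 8)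
def I2 : Finset (Fin 9 × Fin 9) := Finset.univ.filter (fun q => (q.2:ℕ) ≤ 1 ∧ (q.1:ℕ) + q.2 ≤ 8)
def I3 : Finset (Fin 9 × Fin 9) := Finset.univ.filter (fun q => (q.1:ℕ) = 0 ∨ (q.2:ℕ) = 0)

theorem core (p : MvPolynomial (Fin 2) ℤ) (hp : Irreducible p) (N m B : ℕ) (hB8 : 8 ≤ B)
    (hB : p.totalDegree ≤ B) (hp2 : 2 ≤ p.totalDegree) (hN : 1 ≤ N) (hm : 0 < m)
    (h1 : 17 * N ^ 8 < m ^ 14) (h2 : m ^ 105 ≤ N ^ 64)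
    (T : Finset (Fin 2 → ℤ)) (hz : ∀ x ∈ T, eval x p = 0)
    (hcong : ∀ x ∈ T, ∀ y ∈ T, ∀ i, (m:ℤ) ∣ x i - y i)
    (hcop : ∀ x ∈ T, IsCoprime (eval x (pderiv 0 p)) (m:ℤ)) (hbox : ∀ x ∈ T, Box N x) :
    T.card ≤ (2 * B * B + B) ^ 2 := by
  by_cases c0 : 2 ≤ p.degreeOf 0
  · refine core_gen p hp N m B hB8 hB hN hm h1 h2 I1 (by decide +kernel) (by
      intro q hq; exact (Finset.mem_filter.1 hq).2.2) (by decide +kernel) ?_ T hz hcong hcop hbox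
    intro h h0 hs hd
    have h3 := degreeOf_le_of_dvd' 0 hd h0
    have h4 : h.degreeOf 0 ≤ 1 := by
      rw [degreeOf_le_iff]
      intro e he
      obtain ⟨q, hq, rfl⟩ := hs e he
      rw [fs2_zero]
      exact (Finset.mem_filter.1 hq).2.1
    omega
  by_cases c1 : 2 ≤ p.degreeOf 1
  · refine core_gen p hp N m B hB8 hB hN hm h1 h2 I2 (by decide +kernel) (by
      intro q hq; exact (Finset.mem_filter.1 hq).2.2) (by decide +kernel) ?_ T hz hcong hcop hbox
    intro h h0 hs hd
    have h3 := degreeOf_le_of_dvd' 1 hd h0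
    have h4 : h.degreeOf 1 ≤ 1 := by
      rw [degreeOf_le_iff]
      intro e he
      obtain ⟨q, hq, rfl⟩ := hs e he
      rw [fs2_one]
      exact (Finset.mem_filter.1 hq).2.1
    omega
  · refine core_gen p hp N m B hB8 hB hN hm h1 h2 I3 (by decide +kernel) (by
      intro q hq; have := (Finset.mem_filter.1 hq).2; omega) (by decide +kernel) ?_ T hz hcong hcop hbox
    intro h h0 hs
    apply mixed_nd p h hp.ne_zero h0 (by omega)
    · obtain ⟨e, he, hes⟩ := Finset.exists_mem_eq_sup _ (support_nonempty.2 hp.ne_zero)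
        (fun s : Fin 2 →₀ ℕ => s.sum fun _ e => e)
      have hes' : p.totalDegree = e.sum fun _ e => e := hes
      rw [Finsupp.sum_fintype _ _ (by simp), Fin.sum_univ_two] at hes'
      have e0 := (degreeOf_le_iff.1 (le_refl (p.degreeOf 0))) e he
      have e1 := (degreeOf_le_iff.1 (le_refl (p.degreeOf 1))) e he
      have : e = Finsupp.single 0 1 + Finsupp.single 1 1 := by
        ext i; fin_cases i
        · simp; omega
        · simp; omega
      rw [← this]
      exact mem_support_iff.1 he
    · intro e he
      obtain ⟨q, hq, rfl⟩ := hs e he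
      rw [fs2_zero, fs2_one]
      exact (Finset.mem_filter.1 hq).2

end DG


namespace DG
open MvPolynomial

theorem core' (p : MvPolynomial (Fin 2) ℤ) (hp : Irreducible p) (N m B : ℕ) (hB8 : 8 ≤ B)
    (hB : p.totalDegree ≤ B) (hp2 : 2 ≤ p.totalDegree) (hN : 1 ≤ N) (hm : 0 < m)
    (h1 : 17 * N ^ 8 < m ^ 14) (h2 : m ^ 105 ≤ N ^ 64)
    (T : Finset (Fin 2 → ℤ)) (hz : ∀ x ∈ T, eval x p = 0)
    (hcong : ∀ x ∈ T, ∀ y ∈ T, ∀ i, (m:ℤ) ∣ x i - y i) (i : Fin 2)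
    (hcop : ∀ x ∈ T, IsCoprime (eval x (pderiv i p)) (m:ℤ)) (hbox : ∀ x ∈ T, Box N x) :
    T.card ≤ (2 * B * B + B) ^ 2 := by
  classical
  let e : Fin 2 ≃ Fin 2 := Equiv.swap i 0
  have he : e i = 0 := Equiv.swap_apply_left _ _
  have hev : ∀ (x : Fin 2 → ℤ) (q : MvPolynomial (Fin 2) ℤ), eval (x ∘ e) (rename e q) = eval x q := by
    intro x q
    rw [eval_rename]
    congr 2
    funext j
    simp [e]
  have := core (renameEquiv ℤ e p) ((MulEquiv.irreducible_iff _).2 hp) N m B hB8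
    (by rw [totalDegree_renameEquiv]; exact hB) (by rw [totalDegree_renameEquiv]; exact hp2) hN hm h1 h2
    (T.image (fun x => x ∘ e)) (by
      intro y hy
      obtain ⟨x, hx, rfl⟩ := Finset.mem_image.1 hy
      rw [renameEquiv_apply, hev]; exact hz x hx) (by
      intro y hy y' hy' j
      obtain ⟨x, hx, rfl⟩ := Finset.mem_image.1 hy
      obtain ⟨x', hx', rfl⟩ := Finset.mem_image.1 hy'
      exact hcong x hx x' hx' _) (by
      intro y hy
      obtain ⟨x, hx, rfl⟩ := Finset.mem_image.1 hy
      rw [renameEquiv_apply, ← he, pderiv_rename e.injective, hev]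
      exact hcop x hx) (by
      intro y hy
      obtain ⟨x, hx, rfl⟩ := Finset.mem_image.1 hy
      exact fun j => hbox x hx _)
  rwa [Finset.card_image_of_injective] at this
  intro x y h
  funext j
  have := congrFun h (e.symm j)
  simpa using this

theorem linear_form {R : Type*} [CommRing R] {n : ℕ} (p : MvPolynomial (Fin n) R) (hp : p.totalDegree ≤ 1) :
    p = C (coeff 0 p) + ∑ i, C (coeff (Finsupp.single i 1) p) * X i := by
  classical
  have hs : p.support ⊆ insert 0 (Finset.univ.image (fun i : Fin n => Finsupp.single i 1)) := by
    intro e he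
    have h1 := le_totalDegree he
    rw [Finsupp.sum_fintype _ _ (by simp)] at h1
    rw [Finset.mem_insert]
    by_cases h0 : e = 0
    · left; exact h0
    · right
      rw [Finset.mem_image]
      obtain ⟨i, hi⟩ : ∃ i, e i ≠ 0 := by
        by_contra hc; push Not at hc; exact h0 (Finsupp.ext hc)
      refine ⟨i, Finset.mem_univ _, ?_⟩
      have h2 := Finset.add_sum_erase Finset.univ (fun j => e j) (Finset.mem_univ i)
      ext j
      by_cases hj : j = i
      · subst hj
        simp only [Finsupp.single_eq_same]
        omega
      · have h3 : e j ≤ ∑ k ∈ Finset.univ.erase i, e k :=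
          Finset.single_le_sum (f := fun k => e k) (fun _ _ => Nat.zero_le _) (Finset.mem_erase.2 ⟨hj, Finset.mem_univ _⟩)
        rw [Finsupp.single_eq_of_ne hj]
        omega
  conv_lhs => rw [p.as_sum]
  rw [Finset.sum_subset hs (fun e _ he => by rw [notMem_support_iff.1 he]; simp),
    Finset.sum_insert, Finset.sum_image]
  · congr 1
    refine Finset.sum_congr rfl (fun i _ => ?_)
    rw [X, C_mul_monomial, mul_one]
  · intro i _ j _ h
    exact (Finsupp.single_left_inj one_ne_zero).1 h
  · rw [Finset.mem_image]
    rintro ⟨i, -, hi⟩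
    have := DFunLike.congr_fun hi i
    simp at this

theorem td_aeval_le {R : Type*} [CommRing R] {k l : ℕ} (f : Fin k → MvPolynomial (Fin l) R)
    (hf : ∀ i, (f i).totalDegree ≤ 1) (p : MvPolynomial (Fin k) R) :
    (aeval f p).totalDegree ≤ p.totalDegree := by
  rw [aeval_def, eval₂_eq']
  apply totalDegree_finsetSum_le
  intro e he
  have h1 := le_totalDegree he
  rw [Finsupp.sum_fintype _ _ (by simp)] at h1
  refine (totalDegree_mul _ _).trans ?_
  have h2 : (algebraMap R (MvPolynomial (Fin l) R) (coeff e p)).totalDegree = 0 := totalDegree_C _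
  rw [h2, zero_add]
  refine (totalDegree_finset_prod _ _).trans (le_trans ?_ h1)
  apply Finset.sum_le_sum
  intro i _
  refine (totalDegree_pow _ _).trans ?_
  calc _ ≤ e i * 1 := Nat.mul_le_mul_left _ (hf i)
    _ = _ := mul_one _

theorem exists_irr_factor {n : ℕ} (R : MvPolynomial (Fin n) ℤ) (hR : R ≠ 0) (x : Fin n → ℤ)
    (h : eval x R = 0) : ∃ p, Irreducible p ∧ p ∣ R ∧ eval x p = 0 := by
  have h1 := UniqueFactorizationMonoid.factors_prod hR
  have h2 : eval x (UniqueFactorizationMonoid.factors R).prod = 0 := by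
    rcases assoc_pm h1 with h3 | h3
    · rw [← h3]; exact h
    · rw [h3, map_neg, neg_eq_zero] at h; exact h
  rw [map_multiset_prod, Multiset.prod_eq_zero_iff, Multiset.mem_map] at h2
  obtain ⟨p, hp, hp0⟩ := h2
  exact ⟨p, UniqueFactorizationMonoid.irreducible_of_factor _ hp,
    UniqueFactorizationMonoid.dvd_of_mem_factors hp, hp0⟩

theorem pderiv_aeval0 {k l : ℕ} (f : Fin (k+1) → MvPolynomial (Fin (l+1)) ℤ) (h0 : f 0 = X 0)
    (hf : ∀ i : Fin k, pderiv 0 (f i.succ) = 0) (p : MvPolynomial (Fin (k+1)) ℤ) :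
    pderiv 0 (aeval f p) = aeval f (pderiv 0 p) := by
  induction p using MvPolynomial.induction_on with
  | C a => simp
  | add p q hp hq => simp only [map_add, hp, hq]
  | mul_X p i hp =>
    have e1 : pderiv 0 (f i) = aeval f (pderiv 0 (X i : MvPolynomial (Fin (k+1)) ℤ)) := by
      refine Fin.cases ?_ (fun j => ?_) i
      · rw [h0, pderiv_X_self, pderiv_X_self, map_one]
      · rw [hf, pderiv_X_of_ne (Fin.succ_ne_zero j), map_zero]
    rw [map_mul, aeval_X, pderiv_mul, pderiv_mul, map_add, map_mul, map_mul, aeval_X, hp, e1]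

end DG


namespace DG
open MvPolynomial

theorem eval_aeval' {R : Type*} [CommRing R] {k l : ℕ} (f : Fin k → MvPolynomial (Fin l) R)
    (w : Fin l → R) (p : MvPolynomial (Fin k) R) :
    eval w (aeval f p) = eval (fun i => eval w (f i)) p := by
  induction p using MvPolynomial.induction_on with
  | C a => simp
  | add p q hp hq => simp only [map_add, hp, hq]
  | mul_X p i hp => simp only [map_mul, hp, aeval_X, eval_X]

theorem eval_linear_line {R : Type*} [CommRing R] {n : ℕ} (q : MvPolynomial (Fin n) R) (hq : q.totalDegree ≤ 1)
    (a b : Fin n → R) (s : R) :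
    eval (fun i => a i + s * (b i - a i)) q = eval a q + s * (eval b q - eval a q) := by
  rw [linear_form q hq]
  simp only [map_add, map_sum, map_mul, eval_C, eval_X]
  have : ∀ i, eval (fun i => a i + s * (b i - a i)) (X i : MvPolynomial (Fin n) R) = a i + s * (b i - a i) :=
    fun i => eval_X _
  rw [add_sub_add_left_eq_sub, ← Finset.sum_sub_distrib, Finset.mul_sum, add_assoc, ← Finset.sum_add_distrib]
  congr 1
  apply Finset.sum_congr rfl
  intro i _
  ring

theorem lin_end {g : MvPolynomial (Fin 3) ℤ} (hg : Surf g) (N m : ℕ)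
    (hN : 1 ≤ N) (hm : 1 < m) (h1 : 17 * (2 * N) ^ 8 < m ^ 14) (h2 : m ^ 105 ≤ N ^ 64)
    (T : Finset (Fin 3 → ℤ)) (hbox : ∀ x ∈ T, Box N x) (hz : ∀ x ∈ T, eval x g = 0)
    (hcong : ∀ x ∈ T, ∀ y ∈ T, ∀ i, (m:ℤ) ∣ x i - y i)
    (hcop : ∀ x ∈ T, IsCoprime (eval x (pderiv 0 g)) (m:ℤ))
    (hlines : ∀ P ∈ T, ∀ P' ∈ T, P ≠ P' → ∃ s : ℤ, eval (fun i => P i + s * (P' i - P i)) g ≠ 0)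
    (p : MvPolynomial (Fin 2) ℤ) (hp : Irreducible p) (hp1 : p.totalDegree = 1)
    (hpz : ∀ x ∈ T, eval (Fin.tail x) p = 0) : T.card ≤ 3 * (2 * 8 * 8 + 8) ^ 2 := by
  classical
  rcases T.eq_empty_or_nonempty with rfl | ⟨P0, hP0⟩
  · simp
  set γ := coeff 0 p with hγ
  set α := coeff (Finsupp.single 0 1) p with hα
  set β := coeff (Finsupp.single 1 1) p with hβ
  have hlf : p = C γ + (C α * X 0 + C β * X 1) := by
    have := linear_form p hp1.le
    rwa [Fin.sum_univ_two] at this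
  have hev : ∀ x ∈ T, γ + (α * x 1 + β * x 2) = 0 := by
    intro x hx
    have := hpz x hx
    rw [hlf] at this
    simpa [Fin.tail] using this
  have hco : IsCoprime α β := by
    rw [Int.isCoprime_iff_gcd_eq_one]
    set d := Int.gcd α β
    have ha : (d:ℤ) ∣ α := Int.gcd_dvd_left _ _
    have hb : (d:ℤ) ∣ β := Int.gcd_dvd_right _ _
    have hc : (d:ℤ) ∣ γ := by
      have := hev P0 hP0
      have e : γ = -(α * P0 1 + β * P0 2) := by linarith
      rw [e]
      exact (dvd_add (ha.mul_right _) (hb.mul_right _)).neg_right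
    obtain ⟨a, ha⟩ := ha
    obtain ⟨b, hb⟩ := hb
    obtain ⟨c, hc⟩ := hc
    have hfac : p = C (d:ℤ) * (C c + (C a * X 0 + C b * X 1)) := by
      rw [hlf, ha, hb, hc]
      simp only [map_mul]
      ring
    rcases hp.isUnit_or_isUnit hfac with h | h
    · have h := h.map (eval (fun _ => (0:ℤ)))
      rw [eval_C, Int.isUnit_iff] at h
      omega
    · exfalso
      have has : Associated p (C (d:ℤ)) := by
        rw [hfac]
        exact (associated_mul_isUnit_left_iff h).2 (Associated.refl _)
      have := totalDegree_eq_of_assoc has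
      rw [hp1, totalDegree_C] at this
      omega
  obtain ⟨u, v, huv⟩ := hco
  set x1 := P0 1 with hx1
  set y1 := P0 2 with hy1
  let τ : (Fin 3 → ℤ) → ℤ := fun P => v * (P 1 - x1) - u * (P 2 - y1)
  have hlin : ∀ P ∈ T, α * (P 1 - x1) + β * (P 2 - y1) = 0 := by
    intro P hP
    linarith [hev P hP, hev P0 hP0]
  have hxx : ∀ P ∈ T, P 1 - x1 = β * τ P := by
    intro P hP
    have := hlin P hP
    simp only [τ]
    linear_combination (-(P 1 - x1)) * huv + u * this
  have hyy : ∀ P ∈ T, P 2 - y1 = -(α * τ P) := by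
    intro P hP
    have := hlin P hP
    simp only [τ]
    linear_combination (-(P 2 - y1)) * huv + v * this
  have hτ : ∀ P ∈ T, |τ P| ≤ ((2 * N : ℕ):ℤ) := by
    intro P hP
    have b1 := hbox P hP
    have b0 := hbox P0 hP0
    push_cast
    by_cases hb : β = 0
    · have ha : α ≠ 0 := by
        rintro ha
        rw [ha, hb] at huv; simp at huv
      have e := hyy P hP
      have : |P 2 - y1| = |α| * |τ P| := by rw [e, abs_neg, abs_mul]
      have h3 : |P 2 - y1| ≤ |P 2| + |y1| := abs_sub _ _
      have h4 : 1 ≤ |α| := Int.one_le_abs ha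
      have h5 := b1 2
      have h6 := b0 2
      nlinarith [abs_nonneg (τ P)]
    · have e := hxx P hP
      have : |P 1 - x1| = |β| * |τ P| := by rw [e, abs_mul]
      have h3 : |P 1 - x1| ≤ |P 1| + |x1| := abs_sub _ _
      have h4 : 1 ≤ |β| := Int.one_le_abs hb
      have h5 := b1 1
      have h6 := b0 1
      nlinarith [abs_nonneg (τ P)]
  let f : Fin 3 → MvPolynomial (Fin 2) ℤ := ![X 0, C x1 + C β * X 1, C y1 - C α * X 1]
  let φ : (Fin 3 → ℤ) → (Fin 2 → ℤ) := fun P => ![P 0, τ P]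
  have hφ : ∀ P ∈ T, (fun i => eval (φ P) (f i)) = P := by
    intro P hP
    have e1 := hxx P hP
    have e2 := hyy P hP
    funext i
    fin_cases i
    · simp [f, φ]
    · simp [f, φ]; linarith
    · simp [f, φ]; linarith
  set c := aeval f g with hc
  have hcev : ∀ P ∈ T, ∀ q : MvPolynomial (Fin 3) ℤ, eval (φ P) (aeval f q) = eval P q := by
    intro P hP q
    rw [eval_aeval', hφ P hP]
  have hpd : pderiv 0 c = aeval f (pderiv 0 g) := by
    apply pderiv_aeval0
    · rfl
    · intro i
      fin_cases i
      · simp [f, pderiv_X]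
      · simp [f, pderiv_X]
  have htd : c.totalDegree ≤ 3 := by
    refine (td_aeval_le f ?_ g).trans hg.1
    have hh : ∀ a b : ℤ, (C a * X 1 : MvPolynomial (Fin 2) ℤ).totalDegree ≤ 1 := by
      intro a b
      refine (totalDegree_mul _ _).trans ?_
      rw [totalDegree_C, totalDegree_X]
    intro i
    fin_cases i
    · simp [f]
    · refine (totalDegree_add _ _).trans ?_
      simp only [totalDegree_C]
      exact max_le (by omega) (hh _ 0)
    · refine (totalDegree_sub _ _).trans ?_
      simp only [totalDegree_C]
      exact max_le (by omega) (hh _ 0)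
  have hcopc : ∀ P ∈ T, IsCoprime (eval (φ P) (pderiv 0 c)) (m:ℤ) := by
    intro P hP
    rw [hpd, hcev P hP]
    exact hcop P hP
  have hc0 : c ≠ 0 := by
    intro h
    have := hcopc P0 hP0
    rw [h] at this
    simp only [map_zero] at this
    rw [isCoprime_zero_left, Int.isUnit_iff] at this
    omega
  have hcz : ∀ P ∈ T, eval (φ P) c = 0 := by
    intro P hP
    rw [hc, hcev P hP]; exact hz P hP
  have hφinj : ∀ P ∈ T, ∀ P' ∈ T, φ P = φ P' → P = P' := by
    intro P hP P' hP' h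
    rw [← hφ P hP, ← hφ P' hP', h]
  apply factor_cover c hc0 3 _ htd T φ (fun _ _ => True) (fun _ _ _ => trivial)
  · intro P hP
    obtain ⟨q, h3, h4, h5⟩ := exists_irr_factor c hc0 (φ P) (hcz P hP)
    exact ⟨q, h3, h4, h5, trivial⟩
  · intro q hq hqc T' hT' hT'q
    by_cases hq2 : 2 ≤ q.totalDegree
    · have hinj : (T'.image φ).card = T'.card := by
        apply Finset.card_image_of_injOn
        intro a ha b hb h
        exact hφinj a (hT' ha) b (hT' hb) h
      rw [← hinj]
      refine core' q hq (2 * N) m 8 le_rfl ?_ hq2 (by omega) (by omega) h1 ?_ _ ?_ ?_ 0 ?_ ?_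
      · have := td_le_of_dvd hqc hc0
        omega
      · exact h2.trans (Nat.pow_le_pow_left (by omega) _)
      · intro x hx
        obtain ⟨P, hP, rfl⟩ := Finset.mem_image.1 hx
        exact (hT'q P hP).1
      · intro x hx y hy i
        obtain ⟨P, hP, rfl⟩ := Finset.mem_image.1 hx
        obtain ⟨P', hP', rfl⟩ := Finset.mem_image.1 hy
        have hh := hcong P (hT' hP) P' (hT' hP')
        fin_cases i
        · simpa [φ] using hh 0
        · have : φ P 1 - φ P' 1 = v * (P 1 - P' 1) - u * (P 2 - P' 2) := by
            simp [φ, τ]; ring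
          change (m:ℤ) ∣ φ P 1 - φ P' 1
          rw [this]
          exact dvd_sub ((hh 1).mul_left _) ((hh 2).mul_left _)
      · intro x hx
        obtain ⟨P, hP, rfl⟩ := Finset.mem_image.1 hx
        have h3 := hcopc P (hT' hP)
        obtain ⟨w, hw⟩ := hqc
        rw [hw, pderiv_mul, map_add, map_mul, map_mul, (hT'q P hP).1, zero_mul, add_zero] at h3
        exact h3.of_mul_left_left
      · intro x hx
        obtain ⟨P, hP, rfl⟩ := Finset.mem_image.1 hx
        intro i
        fin_cases i
        · have := hbox P (hT' hP) 0
          simp only [φ]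
          push_cast
          simp
          linarith [abs_nonneg (P 0)]
        · exact hτ P (hT' hP)
    · refine le_trans (Finset.card_le_one.2 ?_) (by norm_num)
      intro P hP P' hP'
      by_contra hne
      obtain ⟨s, hs⟩ := hlines P (hT' hP) P' (hT' hP') hne
      apply hs
      have h3 : eval (fun i => φ P i + s * (φ P' i - φ P i)) q = 0 := by
        rw [eval_linear_line q (by omega), (hT'q P hP).1, (hT'q P' hP').1]
        ring
      have h4 : eval (fun i => φ P i + s * (φ P' i - φ P i)) c = 0 := by
        obtain ⟨w, hw⟩ := hqc
        rw [hw, map_mul, h3, zero_mul]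
      rw [hc, eval_aeval'] at h4
      rw [← h4]
      congr 2
      funext i
      have e1 := hxx P (hT' hP)
      have e2 := hyy P (hT' hP)
      have e3 := hxx P' (hT' hP')
      have e4 := hyy P' (hT' hP')
      fin_cases i
      · simp [f, φ]
      · simp [f, φ]; linear_combination (1 - s) * e1 + s * e3
      · simp [f, φ]; linear_combination (1 - s) * e2 + s * e4

theorem end_count {g : MvPolynomial (Fin 3) ℤ} (hg : Surf g) (N m B : ℕ) (hB8 : 8 ≤ B)
    (hN : 1 ≤ N) (hm : 1 < m) (h1 : 17 * (2 * N) ^ 8 < m ^ 14) (h2 : m ^ 105 ≤ N ^ 64)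
    (T : Finset (Fin 3 → ℤ)) (hbox : ∀ x ∈ T, Box N x) (hz : ∀ x ∈ T, eval x g = 0)
    (hcong : ∀ x ∈ T, ∀ y ∈ T, ∀ i, (m:ℤ) ∣ x i - y i)
    (hcop : ∀ x ∈ T, IsCoprime (eval x (pderiv 0 g)) (m:ℤ))
    (hlines : ∀ P ∈ T, ∀ P' ∈ T, P ≠ P' → ∃ s : ℤ, eval (fun i => P i + s * (P' i - P i)) g ≠ 0)
    (p : MvPolynomial (Fin 2) ℤ) (hp : Irreducible p) (hpB : p.totalDegree ≤ B)
    (hpz : ∀ x ∈ T, eval (Fin.tail x) p = 0) (i : Fin 2)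
    (hpi : ∀ x ∈ T, IsCoprime (eval (Fin.tail x) (pderiv i p)) (m:ℤ)) :
    T.card ≤ 3 * (2 * B * B + B) ^ 2 := by
  classical
  by_cases hp2 : 2 ≤ p.totalDegree
  · apply hg.tail_count T hz
    apply core' p hp N m B hB8 hpB hp2 hN (by omega) _ h2 _ _ _ i
    · intro x hx
      obtain ⟨P, hP, rfl⟩ := Finset.mem_image.1 hx
      exact hpi P hP
    · intro x hx
      obtain ⟨P, hP, rfl⟩ := Finset.mem_image.1 hx
      intro j
      exact hbox P hP j.succ
    · refine lt_of_le_of_lt ?_ h1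
      exact Nat.mul_le_mul_left _ (Nat.pow_le_pow_left (by omega) _)
    · intro x hx
      obtain ⟨P, hP, rfl⟩ := Finset.mem_image.1 hx
      exact hpz P hP
    · intro x hx y hy j
      obtain ⟨P, hP, rfl⟩ := Finset.mem_image.1 hx
      obtain ⟨P', hP', rfl⟩ := Finset.mem_image.1 hy
      exact hcong P hP P' hP' j.succ
  · rcases T.eq_empty_or_nonempty with rfl | ⟨P0, hP0⟩
    · simp
    have h0 := irr_nonconst hp (hpz P0 hP0)
    refine (lin_end hg N m hN hm h1 h2 T hbox hz hcong hcop hlines p hp (by omega) hpz).trans ?_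
    gcongr

end DG


namespace DG
open MvPolynomial

theorem cover_count (g : MvPolynomial (Fin 3) ℤ) (T : Finset (Fin 3 → ℤ))
    (hT : ∀ x ∈ T, eval x g = 0) (r m : ℕ) (hr : 0 < r) (hm0 : 0 < m) (j : ℕ) (hm : m ∣ r ^ j)
    (hcop : ∀ x ∈ T, IsCoprime (eval x (pderiv 0 g)) (r:ℤ))
    (R : (Fin 3 → ℤ) → MvPolynomial (Fin 2) ℤ) (B K : ℕ)
    (hRc : ∀ x ∈ T, ∀ y ∈ T, (∀ i, (m:ℤ) ∣ x i - y i) → R x = R y)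
    (hR : ∀ x ∈ T, R x ≠ 0 ∧ (R x).totalDegree ≤ B)
    (Q : MvPolynomial (Fin 2) ℤ → (Fin 3 → ℤ) → Prop) (hQ : ∀ p P, Q p P → Q (-p) P)
    (hTQ : ∀ P ∈ T, ∃ p, Irreducible p ∧ p ∣ R P ∧ eval (Fin.tail P) p = 0 ∧ Q p P)
    (hK : ∀ p, Irreducible p → p.totalDegree ≤ B → ∀ T' ⊆ T,
      (∀ x ∈ T', ∀ y ∈ T', ∀ i, (m:ℤ) ∣ x i - y i) →
      (∀ P ∈ T', eval (Fin.tail P) p = 0 ∧ p ∣ R P ∧ Q p P) → T'.card ≤ K) :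
    T.card ≤ m ^ 2 * r * (B * K) := by
  apply class_count g T hT r m hr hm0 j hm hcop
  intro T' hT' hc
  rcases T'.eq_empty_or_nonempty with rfl | ⟨P0, hP0⟩
  · simp
  have hconst : ∀ P ∈ T', R P = R P0 := fun P hP => hRc P (hT' hP) P0 (hT' hP0) (hc P hP P0 hP0)
  have h0 := hR P0 (hT' hP0)
  apply factor_cover (R P0) h0.1 B K h0.2 T' Fin.tail Q hQ
  · intro P hP
    rw [← hconst P hP]
    exact hTQ P (hT' hP)
  · intro p hp hpd T'' hT'' h
    apply hK p hp ((td_le_of_dvd hpd h0.1).trans h0.2) T'' (hT''.trans hT')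
    · intro x hx y hy
      exact hc x (hT'' hx) y (hT'' hy)
    · intro P hP
      exact ⟨(h P hP).1, by rw [hconst P (hT'' hP)]; exact hpd, (h P hP).2⟩

theorem cop_of_prime {p : ℕ} (hp : p.Prime) {u : ℤ} (h : ¬ (p:ℤ) ∣ u) : IsCoprime u (p:ℤ) := by
  have := (Nat.prime_iff_prime_int.1 hp).irreducible
  exact (this.coprime_iff_not_dvd.2 h).symm

theorem exists_bb (p c Q : ℕ) (hp : 2 ≤ p) (hc : 1 ≤ c) :
    ∃ b, Q ≤ c * p ^ b ∧ ∀ b', Q ≤ c * p ^ b' → b ≤ b' := by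
  classical
  have : ∃ b, Q ≤ c * p ^ b := ⟨Q, by
    have h1 : Q < p ^ Q := Nat.lt_pow_self (by omega)
    nlinarith⟩
  exact ⟨Nat.find this, Nat.find_spec this, fun b' h => Nat.find_min' this h⟩

/-- The determinant-method count, with all parameters explicit. -/
theorem S_core {g : MvPolynomial (Fin 3) ℤ} (hg : Surf g) (N Q Y B k : ℕ) (PP : Finset ℕ)
    (hN : 512 ≤ N) (hB : B = (Nat.log 2 N + 4)^2) (hB8 : 8 ≤ B)
    (hQ : Real.exp 11 * (N:ℝ)^(1/√3) ≤ Q) (hQ2 : 2 ≤ Q)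
    (hPP : ∀ p ∈ PP, p.Prime ∧ p ≤ Y) (hk : k < PP.card) (hPPY : PP.card ≤ Y)
    (hYN : Y * Q ≤ N) (h105 : (Y * Q) ^ 105 ≤ N ^ 64) (h17 : 17 * (2 * N) ^ 8 < Q ^ 14)
    (T : Finset (Fin 3 → ℤ)) (hbox : ∀ x ∈ T, Box N x) (hz : ∀ x ∈ T, eval x g = 0)
    (hgz : ∀ x ∈ T, eval x (pderiv 0 g) ≠ 0 ∧ |eval x (pderiv 0 g)| * (Ub N B : ℤ) ≤ 2 ^ k)
    (hUb : 1 ≤ Ub N B)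
    (hlines : ∀ P ∈ T, ∀ P' ∈ T, P ≠ P' → ∃ s : ℤ, eval (fun i => P i + s * (P' i - P i)) g ≠ 0) :
    T.card ≤ (Y * Y * (B + 4)) * (Y ^ 6 * Q ^ 2 * (B * (3 * (2 * B * B + B) ^ 2))) := by
  classical
  -- auxiliary polynomials
  have hex : ∀ (m : ℕ) (κ : Fin 3 → ℤ), Q ≤ m → m ≤ N →
      ∃ R : MvPolynomial (Fin 2) ℤ, R ≠ 0 ∧ R.totalDegree ≤ B ∧
        ∀ x ∈ T, (∀ i, x i % m = κ i) → IsCoprime (eval x (pderiv 0 g)) (m:ℤ) →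
          eval (Fin.tail x) R = 0 := by
    intro m κ h1 h2
    obtain ⟨R, h3, h4, h5⟩ := aux3 hg hN (hQ.trans (by exact_mod_cast h1)) h2
      (T.filter (fun x => (∀ i, x i % m = κ i) ∧ IsCoprime (eval x (pderiv 0 g)) (m:ℤ))) κ
      (fun x hx => hz x (Finset.mem_filter.1 hx).1)
      (fun x hx i => by
        rw [← (Finset.mem_filter.1 hx).2.1 i]
        exact Int.dvd_self_sub_emod)
      (fun x hx => (Finset.mem_filter.1 hx).2.2)
      (fun x hx => hbox x (Finset.mem_filter.1 hx).1)
    refine ⟨R, h3, hB ▸ h4, fun x hx h6 h7 => h5 x (Finset.mem_filter.2 ⟨hx, h6, h7⟩)⟩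
  choose! Rf hRf0 hRfd hRfz using hex
  let RR : ℕ → (Fin 3 → ℤ) → MvPolynomial (Fin 2) ℤ := fun m P => Rf m (fun i => P i % m)
  have hRc : ∀ m M : ℕ, m ∣ M → ∀ x y : Fin 3 → ℤ, (∀ i, (M:ℤ) ∣ x i - y i) → RR m x = RR m y := by
    intro m M hmM x y h
    simp only [RR]
    congr 1
    funext i
    exact (Int.modEq_iff_dvd.2 ((Int.natCast_dvd_natCast.2 hmM).trans (h i))).symm
  have hR0 : ∀ m, Q ≤ m → m ≤ N → ∀ P, RR m P ≠ 0 ∧ (RR m P).totalDegree ≤ B :=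
    fun m h1 h2 P => ⟨hRf0 m _ h1 h2, hRfd m _ h1 h2⟩
  have hRz : ∀ m, Q ≤ m → m ≤ N → ∀ P ∈ T, IsCoprime (eval P (pderiv 0 g)) (m:ℤ) →
      eval (Fin.tail P) (RR m P) = 0 :=
    fun m h1 h2 P hP hc => hRfz m _ h1 h2 P hP (fun _ => rfl) hc
  have hbb : ∀ p c : ℕ, 2 ≤ p → 1 ≤ c → ∃ b, Q ≤ c * p ^ b ∧ ∀ b', Q ≤ c * p ^ b' → b ≤ b' :=
    fun p c h1 h2 => exists_bb p c Q h1 h2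
  choose! bb hbb1 hbb2 using hbb
  let J : ℕ → ℕ := fun p => bb p 1
  let mm : ℕ → ℕ → ℕ → ℕ := fun p q a => p ^ a * q ^ (bb q (p ^ a))
  set L := B * (3 * (2 * B * B + B) ^ 2) with hL
  have hJB : ∀ p ∈ PP, J p ≤ B := by
    intro p hp
    have hp2 := (hPP p hp).1.two_le
    rcases Nat.eq_zero_or_pos (J p) with h | h
    · omega
    have h1 : ¬ Q ≤ 1 * p ^ (J p - 1) := fun hc => by
      have := hbb2 p 1 hp2 le_rfl _ hc
      simp only [J] at h this
      omega
    have h2 : 2 ^ (J p - 1) ≤ N := by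
      have h3 : 2 ^ (J p - 1) ≤ p ^ (J p - 1) := Nat.pow_le_pow_left hp2 _
      have h4 : Y ≠ 0 := by have := (hPP p hp).2; omega
      have h5 : Q ≤ Y * Q := Nat.le_mul_of_pos_left _ (by omega)
      omega
    have h3 : J p - 1 ≤ Nat.log 2 N := Nat.le_log_of_pow_le (by norm_num) h2
    have h4 : J p ≤ Nat.log 2 N + 4 := by omega
    rw [hB]
    nlinarith
  have hpow : ∀ p : ℕ, 2 ≤ p → ∀ a, 1 ≤ p ^ a := fun p h a => Nat.one_le_pow _ _ (by omega)
  have hmQ : ∀ p ∈ PP, ∀ q ∈ PP, ∀ a, Q ≤ mm p q a := fun p hp q hq a =>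
    hbb1 q (p ^ a) (hPP q hq).1.two_le (hpow p (hPP p hp).1.two_le a)
  have hstep : ∀ q ∈ PP, ∀ c, 1 ≤ c → 0 < bb q c → c * q ^ bb q c ≤ Y * Q := by
    intro q hq c hc hb
    have hq2 := (hPP q hq).1.two_le
    have h1 : ¬ Q ≤ c * q ^ (bb q c - 1) := fun hcc => by
      have := hbb2 q c hq2 hc _ hcc
      omega
    have h2 : c * q ^ bb q c = q * (c * q ^ (bb q c - 1)) := by
      obtain ⟨b, hb'⟩ : ∃ b, bb q c = b + 1 := ⟨bb q c - 1, by omega⟩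
      rw [hb', Nat.add_sub_cancel, pow_succ]; ring
    rw [h2]
    exact Nat.mul_le_mul (hPP q hq).2 (by omega)
  have hJpos : ∀ p ∈ PP, 0 < J p := by
    intro p hp
    by_contra h
    have h1 := hbb1 p 1 (hPP p hp).1.two_le le_rfl
    have h0 : bb p 1 = 0 := by simp only [J] at h; omega
    rw [h0, pow_zero] at h1
    omega
  have hmY : ∀ p ∈ PP, ∀ q ∈ PP, ∀ a, a ≤ J p → mm p q a ≤ Y * Q := by
    intro p hp q hq a ha
    have hp2 := (hPP p hp).1.two_le
    rcases Nat.eq_zero_or_pos (bb q (p ^ a)) with h | h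
    · have h1 := hmQ p hp q hq a
      simp only [mm] at h1 ⊢
      rw [h, pow_zero, mul_one] at h1 ⊢
      have h2 := hbb2 p 1 hp2 le_rfl a (by rw [one_mul]; exact h1)
      have h3 : a = bb p 1 := le_antisymm ha h2
      have h4 := hstep p hp 1 le_rfl (hJpos p hp)
      rw [h3]; simpa using h4
    · exact hstep q hq _ (hpow p hp2 a) h
  have hmN : ∀ p ∈ PP, ∀ q ∈ PP, ∀ a, a ≤ J p → mm p q a ≤ N :=
    fun p hp q hq a ha => (hmY p hp q hq a ha).trans hYN
  have hmJ : ∀ p ∈ PP, ∀ q ∈ PP, mm p q (J p) = p ^ (J p) := by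
    intro p hp q hq
    have h1 := hbb2 q (p ^ J p) (hPP q hq).1.two_le (hpow p (hPP p hp).1.two_le _) 0 (by
      have := hbb1 p 1 (hPP p hp).1.two_le le_rfl
      simpa [J] using this)
    have h2 : bb q (p ^ J p) = 0 := by omega
    simp only [mm]
    rw [h2, pow_zero, mul_one]
  -- the three kinds of sets
  let gz : (Fin 3 → ℤ) → ℤ := fun P => eval P (pderiv 0 g)
  let SD : ℕ → Finset (Fin 3 → ℤ) := fun p => T.filter (fun P => ¬ (p:ℤ) ∣ gz P ∧
    ∃ π, Irreducible π ∧ π ∣ RR (p ^ J p) P ∧ eval (Fin.tail P) π = 0 ∧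
      ∀ i, eval (Fin.tail P) (pderiv i π) = 0 ∨ (Ub N B : ℤ) < |eval (Fin.tail P) (pderiv i π)|)
  let SW : ℕ → ℕ → ℕ → Finset (Fin 3 → ℤ) := fun p q a => T.filter (fun P =>
    a < J p ∧ ¬ (p:ℤ) ∣ gz P ∧ ¬ (q:ℤ) ∣ gz P ∧
    ∃ π, Irreducible π ∧ π ∣ RR (mm p q (a+1)) P ∧ eval (Fin.tail P) π = 0 ∧ ¬ π ∣ RR (mm p q a) P)
  let SE : ℕ → Fin 2 → Finset (Fin 3 → ℤ) := fun q i => T.filter (fun P => ¬ (q:ℤ) ∣ gz P ∧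
    ∃ π, Irreducible π ∧ π ∣ RR (q ^ J q) P ∧ eval (Fin.tail P) π = 0 ∧
      ¬ (q:ℤ) ∣ eval (Fin.tail P) (pderiv i π))
  have hJQ : ∀ p ∈ PP, Q ≤ p ^ J p ∧ p ^ J p ≤ Y * Q := fun p hp => by
    rw [← hmJ p hp p hp]
    exact ⟨hmQ p hp p hp _, hmY p hp p hp _ le_rfl⟩
  have hfin : ∀ (m r : ℕ), m ≤ Y * (Y * Q) → r ≤ Y * Y → m ^ 2 * r * L ≤ Y ^ 6 * Q ^ 2 * L := by
    intro m r h1 h2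
    have : m ^ 2 * r ≤ (Y * (Y * Q)) ^ 2 * (Y * Y) := Nat.mul_le_mul (Nat.pow_le_pow_left h1 2) h2
    calc m ^ 2 * r * L ≤ (Y * (Y * Q)) ^ 2 * (Y * Y) * L := Nat.mul_le_mul_right _ this
      _ = _ := by ring
  have hSD : ∀ p ∈ PP, (SD p).card ≤ Y ^ 6 * Q ^ 2 * L := by
    intro p hp
    have hpY := (hPP p hp).2
    have hp0 := (hPP p hp).1.pos
    refine le_trans ?_ (hfin (p ^ J p) p ((hJQ p hp).2.trans (Nat.le_mul_of_pos_left _ (by omega))) (by nlinarith))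
    refine cover_count g (SD p) (fun x hx => hz x (Finset.mem_filter.1 hx).1) p (p ^ J p) hp0
      (pow_pos hp0 _) (J p) dvd_rfl
      (fun x hx => cop_of_prime (hPP p hp).1 (Finset.mem_filter.1 hx).2.1)
      (RR (p ^ J p)) B _ (fun x _ y _ h => hRc _ _ dvd_rfl x y h)
      (fun x _ => hR0 _ (hJQ p hp).1 ((hJQ p hp).2.trans hYN) x)
      (fun π P => ∀ i, eval (Fin.tail P) (pderiv i π) = 0 ∨ (Ub N B : ℤ) < |eval (Fin.tail P) (pderiv i π)|)
      ?_ (fun P hP => (Finset.mem_filter.1 hP).2.2) ?_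
    · intro π P h i
      simpa using h i
    · intro π hπ hπB T' hT' _ h
      apply hg.tail_count T' (fun x hx => hz x (Finset.mem_filter.1 (hT' hx)).1)
      apply sing_count (by omega : 1 ≤ N) π hπ hπB
      · intro x hx
        obtain ⟨P, hP, rfl⟩ := Finset.mem_image.1 hx
        exact ⟨fun i => hbox P (Finset.mem_filter.1 (hT' hP)).1 i.succ, (h P hP).1⟩
      · intro x hx
        obtain ⟨P, hP, rfl⟩ := Finset.mem_image.1 hx
        exact (h P hP).2.2
  have hSE : ∀ q ∈ PP, ∀ i, (SE q i).card ≤ Y ^ 6 * Q ^ 2 * L := by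
    intro p hp i
    have hpY := (hPP p hp).2
    have hp0 := (hPP p hp).1.pos
    refine le_trans ?_ (hfin (p ^ J p) p ((hJQ p hp).2.trans (Nat.le_mul_of_pos_left _ (by omega))) (by nlinarith))
    refine cover_count g (SE p i) (fun x hx => hz x (Finset.mem_filter.1 hx).1) p (p ^ J p) hp0
      (pow_pos hp0 _) (J p) dvd_rfl
      (fun x hx => cop_of_prime (hPP p hp).1 (Finset.mem_filter.1 hx).2.1)
      (RR (p ^ J p)) B _ (fun x _ y _ h => hRc _ _ dvd_rfl x y h)
      (fun x _ => hR0 _ (hJQ p hp).1 ((hJQ p hp).2.trans hYN) x)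
      (fun π P => ¬ (p:ℤ) ∣ eval (Fin.tail P) (pderiv i π))
      ?_ (fun P hP => (Finset.mem_filter.1 hP).2.2) ?_
    · intro π P h
      simpa using h
    · intro π hπ hπB T' hT' hc h
      have hT'T : ∀ x ∈ T', x ∈ T := fun x hx => (Finset.mem_filter.1 (hT' hx)).1
      have hJQp := hJQ p hp
      refine end_count hg N (p ^ J p) B hB8 (by omega) (by omega) ?_ ?_ T' (fun x hx => hbox x (hT'T x hx))
        (fun x hx => hz x (hT'T x hx)) hc ?_
        (fun P hP P' hP' => hlines P (hT'T P hP) P' (hT'T P' hP')) π hπ hπB (fun x hx => (h x hx).1) i ?_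
      · exact h17.trans_le (Nat.pow_le_pow_left hJQp.1 _)
      · exact (Nat.pow_le_pow_left hJQp.2 _).trans h105
      · intro x hx
        push_cast
        exact (cop_of_prime (hPP p hp).1 (Finset.mem_filter.1 (hT' hx)).2.1).pow_right
      · intro x hx
        push_cast
        exact (cop_of_prime (hPP p hp).1 (h x hx).2.2).pow_right
  have hSW : ∀ p ∈ PP, ∀ q ∈ PP, ∀ a, (SW p q a).card ≤ Y ^ 6 * Q ^ 2 * L := by
    intro p hp q hq a
    by_cases ha : a < J p
    swap
    · have : SW p q a = ∅ := Finset.filter_false_of_mem (fun x _ h => ha h.1)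
      rw [this]; simp
    have hpY := (hPP p hp).2
    have hqY := (hPP q hq).2
    have hp0 := (hPP p hp).1.pos
    have hq0 := (hPP q hq).1.pos
    have hp2 := (hPP p hp).1.two_le
    set M := p * mm p q a with hM
    have hmpos : 0 < mm p q a := lt_of_lt_of_le (by omega) (hmQ p hp q hq a)
    have hd0 : mm p q a ∣ M := dvd_mul_left _ _
    have hd1 : mm p q (a+1) ∣ M := by
      have h1 : bb q (p ^ (a+1)) ≤ bb q (p ^ a) := by
        apply hbb2 q _ (hPP q hq).1.two_le (hpow p hp2 _)
        refine (hbb1 q (p ^ a) (hPP q hq).1.two_le (hpow p hp2 _)).trans ?_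
        exact Nat.mul_le_mul_right _ (Nat.pow_le_pow_right hp0 (by omega))
      have h2 : M = p ^ (a+1) * q ^ (bb q (p ^ a)) := by
        simp only [hM, mm]; ring
      rw [h2]
      exact Nat.mul_dvd_mul_left _ (pow_dvd_pow _ h1)
    have hcopW : ∀ x ∈ SW p q a, IsCoprime (gz x) (p:ℤ) ∧ IsCoprime (gz x) (q:ℤ) := fun x hx =>
      ⟨cop_of_prime (hPP p hp).1 (Finset.mem_filter.1 hx).2.2.1,
        cop_of_prime (hPP q hq).1 (Finset.mem_filter.1 hx).2.2.2.1⟩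
    refine le_trans ?_ (hfin M (p * q) (Nat.mul_le_mul hpY (hmY p hp q hq a ha.le)) (Nat.mul_le_mul hpY hqY))
    refine cover_count g (SW p q a) (fun x hx => hz x (Finset.mem_filter.1 hx).1) (p * q) M
      (Nat.mul_pos hp0 hq0) (Nat.mul_pos hp0 hmpos) (a + 1 + bb q (p ^ a)) ?_
      (fun x hx => by push_cast; exact (hcopW x hx).1.mul_right (hcopW x hx).2)
      (RR (mm p q (a+1))) B _ (fun x _ y _ h => hRc _ _ hd1 x y h)
      (fun x _ => hR0 _ (hmQ p hp q hq _) (hmN p hp q hq _ (by omega)) x)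
      (fun π P => ¬ π ∣ RR (mm p q a) P)
      ?_ (fun P hP => (Finset.mem_filter.1 hP).2.2.2.2) ?_
    · have h2 : M = p ^ (a+1) * q ^ (bb q (p ^ a)) := by
        simp only [hM, mm]; ring
      rw [h2, mul_pow]
      exact Nat.mul_dvd_mul (pow_dvd_pow _ (by omega)) (pow_dvd_pow _ (by omega))
    · intro π P h
      rwa [neg_dvd]
    · intro π hπ hπB T' hT' hc h
      have hT'T : ∀ x ∈ T', x ∈ T := fun x hx => (Finset.mem_filter.1 (hT' hx)).1
      rcases T'.eq_empty_or_nonempty with rfl | ⟨P0, hP0⟩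
      · simp
      apply hg.tail_count T' (fun x hx => hz x (hT'T x hx))
      have hR0' := hR0 _ (hmQ p hp q hq a) (hmN p hp q hq a ha.le) P0
      apply cz B π (RR (mm p q a) P0) hπ (h P0 hP0).2.2 hπB hR0'.2
      intro x hx
      obtain ⟨P, hP, rfl⟩ := Finset.mem_image.1 hx
      refine ⟨(h P hP).1, ?_⟩
      rw [← hRc _ _ hd0 P P0 (hc P hP P0 hP0)]
      apply hRz _ (hmQ p hp q hq a) (hmN p hp q hq a ha.le) P (hT'T P hP)
      have := hcopW P (hT' hP)
      simp only [mm]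
      push_cast
      exact this.1.pow_right.mul_right this.2.pow_right
  have hcov : T ⊆ (PP ×ˢ PP).biUnion (fun z => SD z.1 ∪ (Finset.range B).biUnion (SW z.1 z.2) ∪
      (SE z.2 0 ∪ SE z.2 1)) := by
    intro P hP
    have hPg := hgz P hP
    have hUz : (1:ℤ) ≤ Ub N B := by exact_mod_cast hUb
    obtain ⟨p, hp, hpd⟩ := exists_prime_not_dvd PP (fun p hp => (hPP p hp).1) k hk (gz P) hPg.1 (by
      refine le_trans ?_ hPg.2
      simp only [gz]
      nlinarith [abs_nonneg (eval P (pderiv 0 g))])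
    rw [Finset.mem_biUnion]
    have hc1 := cop_of_prime (hPP p hp).1 hpd
    obtain ⟨π, hπ, hπd, hπz⟩ := exists_irr_factor (RR (p ^ J p) P)
      (hR0 _ (hJQ p hp).1 ((hJQ p hp).2.trans hYN) P).1 (Fin.tail P)
      (hRz _ (hJQ p hp).1 ((hJQ p hp).2.trans hYN) P hP (by push_cast; exact hc1.pow_right))
    by_cases hs : ∀ i, eval (Fin.tail P) (pderiv i π) = 0 ∨ (Ub N B : ℤ) < |eval (Fin.tail P) (pderiv i π)|
    · exact ⟨(p, p), Finset.mem_product.2 ⟨hp, hp⟩, Finset.mem_union_left _ (Finset.mem_union_left _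
        (Finset.mem_filter.2 ⟨hP, hpd, π, hπ, hπd, hπz, hs⟩))⟩
    push Not at hs
    obtain ⟨i, hi0, hiU⟩ := hs
    obtain ⟨q, hq, hqd⟩ := exists_prime_not_dvd PP (fun p hp => (hPP p hp).1) k hk
      (gz P * eval (Fin.tail P) (pderiv i π)) (mul_ne_zero hPg.1 hi0) (by
      refine le_trans ?_ hPg.2
      rw [abs_mul]
      exact mul_le_mul_of_nonneg_left hiU (abs_nonneg _))
    have hq1 : ¬ (q:ℤ) ∣ gz P := fun h => hqd (h.mul_right _)
    have hq2 : ¬ (q:ℤ) ∣ eval (Fin.tail P) (pderiv i π) := fun h => hqd (h.mul_left _)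
    refine ⟨(p, q), Finset.mem_product.2 ⟨hp, hq⟩, ?_⟩
    have hexa : ∃ a, π ∣ RR (mm p q a) P := ⟨J p, by rw [hmJ p hp q hq]; exact hπd⟩
    have hspec := Nat.find_spec hexa
    have hle : Nat.find hexa ≤ J p := Nat.find_min' hexa (by rw [hmJ p hp q hq]; exact hπd)
    rcases hfa : Nat.find hexa with _ | a
    · apply Finset.mem_union_right
      rw [hfa] at hspec
      have e : mm p q 0 = q ^ J q := by simp [mm, J]
      rw [e] at hspec
      have : P ∈ SE q i := Finset.mem_filter.2 ⟨hP, hq1, π, hπ, hspec, hπz, hq2⟩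
      fin_cases i
      · exact Finset.mem_union_left _ this
      · exact Finset.mem_union_right _ this
    · apply Finset.mem_union_left
      apply Finset.mem_union_right
      rw [hfa] at hspec hle
      have hna : ¬ π ∣ RR (mm p q a) P := Nat.find_min hexa (by omega)
      have := hJB p hp
      exact Finset.mem_biUnion.2 ⟨a, Finset.mem_range.2 (by omega),
        Finset.mem_filter.2 ⟨hP, by show a < J p; omega, hpd, hq1, π, hπ, hspec, hπz, hna⟩⟩
  set K0 := Y ^ 6 * Q ^ 2 * L with hK0
  have hone : ∀ z ∈ PP ×ˢ PP, (SD z.1 ∪ (Finset.range B).biUnion (SW z.1 z.2) ∪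
      (SE z.2 0 ∪ SE z.2 1)).card ≤ (B + 4) * K0 := by
    intro z hz'
    obtain ⟨hz1, hz2⟩ := Finset.mem_product.1 hz'
    have b1 := hSD z.1 hz1
    have b2 := hSE z.2 hz2 0
    have b3 := hSE z.2 hz2 1
    have b4 : ((Finset.range B).biUnion (SW z.1 z.2)).card ≤ B * K0 := by
      have := Finset.card_biUnion_le_card_mul (Finset.range B) (SW z.1 z.2) K0
        (fun a _ => hSW z.1 hz1 z.2 hz2 a)
      rwa [Finset.card_range] at this
    have c1 := Finset.card_union_le (SD z.1 ∪ (Finset.range B).biUnion (SW z.1 z.2)) (SE z.2 0 ∪ SE z.2 1)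
    have c2 := Finset.card_union_le (SD z.1) ((Finset.range B).biUnion (SW z.1 z.2))
    have c3 := Finset.card_union_le (SE z.2 0) (SE z.2 1)
    rw [add_mul]
    omega
  refine (Finset.card_le_card hcov).trans ((Finset.card_biUnion_le_card_mul _ _ _ hone).trans ?_)
  rw [Finset.card_product, mul_assoc (Y * Y)]
  exact Nat.mul_le_mul_right _ (Nat.mul_le_mul hPPY hPPY)

end DG


namespace DG
open MvPolynomial

/-- Logarithmic size of `N`. -/
def lg (N : ℕ) : ℕ := Nat.log 2 N + 4

theorem lg_ge (N : ℕ) : 4 ≤ lg N := by unfold lg; omega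

theorem le_two_pow_lg (N : ℕ) : N ≤ 2 ^ lg N := by
  unfold lg
  have h1 : N < 2 ^ (Nat.log 2 N + 1) := Nat.lt_pow_succ_log_self (by norm_num) N
  exact h1.le.trans (Nat.pow_le_pow_right (by norm_num) (by omega))

theorem lg_mono {M N : ℕ} (h : M ≤ N) : lg M ≤ lg N := by
  unfold lg
  have := Nat.log_mono_right (b := 2) h
  omega

theorem params_exp (N : ℕ) :
    (4 ^ 3 * ((((64 * N ^ 3) ^ 64) * 3) * N ^ 3)) * Ub N ((lg N) ^ 2) ≤ 2 ^ (1000 * (lg N) ^ 7) := by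
  set l := lg N with hl
  have hl4 : 4 ≤ l := lg_ge N
  have hN : N ≤ 2 ^ l := le_two_pow_lg N
  have hB : l ^ 2 + 1 ≤ 2 ^ (2 * l) := by
    have h1 : l < 2 ^ l := Nat.lt_two_pow_self
    have : 2 ^ (2 * l) = (2 ^ l) ^ 2 := by rw [← pow_mul, mul_comm]
    rw [this]
    nlinarith
  have hB' : l ^ 2 ≤ 2 ^ (2 * l) := by omega
  have e1 : 4 ^ 3 * ((((64 * N ^ 3) ^ 64) * 3) * N ^ 3) ≤ 2 ^ (6 + (((6 + l * 3) * 64 + 2) + l * 3)) := by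
    have ee : (2:ℕ) ^ (6 + (((6 + l * 3) * 64 + 2) + l * 3)) =
        2 ^ 6 * (((2 ^ 6 * (2 ^ l) ^ 3) ^ 64 * 2 ^ 2) * (2 ^ l) ^ 3) := by
      rw [← pow_mul 2 l 3, ← pow_add, ← pow_mul, ← pow_add, ← pow_add, ← pow_add]
    rw [ee]
    have a1 : 64 * N ^ 3 ≤ 2 ^ 6 * (2 ^ l) ^ 3 := Nat.mul_le_mul (by norm_num) (Nat.pow_le_pow_left hN 3)
    have a2 : N ^ 3 ≤ (2 ^ l) ^ 3 := Nat.pow_le_pow_left hN 3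
    have a3 := Nat.pow_le_pow_left a1 64
    exact Nat.mul_le_mul (by norm_num) (Nat.mul_le_mul (Nat.mul_le_mul a3 (by norm_num)) a2)
  have hNB : N ^ (l ^ 2) ≤ 2 ^ (l * l ^ 2) := by
    rw [pow_mul]; exact Nat.pow_le_pow_left hN _
  have hB2 : (l ^ 2 + 1) ^ 2 ≤ 2 ^ (2 * l * 2) := by
    rw [pow_mul]; exact Nat.pow_le_pow_left hB _
  have e2 : Ub N (l ^ 2) ≤ 2 ^ (2 * l * 2 + (((2 * l * 2 + l * l ^ 2) * (l ^ 2 + 1) ^ 2 + 2 * l) + l * l ^ 2)) := by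
    unfold Ub
    rw [pow_add 2 (2 * l * 2), pow_add 2 _ (l * l ^ 2), pow_add 2 _ (2 * l), pow_mul 2 (2 * l * 2 + l * l ^ 2)]
    refine Nat.mul_le_mul hB2 (Nat.mul_le_mul (Nat.mul_le_mul (Nat.pow_le_pow_left ?_ _) hB') hNB)
    rw [pow_add]
    exact Nat.mul_le_mul hB2 hNB
  refine (Nat.mul_le_mul e1 e2).trans ?_
  rw [← pow_add]
  apply Nat.pow_le_pow_right (by norm_num)
  obtain ⟨j, hj⟩ : ∃ j, l = j + 4 := ⟨l - 4, by omega⟩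
  rw [hj]
  ring_nf
  gcongr <;> omega

theorem sqrt3_bounds : 1 < 2 / √3 ∧ (8:ℝ) ≤ 14 * (1 / √3) ∧ 1 / √3 < 64 / 105 := by
  have h3 : (0:ℝ) < √3 := by positivity
  have hs : √3 * √3 = 3 := Real.mul_self_sqrt (by norm_num)
  have u : √3 < 1.75 := by nlinarith
  have v : 1.7 < √3 := by nlinarith
  refine ⟨?_, ?_, ?_⟩
  · rw [lt_div_iff₀ h3]; linarith
  · rw [mul_one_div, le_div_iff₀ h3]; linarith
  · rw [div_lt_iff₀ h3]; linarith

/-- Asymptotic choice of parameters. -/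
theorem params_large (c : ℝ) (hc : 0 < c) (k : ℕ) : ∃ N0 : ℕ, 512 ≤ N0 ∧ ∀ N : ℕ, N0 ≤ N →
    c * (lg N : ℝ) ^ k * (N:ℝ) ^ (1 / √3) ≤ (N:ℝ) ^ ((64:ℝ) / 105) := by
  have hs := sqrt3_bounds.2.2
  set s : ℝ := 64 / 105 - 1 / √3 with hsd
  have hs0 : 0 < s := by rw [hsd]; linarith
  have h1 := isLittleO_log_rpow_rpow_atTop (s := s) (k:ℝ) hs0
  have h2 := (h1.bound (c := 1 / (c * 6 ^ k)) (by positivity))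
  have h3 := (tendsto_natCast_atTop_atTop (R := ℝ)).eventually h2
  obtain ⟨N1, hN1⟩ := Filter.eventually_atTop.1 h3
  refine ⟨max 512 N1, le_max_left _ _, fun N hN => ?_⟩
  have hN5 : 512 ≤ N := (le_max_left _ _).trans hN
  have h4 := hN1 N ((le_max_right _ _).trans hN)
  have hNpos : (0:ℝ) < N := by exact_mod_cast (by omega : 0 < N)
  have hN512 : (512:ℝ) ≤ N := by exact_mod_cast hN5
  have hlog1 : 1 ≤ Real.log N := by
    rw [Real.le_log_iff_exp_le hNpos]
    have := Real.exp_one_lt_d9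
    linarith
  have hlg : (lg N : ℝ) ≤ 6 * Real.log N := by
    unfold lg
    push_cast
    have a1 : (2:ℝ) ^ (Nat.log 2 N) ≤ N := by exact_mod_cast Nat.pow_log_le_self 2 (by omega)
    have a2 := Real.log_le_log (by positivity) a1
    rw [Real.log_pow] at a2
    have a3 := Real.log_two_gt_d9
    have a4 : (0:ℝ) ≤ Nat.log 2 N := by positivity
    nlinarith
  rw [Real.norm_of_nonneg (by positivity), Real.norm_of_nonneg (by positivity), Real.rpow_natCast] at h4
  have h5 : (lg N : ℝ) ^ k ≤ 6 ^ k * Real.log N ^ k := by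
    rw [← mul_pow]; exact pow_le_pow_left₀ (by positivity) hlg k
  have h6 : (N:ℝ) ^ ((64:ℝ) / 105) = (N:ℝ) ^ s * (N:ℝ) ^ (1 / √3) := by
    rw [← Real.rpow_add hNpos, hsd]; congr 1; ring
  rw [h6]
  apply mul_le_mul_of_nonneg_right _ (by positivity)
  calc c * (lg N : ℝ) ^ k ≤ c * (6 ^ k * (1 / (c * 6 ^ k) * (N:ℝ) ^ s)) := by
        apply mul_le_mul_of_nonneg_left _ hc.le
        exact h5.trans (mul_le_mul_of_nonneg_left h4 (by positivity))
    _ = (N:ℝ) ^ s := by field_simp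

theorem pderiv0_facts {g : MvPolynomial (Fin 3) ℤ} (hg : Surf g) :
    pderiv 0 g ≠ 0 ∧ (pderiv 0 g).totalDegree ≤ 2 := by
  have h0 : pderiv 0 g ≠ 0 := by
    intro h
    have := coeff_pderiv (i := 0) g (Finsupp.single 0 2)
    rw [h, coeff_zero, ← Finsupp.single_add] at this
    simp at this
    exact hg.2.1 this
  refine ⟨h0, ?_⟩
  have := td_pderiv_lt 0 g h0
  have := hg.1
  omega

theorem final_ineq {Y B l Q E X : ℝ} (hl : 4 ≤ l) (hB : B = l ^ 2) (hY : 0 ≤ Y) (hX : 0 ≤ X) (hE : 0 ≤ E)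
    (hQ : Q ^ 2 ≤ E * X) :
    (Y * Y * (B + 4)) * (Y ^ 6 * Q ^ 2 * (B * (3 * (2 * B * B + B) ^ 2))) ≤
      (Y * Y * (2 * l ^ 2)) * (Y ^ 6 * (E * X) * (l ^ 2 * (3 * (3 * l ^ 4) ^ 2))) := by
  have c3 : B + 4 ≤ 2 * l ^ 2 := by rw [hB]; nlinarith
  have c4 : 2 * B * B + B ≤ 3 * l ^ 4 := by
    rw [hB]
    have : l ^ 2 ≤ l ^ 4 := pow_le_pow_right₀ (by linarith) (by norm_num)
    nlinarith
  have hB0 : 0 ≤ B := by rw [hB]; positivity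
  have hl0 : 0 ≤ l := by linarith
  rw [← hB]
  rw [← hB] at c3
  gcongr

theorem S_thm : ∃ C κ : ℕ, ∀ (g : MvPolynomial (Fin 3) ℤ), Surf g → ∀ N : ℕ, 1 ≤ N →
    ∀ T : Finset (Fin 3 → ℤ), (∀ x ∈ T, Box N x) → (∀ x ∈ T, eval x g = 0) →
    (∀ P ∈ T, ∀ P' ∈ T, P ≠ P' → ∃ s : ℤ, eval (fun i => P i + s * (P' i - P i)) g ≠ 0) →
    (T.card : ℝ) ≤ C * (N:ℝ) ^ (2 / √3) * (lg N : ℝ) ^ κ := by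
  classical
  obtain ⟨e11, he11⟩ : ∃ e11, e11 = Real.exp 11 := ⟨_, rfl⟩
  have he0 : 1 ≤ e11 := he11 ▸ Real.one_le_exp (by norm_num)
  obtain ⟨N0, hN05, hN0⟩ := params_large (16 * 1000 ^ 2 * (2 * e11)) (by positivity) 14
  obtain ⟨Cr, hCrd⟩ : ∃ Cr : ℝ, Cr = 3 * (2 * N0 + 1) ^ 2 + 108 * 3 + 75 * 3 +
    (16 * 1000 ^ 2) ^ 8 * 2 * (2 * e11) ^ 2 * 27 := ⟨_, rfl⟩
  obtain ⟨C, hC⟩ := exists_nat_ge Cr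
  refine ⟨C, 124, ?_⟩
  intro g hg N hN T hbox hz hlines
  have hl4 : (4:ℝ) ≤ lg N := by exact_mod_cast lg_ge N
  have hl1 : (1:ℝ) ≤ (lg N : ℝ) ^ 124 := one_le_pow₀ (by linarith)
  have hN1 : (1:ℝ) ≤ N := by exact_mod_cast hN
  have hNpos : (0:ℝ) < N := by linarith
  have hNp : (N:ℝ) ≤ (N:ℝ) ^ (2 / √3) := by
    have := Real.rpow_le_rpow_of_exponent_le hN1 sqrt3_bounds.1.le
    rwa [Real.rpow_one] at this
  set X := (N:ℝ) ^ (2 / √3) with hX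
  have hX1 : 1 ≤ X := hN1.trans hNp
  -- it suffices to bound by Cr
  suffices h : (T.card : ℝ) ≤ Cr * X * (lg N : ℝ) ^ 124 by
    refine h.trans ?_
    gcongr
  have hXl : X ≤ X * (lg N : ℝ) ^ 124 := le_mul_of_one_le_right (by linarith) hl1
  set Z := X * (lg N : ℝ) ^ 124 with hZ
  have hZ1 : 1 ≤ Z := hX1.trans hXl
  rw [mul_assoc, ← hZ]
  have hCr : Cr * Z = 3 * (2 * N0 + 1) ^ 2 * Z + 108 * 3 * Z + 75 * 3 * Z +
    (16 * 1000 ^ 2) ^ 8 * 2 * (2 * e11) ^ 2 * 27 * Z := by rw [hCrd]; ring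
  have p1 : 0 ≤ 3 * (2 * (N0:ℝ) + 1) ^ 2 * Z := by positivity
  have p4 : 0 ≤ (16 * 1000 ^ 2) ^ 8 * 2 * (2 * e11) ^ 2 * 27 * Z := by positivity
  have h2N1 : (2 * (N:ℝ) + 1) ≤ 3 * Z := by linarith
  by_cases hbig : N0 ≤ N
  swap
  · have h1 := hg.t0 T (fun x hx => ⟨hbox x hx, hz x hx⟩)
    have h2 : (T.card:ℝ) ≤ 3 * (2 * N + 1) ^ 2 := by exact_mod_cast h1
    have h3 : (N:ℝ) ≤ N0 := by exact_mod_cast (by omega : N ≤ N0)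
    have h4 : 3 * (2 * (N:ℝ) + 1) ^ 2 ≤ 3 * (2 * (N0:ℝ) + 1) ^ 2 := by gcongr
    have h5 : 3 * (2 * (N0:ℝ) + 1) ^ 2 ≤ 3 * (2 * (N0:ℝ) + 1) ^ 2 * Z := le_mul_of_one_le_right (by positivity) hZ1
    linarith
  rcases hg.small_height hN T (fun x hx => ⟨hbox x hx, hz x hx⟩) with h1 | ⟨g0, hg0, hg0z, hg0c⟩
  · have h2 : (T.card:ℝ) ≤ 108 * (2 * N + 1) := by exact_mod_cast h1
    linarith
  obtain ⟨hd0, hd2⟩ := pderiv0_facts hg0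
  have hT1 := hg0.t1 (N := N) (hg0.not_dvd hd0 ((degreeOf_le_totalDegree _ _).trans hd2)) hd2
    (T.filter (fun x => eval x (pderiv 0 g0) = 0)) (fun x hx => by
      rw [Finset.mem_filter] at hx
      exact ⟨hbox x hx.1, (hg0z x).2 (hz x hx.1), hx.2⟩)
  have hsplit := Finset.card_filter_add_card_filter_not (s := T) (fun x => eval x (pderiv 0 g0) = 0)
  set T2 := T.filter (fun x => ¬ eval x (pderiv 0 g0) = 0) with hT2
  set l := lg N with hl
  obtain ⟨k, hk⟩ : ∃ k, k = 1000 * l ^ 7 := ⟨_, rfl⟩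
  obtain ⟨Y, hY⟩ : ∃ Y, Y = 16 * k ^ 2 := ⟨_, rfl⟩
  set W := (N:ℝ) ^ (1 / √3) with hW
  obtain ⟨Q, hQ⟩ : ∃ Q, Q = ⌈e11 * W⌉₊ := ⟨_, rfl⟩
  have hl2 : l ^ 2 = (Nat.log 2 N + 4) ^ 2 := rfl
  have b2 := params_exp N
  rw [← hl, ← hk] at b2
  clear_value l W X Z
  have hW1 : 1 ≤ W := by rw [hW]; exact Real.one_le_rpow hN1 (by positivity)
  have hepos : 0 < e11 := by linarith
  have hWpos : 0 < W := by linarith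
  have hQge : e11 * W ≤ Q := hQ ▸ Nat.le_ceil _
  have hQle : (Q:ℝ) ≤ 2 * e11 * W := by
    have := Nat.ceil_lt_add_one (show 0 ≤ e11 * W by positivity)
    rw [← hQ] at this
    have : 1 ≤ e11 * W := one_le_mul_of_one_le_of_one_le he0 hW1
    linarith
  have hWX : W ^ 2 = X := by
    rw [hW, hX, ← Real.rpow_natCast, ← Real.rpow_mul hNpos.le]
    congr 1; push_cast; ring
  have hYr : (Y:ℝ) = 16 * 1000 ^ 2 * (l:ℝ) ^ 14 := by
    rw [hY, hk]; push_cast; ring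
  have hYQ : ((Y * Q : ℕ):ℝ) ≤ (N:ℝ) ^ ((64:ℝ)/105) := by
    refine le_trans ?_ (hN0 N hbig)
    push_cast
    rw [hYr]
    calc 16 * 1000 ^ 2 * (l:ℝ) ^ 14 * (Q:ℝ) ≤ 16 * 1000 ^ 2 * (l:ℝ) ^ 14 * (2 * e11 * W) := by gcongr
      _ = _ := by rw [← hl, ← hW]; ring
  have h105 : (Y * Q) ^ 105 ≤ N ^ 64 := by
    have : (((Y * Q : ℕ):ℝ)) ^ 105 ≤ (N:ℝ) ^ 64 := by
      refine (pow_le_pow_left₀ (by positivity) hYQ 105).trans_eq ?_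
      rw [← Real.rpow_natCast, ← Real.rpow_mul hNpos.le, ← Real.rpow_natCast]
      congr 1; norm_num
    exact_mod_cast this
  have hYN : Y * Q ≤ N := by
    have : ((Y * Q : ℕ):ℝ) ≤ (N:ℝ) := by
      refine hYQ.trans ?_
      have := Real.rpow_le_rpow_of_exponent_le hN1 (show (64:ℝ)/105 ≤ 1 by norm_num)
      rwa [Real.rpow_one] at this
    exact_mod_cast this
  have h17 : 17 * (2 * N) ^ 8 < Q ^ 14 := by
    have a1 : (8:ℝ) ≤ 14 * (1/√3) := sqrt3_bounds.2.1
    have a2 : (N:ℝ) ^ 8 ≤ W ^ 14 := by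
      rw [hW, ← Real.rpow_natCast, ← Real.rpow_natCast, ← Real.rpow_mul hNpos.le]
      apply Real.rpow_le_rpow_of_exponent_le hN1
      push_cast; linarith
    have a3 : (12:ℝ) ≤ e11 := by
      have := Real.add_one_le_exp (11:ℝ)
      rw [he11]; linarith
    have a4 : (12:ℝ) ^ 14 ≤ e11 ^ 14 := pow_le_pow_left₀ (by norm_num) a3 14
    have a5 : e11 ^ 14 * W ^ 14 ≤ (Q:ℝ) ^ 14 := by
      rw [← mul_pow]; exact pow_le_pow_left₀ (by positivity) hQge 14
    have a6 : (1:ℝ) ≤ (N:ℝ) ^ 8 := one_le_pow₀ hN1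
    have a7 : (12:ℝ) ^ 14 * (N:ℝ) ^ 8 ≤ e11 ^ 14 * W ^ 14 := by gcongr
    have : (17:ℝ) * (2 * N) ^ 8 < (Q:ℝ) ^ 14 := by
      rw [mul_pow]
      norm_num at a7 ⊢
      linarith
    exact_mod_cast this
  have hQ2 : 2 ≤ Q := by
    have a3 : (12:ℝ) ≤ e11 := by
      have := Real.add_one_le_exp (11:ℝ)
      rw [he11]; linarith
    have : (2:ℝ) ≤ Q := by nlinarith
    exact_mod_cast this
  have hl4' : 4 ≤ l := by exact_mod_cast hl4
  have hk1 : 1 ≤ k := by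
    have : 1 ≤ l ^ 7 := Nat.one_le_pow _ _ (by omega)
    omega
  obtain ⟨B, hB⟩ : ∃ B, B = l ^ 2 := ⟨_, rfl⟩
  rw [← hB] at b2
  have hB8 : 8 ≤ B := by rw [hB]; nlinarith
  have hUb : 1 ≤ Ub N B := by
    unfold Ub
    apply Nat.one_le_iff_ne_zero.2
    have : N ≠ 0 := by omega
    have : B ≠ 0 := by omega
    positivity
  have hScore := S_core hg0 N Q Y B k ((Finset.range (16 * k ^ 2 + 1)).filter Nat.Prime)
    (hN05.trans hbig) (hB.trans hl2) hB8 (by rw [← hW, ← he11]; exact hQge) hQ2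
    (fun p hp => by
      rw [Finset.mem_filter, Finset.mem_range] at hp
      exact ⟨hp.2, by omega⟩) (many_primes k hk1)
    (by
      have : (Finset.range (16 * k ^ 2 + 1)).filter Nat.Prime ⊆ Finset.Icc 1 Y := by
        intro p hp
        rw [Finset.mem_filter, Finset.mem_range] at hp
        exact Finset.mem_Icc.2 ⟨hp.2.pos, by omega⟩
      simpa using Finset.card_le_card this)
    hYN h105 h17 T2 (fun x hx => hbox x (Finset.mem_filter.1 hx).1)
    (fun x hx => (hg0z x).2 (hz x (Finset.mem_filter.1 hx).1))
    (fun x hx => by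
      refine ⟨(Finset.mem_filter.1 hx).2, ?_⟩
      have b1 := eval_bound hN (pderiv 0 g0) (D := 3) (by omega)
        (coeff_pderiv_bound 0 g0 hg0.1 hg0c) x (hbox x (Finset.mem_filter.1 hx).1)
      refine (mul_le_mul_of_nonneg_right b1 (by positivity)).trans ?_
      exact_mod_cast b2)
    hUb
    (fun P hP P' hP' hne => by
      obtain ⟨s, hs⟩ := hlines P (Finset.mem_filter.1 hP).1 P' (Finset.mem_filter.1 hP').1 hne
      exact ⟨s, fun h => hs ((hg0z _).1 h)⟩)
  have hT1r : ((T.filter (fun x => eval x (pderiv 0 g0) = 0)).card:ℝ) ≤ 75 * (2 * N + 1) := by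
    have : (T.filter (fun x => eval x (pderiv 0 g0) = 0)).card ≤ 75 * (2 * N + 1) := by
      refine hT1.trans_eq (by norm_num)
    exact_mod_cast this
  have hT2r : (T2.card:ℝ) ≤ (16 * 1000 ^ 2) ^ 8 * 2 * (2 * e11) ^ 2 * 27 * Z := by
    have c1 : (T2.card:ℝ) ≤ ((Y:ℝ) * Y * (B + 4)) * ((Y:ℝ) ^ 6 * (Q:ℝ) ^ 2 * (B * (3 * (2 * B * B + B) ^ 2))) := by
      exact_mod_cast hScore
    refine c1.trans ?_
    have c5 : (Q:ℝ) ^ 2 ≤ (2 * e11) ^ 2 * X := by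
      rw [← hWX, ← mul_pow]
      exact pow_le_pow_left₀ (by positivity) hQle 2
    have c2 : (B:ℝ) = (l:ℝ) ^ 2 := by rw [hB, Nat.cast_pow]
    refine (final_ineq hl4 c2 (Nat.cast_nonneg Y) (by linarith) (by positivity) c5).trans_eq ?_
    rw [hYr, hZ]; ring
  have hsr : (T.card:ℝ) = ((T.filter (fun x => eval x (pderiv 0 g0) = 0)).card:ℝ) + (T2.card:ℝ) := by
    exact_mod_cast hsplit.symm
  rw [hsr, hCr]
  linarith

end DG

namespace DG
open MvPolynomial

noncomputable def linep {R : Type*} [CommRing R] {k : ℕ} (P v : Fin k → R)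
    (q : MvPolynomial (Fin k) R) : Polynomial R :=
  aeval (fun i => Polynomial.C (P i) + Polynomial.C (v i) * Polynomial.X) q

theorem linep_eval {R : Type*} [CommRing R] {k : ℕ} (P v : Fin k → R)
    (q : MvPolynomial (Fin k) R) (s : R) :
    (linep P v q).eval s = eval (fun i => P i + s * v i) q := by
  unfold linep
  induction q using MvPolynomial.induction_on with
  | C a => simp
  | add p q hp hq => simp only [map_add, Polynomial.eval_add, hp, hq]
  | mul_X p i hp =>
    simp only [map_mul, Polynomial.eval_mul, hp, aeval_X, eval_X]
    simp only [Polynomial.eval_add, Polynomial.eval_mul, Polynomial.eval_C, Polynomial.eval_X]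
    ring

theorem linep_deriv {R : Type*} [CommRing R] {k : ℕ} (P v : Fin k → R)
    (q : MvPolynomial (Fin k) R) :
    Polynomial.derivative (linep P v q) = linep P v (∑ i, C (v i) * pderiv i q) := by
  classical
  unfold linep
  induction q using MvPolynomial.induction_on with
  | C a => simp
  | add p q hp hq => simp only [map_add, hp, hq, mul_add, Finset.sum_add_distrib]
  | mul_X p i hp =>
    have e : ∑ j, C (v j) * pderiv j (p * X i) = (∑ j, C (v j) * pderiv j p) * X i + C (v i) * p := by
      simp only [pderiv_mul, mul_add, Finset.sum_add_distrib, pderiv_X]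
      congr 1
      · rw [Finset.sum_mul]; apply Finset.sum_congr rfl; intros; ring
      · rw [Finset.sum_eq_single i]
        · simp
        · intro j _ hj
          rw [Pi.single_eq_of_ne (Ne.symm hj)]; simp
        · simp
    rw [e, map_mul, Polynomial.derivative_mul, hp, map_add, map_mul, map_mul, aeval_X]
    simp only [Polynomial.derivative_add, Polynomial.derivative_mul, Polynomial.derivative_C,
      Polynomial.derivative_X, algHom_C, Polynomial.algebraMap_eq]
    ring

theorem poly_zero_nat (p : Polynomial ℚ) (h : ∀ s : ℕ, 1 ≤ s → p.eval (s:ℚ) = 0) : p = 0 := by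
  apply Polynomial.eq_zero_of_infinite_isRoot
  apply Set.Infinite.mono (s := (fun n : ℕ => ((n+1 : ℕ):ℚ)) '' Set.univ)
  · rintro x ⟨n, -, rfl⟩
    exact h _ (by omega)
  · apply Set.infinite_univ.image
    intro a _ b _ hab
    have : ((a+1:ℕ):ℚ) = ((b+1:ℕ):ℚ) := hab
    have := Nat.cast_injective this
    omega

theorem linep_zero {k : ℕ} (P v : Fin k → ℚ) (q : MvPolynomial (Fin k) ℚ)
    (h : ∀ s : ℕ, 1 ≤ s → eval (fun i => P i + (s:ℚ) * v i) q = 0) : linep P v q = 0 := by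
  apply poly_zero_nat
  intro s hs
  rw [linep_eval]; exact h s hs

theorem line_all {k : ℕ} (P v : Fin k → ℚ) (q : MvPolynomial (Fin k) ℚ)
    (h : ∀ s : ℕ, 1 ≤ s → eval (fun i => P i + (s:ℚ) * v i) q = 0) (s : ℚ) :
    eval (fun i => P i + s * v i) q = 0 := by
  rw [← linep_eval, linep_zero P v q h, Polynomial.eval_zero]

theorem hom_eval {R : Type*} [CommRing R] {k d : ℕ} (G : MvPolynomial (Fin k) R)
    (hG : G.IsHomogeneous d) (a : R) (x : Fin k → R) :
    eval (fun i => a * x i) G = a ^ d * eval x G := by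
  rw [eval_eq', eval_eq', Finset.mul_sum]
  apply Finset.sum_congr rfl
  intro e he
  have h1 : ∑ i, e i = d := by
    have := hG (mem_support_iff.1 he)
    rw [Finsupp.weight_apply, Finsupp.sum_fintype _ _ (by simp)] at this
    simpa using this
  simp only [mul_pow]
  rw [Finset.prod_mul_distrib, Finset.prod_pow_eq_pow_sum, h1]
  ring

theorem hom_plane {k d : ℕ} (G : MvPolynomial (Fin k) ℚ) (hG : G.IsHomogeneous d)
    (A V : Fin k → ℚ) (h : ∀ s : ℕ, eval (fun i => A i + (s:ℚ) * V i) G = 0) (a b : ℚ) :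
    eval (fun i => a * A i + b * V i) G = 0 := by
  have h1 := line_all A V G (fun s _ => h s)
  have h2 : ∀ t : ℚ, t ≠ 0 → eval (fun i => V i + t * A i) G = 0 := by
    intro t ht
    have e : (fun i => V i + t * A i) = fun i => t * (A i + t⁻¹ * V i) := by
      funext i; field_simp; ring
    rw [e, hom_eval G hG, h1, mul_zero]
  by_cases ha : a = 0
  · have h3 := line_all V A G (fun s hs => h2 s (by positivity)) 0
    have e : (fun i => a * A i + b * V i) = fun i => b * (V i + 0 * A i) := by
      funext i; rw [ha]; ring
    rw [e, hom_eval G hG, h3, mul_zero]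
  · have e : (fun i => a * A i + b * V i) = fun i => a * (A i + (b/a) * V i) := by
      funext i; field_simp
    rw [e, hom_eval G hG, h1, mul_zero]

theorem graph_root {k : ℕ} (G : MvPolynomial (Fin (k+1)) ℚ) (ρ : MvPolynomial (Fin k) ℚ)
    (h : ∀ x' : Fin k → ℚ, eval (Fin.cons (eval x' ρ) x' : Fin (k+1) → ℚ) G = 0) :
    (finSuccEquiv ℚ k G).eval ρ = 0 := by
  apply MvPolynomial.funext
  intro x
  have e := aeval_fse (Fin.cons ρ X : Fin (k+1) → MvPolynomial (Fin k) ℚ) G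
  rw [Fin.cons_zero, Fin.tail_cons] at e
  have e2 : (aeval (X : Fin k → MvPolynomial (Fin k) ℚ)).toRingHom = RingHom.id _ := by
    ext <;> simp
  rw [e2] at e
  rw [Polynomial.eval, ← e, eval_aeval', map_zero, ← h x]
  congr 1
  congr 1
  funext i
  refine Fin.cases ?_ (fun j => ?_) i <;> simp

theorem graph_red {k : ℕ} (G : MvPolynomial (Fin (k+1)) ℚ) (ρ : MvPolynomial (Fin k) ℚ)
    (h : ∀ x' : Fin k → ℚ, eval (Fin.cons (eval x' ρ) x' : Fin (k+1) → ℚ) G = 0)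
    (hd : 2 ≤ (finSuccEquiv ℚ k G).natDegree) : ¬ Irreducible G := by
  intro hi
  have hi' : Irreducible (finSuccEquiv ℚ k G) :=
    (MulEquiv.irreducible_iff (finSuccEquiv ℚ k)).2 hi
  obtain ⟨q, hq⟩ := Polynomial.dvd_iff_isRoot.2 (graph_root G ρ h)
  rcases hi'.isUnit_or_isUnit hq with h1 | h1
  · exact Polynomial.not_isUnit_X_sub_C _ h1
  · have h2 := Polynomial.natDegree_eq_zero_of_isUnit h1
    have h3 := Polynomial.natDegree_mul_le (p := Polynomial.X - Polynomial.C ρ) (q := q)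
    rw [← hq, h2, Polynomial.natDegree_X_sub_C] at h3
    omega

theorem coeff3_of_fse {R : Type*} [CommRing R] {k : ℕ} (G : MvPolynomial (Fin (k+1)) R) :
    coeff (Finsupp.single 0 3) G = coeff 0 ((finSuccEquiv R k G).coeff 3) := by
  rw [finSuccEquiv_coeff_coeff]
  congr 1
  ext i
  refine Fin.cases ?_ (fun j => ?_) i
  · simp
  · simp

theorem hom_coeff3 {R : Type*} [CommRing R] {k : ℕ} (G : MvPolynomial (Fin (k+1)) R)
    (hG : G.IsHomogeneous 3) : eval (Pi.single 0 1) G = coeff (Finsupp.single 0 3) G := by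
  classical
  rw [eval_eq', Finset.sum_eq_single (Finsupp.single 0 3)]
  · rw [Finset.prod_eq_one, mul_one]
    intro i _
    refine Fin.cases ?_ (fun j => ?_) i <;> simp
  · intro e he hne
    have h1 : ∑ i, e i = 3 := by
      have := hG (mem_support_iff.1 he)
      rw [Finsupp.weight_apply, Finsupp.sum_fintype _ _ (by simp)] at this
      simpa using this
    have : ∃ j : Fin k, e j.succ ≠ 0 := by
      by_contra hcon
      push Not at hcon
      apply hne
      rw [Fin.sum_univ_succ] at h1
      simp only [hcon, Finset.sum_const_zero, add_zero] at h1
      ext i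
      refine Fin.cases ?_ (fun j => ?_) i
      · simp [h1]
      · simp [hcon]
    obtain ⟨j, hj⟩ := this
    rw [Finset.prod_eq_zero (Finset.mem_univ j.succ), mul_zero]
    rw [Pi.single_eq_of_ne (Fin.succ_ne_zero j), zero_pow hj]
  · intro h
    rw [notMem_support_iff.1 h, zero_mul]

theorem natDegree_of_coeff3 {k : ℕ} (G : MvPolynomial (Fin (k+1)) ℚ)
    (hc : coeff (Finsupp.single 0 3) G ≠ 0) : 3 ≤ (finSuccEquiv ℚ k G).natDegree := by
  apply Polynomial.le_natDegree_of_ne_zero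
  intro h
  rw [coeff3_of_fse, h] at hc
  simp at hc

theorem irr_aux {k : ℕ} (g a b : MvPolynomial (Fin (k+1)) ℚ) (htd : g.totalDegree ≤ 3)
    (hc : coeff (Finsupp.single 0 3) g ≠ 0)
    (hρ : ∀ (ρ : Fin k → ℚ) (c : ℚ), ∃ x' : Fin k → ℚ,
      eval (Fin.cons (c + ∑ i, ρ i * x' i) x' : Fin (k+1) → ℚ) g ≠ 0)
    (hab : g = a * b) (ha1 : a.totalDegree ≤ 1) : IsUnit a := by
  have hg0 : g ≠ 0 := by rintro rfl; simp at hc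
  have ha0 : a ≠ 0 := by rintro rfl; simp at hab; exact hg0 hab
  have hb0 : b ≠ 0 := by rintro rfl; simp at hab; exact hg0 hab
  have hsum : g.totalDegree = a.totalDegree + b.totalDegree := by
    rw [hab]; exact totalDegree_mul_of_isDomain ha0 hb0
  rcases Nat.eq_zero_or_pos a.totalDegree with h0 | hpos
  · rw [totalDegree_eq_zero_iff_eq_C] at h0
    rw [h0]
    apply IsUnit.map
    rw [isUnit_iff_ne_zero]
    intro h
    rw [h] at h0; simp at h0; exact ha0 h0
  · exfalso
    have hl := linear_form a ha1
    rw [Fin.sum_univ_succ] at hl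
    obtain ⟨α, hα⟩ : ∃ α, α = coeff 0 a := ⟨_, rfl⟩
    obtain ⟨α0, hα0⟩ : ∃ α0, α0 = coeff (Finsupp.single 0 1) a := ⟨_, rfl⟩
    obtain ⟨α', hα'⟩ : ∃ α' : Fin k → ℚ, α' = fun i => coeff (Finsupp.single i.succ 1) a := ⟨_, rfl⟩
    have hl' : a = C α + (C α0 * X 0 + ∑ i, C (α' i) * X (Fin.succ i)) := by
      rw [hα, hα0, hα']; exact hl
    by_cases hz : α0 = 0
    · have e : finSuccEquiv ℚ k a = Polynomial.C (C α + ∑ i, C (α' i) * X i) := by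
        rw [hl', hz]
        simp only [map_add, map_mul, map_sum, finSuccEquiv_X_succ, finSuccEquiv_X_zero]
        have hC : ∀ c : ℚ, finSuccEquiv ℚ k (C c) = Polynomial.C (C c) := by
          intro c; simp [finSuccEquiv_apply]
        simp only [hC]
        simp
      have h3 := natDegree_of_coeff3 g hc
      rw [hab, map_mul, e] at h3
      have h4 := (Polynomial.natDegree_C_mul_le (C α + ∑ i, C (α' i) * X i) (finSuccEquiv ℚ k b))
      have h5 := natDegree_fse_le b
      omega
    · obtain ⟨x', hx'⟩ := hρ (fun i => - α' i / α0) (- α / α0)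
      apply hx'
      rw [hab, map_mul]
      have : eval (Fin.cons (- α / α0 + ∑ i, - α' i / α0 * x' i) x' : Fin (k+1) → ℚ) a = 0 := by
        rw [hl']
        simp only [map_add, map_mul, map_sum, eval_C, eval_X, Fin.cons_zero, Fin.cons_succ]
        rw [mul_add, Finset.mul_sum]
        have : ∑ i, α0 * (-α' i / α0 * x' i) = - ∑ i, α' i * x' i := by
          rw [← Finset.sum_neg_distrib]; apply Finset.sum_congr rfl; intros; field_simp
        rw [this]; field_simp; ring
      rw [this, zero_mul]

theorem irr_of {k : ℕ} (g : MvPolynomial (Fin (k+1)) ℚ) (htd : g.totalDegree ≤ 3)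
    (hc : coeff (Finsupp.single 0 3) g ≠ 0)
    (hρ : ∀ (ρ : Fin k → ℚ) (c : ℚ), ∃ x' : Fin k → ℚ,
      eval (Fin.cons (c + ∑ i, ρ i * x' i) x' : Fin (k+1) → ℚ) g ≠ 0) : Irreducible g := by
  have hg0 : g ≠ 0 := by rintro rfl; simp at hc
  rw [irreducible_iff]
  constructor
  · intro hu
    have h3 := natDegree_of_coeff3 g hc
    have := Polynomial.natDegree_eq_zero_of_isUnit (hu.map (finSuccEquiv ℚ k))
    omega
  · intro a b hab
    have ha0 : a ≠ 0 := by rintro rfl; simp at hab; exact hg0 hab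
    have hb0 : b ≠ 0 := by rintro rfl; simp at hab; exact hg0 hab
    have hsum : g.totalDegree = a.totalDegree + b.totalDegree := by
      rw [hab]; exact totalDegree_mul_of_isDomain ha0 hb0
    rcases le_or_gt a.totalDegree 1 with h | h
    · exact Or.inl (irr_aux g a b htd hc hρ hab h)
    · exact Or.inr (irr_aux g b a htd hc hρ (by rw [hab, mul_comm]) (by omega))

end DG

namespace DG
open MvPolynomial

theorem aeval_q {n : ℕ} (x : Fin n → ℚ) (g : MvPolynomial (Fin n) ℤ) :
    aeval x g = eval x (qm g) := by
  unfold qm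
  rw [eval_map]; rfl

theorem bez {k : ℕ} (d : Fin k → ℤ) (hd : d ≠ 0) : ∃ (m : ℤ) (v u : Fin k → ℤ), m ≠ 0 ∧
    (∀ i, d i = m * v i) ∧ ∑ i, u i * v i = 1 := by
  obtain ⟨m, hm⟩ := IsPrincipalIdealRing.principal (Ideal.span (Set.range d))
  have hm' : ∀ i, ∃ v, d i = m * v := by
    intro i
    have : d i ∈ Ideal.span (Set.range d) := Ideal.subset_span ⟨i, rfl⟩
    rw [hm] at this
    exact Ideal.mem_span_singleton.1 this
  choose v hv using hm'
  have hmem : m ∈ Ideal.span (Set.range d) := by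
    rw [hm]; exact Ideal.mem_span_singleton_self m
  obtain ⟨u, hu⟩ := Ideal.mem_span_range_iff_exists_fun.1 hmem
  have hm0 : m ≠ 0 := by
    rintro rfl
    apply hd; funext i; rw [hv i]; simp
  refine ⟨m, v, u, hm0, hv, ?_⟩
  apply mul_left_cancel₀ hm0
  rw [mul_one, Finset.mul_sum]
  conv_rhs => rw [← hu]
  apply Finset.sum_congr rfl
  intro i _
  rw [hv i]; ring

theorem par {k : ℕ} (d v u : Fin k → ℤ) (hu : ∑ i, u i * v i = 1)
    (h : ∀ i j, d i * v j = d j * v i) (j : Fin k) : d j = (∑ i, u i * d i) * v j := by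
  rw [Finset.sum_mul]
  calc d j = (∑ i, u i * v i) * d j := by rw [hu, one_mul]
    _ = _ := by
      rw [Finset.sum_mul]
      apply Finset.sum_congr rfl
      intro i _
      have := h i j
      linear_combination - u i * this

theorem linep_natDegree {R : Type*} [CommRing R] {k : ℕ} (P v : Fin k → R)
    (q : MvPolynomial (Fin k) R) : (linep P v q).natDegree ≤ q.totalDegree := by
  have := aeval_natDegree_le q le_rfl
    (fun i => Polynomial.C (P i) + Polynomial.C (v i) * Polynomial.X) (n := 1) (by
      intro i
      rw [add_comm]
      exact Polynomial.natDegree_linear_le)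
  rw [mul_one] at this
  exact this

theorem linep_zero_int {k : ℕ} (P v : Fin k → ℤ) (q : MvPolynomial (Fin k) ℤ)
    (h : ∀ s : ℤ, eval (fun i => P i + s * v i) q = 0) : linep P v q = 0 := by
  apply Polynomial.funext
  intro s
  rw [linep_eval, h, Polynomial.eval_zero]

/-- Integer vanishing extends to rational vanishing. -/
theorem line_q {k : ℕ} (P v : Fin k → ℤ) (q : MvPolynomial (Fin k) ℤ)
    (h : ∀ s : ℤ, eval (fun i => P i + s * v i) q = 0) (s : ℚ) :
    eval (fun i => (P i : ℚ) + s * (v i : ℚ)) (qm q) = 0 := by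
  apply line_all (fun i => (P i : ℚ)) (fun i => (v i : ℚ))
  intro t _
  have := eval_qm (fun i => P i + (t:ℤ) * v i) q
  rw [h] at this
  rw [← Int.cast_zero, ← this]
  congr 1; congr 1; funext i; push_cast; ring

noncomputable def Dv (v : Fin 3 → ℤ) (g : MvPolynomial (Fin 3) ℤ) : MvPolynomial (Fin 3) ℤ :=
  ∑ i, C (v i) * pderiv i g

theorem Dv_td {g : MvPolynomial (Fin 3) ℤ} (hg : g.totalDegree ≤ 3) (v : Fin 3 → ℤ) :
    (Dv v g).totalDegree ≤ 2 := by
  unfold Dv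
  apply totalDegree_finsetSum_le
  intro i _
  refine (totalDegree_mul _ _).trans ?_
  rw [totalDegree_C, zero_add]
  by_cases h : pderiv i g = 0
  · rw [h]; simp
  · have := td_pderiv_lt i g h
    omega

theorem F_axis {F : MvPolynomial (Fin 3) ℤ} (hF : Surf F) (hh : F.IsHomogeneous 3)
    (v : Fin 3 → ℚ) (h1 : v 1 = 0) (h2 : v 2 = 0) (h : eval v (qm F) = 0) : v 0 = 0 := by
  have hh' : (qm F).IsHomogeneous 3 := hh.map _
  have e : v = fun i => v 0 * (Pi.single 0 1 : Fin 3 → ℚ) i := by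
    funext i; fin_cases i
    · simp
    · simpa using h1
    · simpa using h2
  rw [e, hom_eval _ hh', hom_coeff3 _ hh'] at h
  rcases mul_eq_zero.1 h with h | h
  · exact pow_eq_zero_iff (by norm_num) |>.1 h
  · exfalso
    apply hF.2.1
    rw [coeff_map] at h
    simpa using h

/-- normalised primitive direction -/
def Prim (v : Fin 3 → ℤ) : Prop :=
  (∃ u : Fin 3 → ℤ, ∑ i, u i * v i = 1) ∧ (0 < v 1 ∨ v 1 = 0 ∧ 0 < v 2)

theorem Prim_eq {v v' : Fin 3 → ℤ} (hv : Prim v) (hv' : Prim v')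
    (h : ∀ i j, v' i * v j = v' j * v i) : v = v' := by
  obtain ⟨⟨u, hu⟩, hs⟩ := hv
  obtain ⟨⟨u', hu'⟩, hs'⟩ := hv'
  have h1 := par v' v u hu h
  have h2 := par v v' u' hu' (fun i j => by have := h i j; linear_combination -this)
  obtain ⟨a, ha⟩ : ∃ a, a = ∑ i, u i * v' i := ⟨_, rfl⟩
  obtain ⟨b, hb⟩ : ∃ b, b = ∑ i, u' i * v i := ⟨_, rfl⟩
  rw [← ha] at h1
  rw [← hb] at h2
  have hab : a = 1 := by
    have key : ∀ j, 0 < v j → 0 < v' j → a = 1 := by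
      intro j hj hj'
      have e1 := h1 j
      have e2 := h2 j
      have ha0 : 0 < a := by
        by_contra hc
        nlinarith
      have hb0 : 0 < b := by
        by_contra hc
        nlinarith
      have : v j = (b * a) * v j := by
        conv_lhs => rw [e2, e1]
        ring
      have h3 : b * a = 1 := by
        have : (b * a - 1) * v j = 0 := by linarith
        rcases mul_eq_zero.1 this with h | h <;> omega
      nlinarith
    rcases hs with hs | ⟨hs0, hs⟩ <;> rcases hs' with hs' | ⟨hs0', hs'⟩
    · exact key 1 hs hs'
    · have := h2 1; rw [hs0'] at this; simp at this; omega
    · have := h1 1; rw [hs0] at this; simp at this; omega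
    · exact key 2 hs hs'
  funext j
  rw [h1 j, hab, one_mul]

/-- If a cubic form vanishes on the line through two normalised primitive vectors, they agree. -/
theorem F_line {F : MvPolynomial (Fin 3) ℤ} (hF : Surf F) (hh : F.IsHomogeneous 3)
    {v v' : Fin 3 → ℤ} (hv : Prim v) (hv' : Prim v')
    (h : ∀ s : ℤ, eval (fun i => v i + s * (v' i - v i)) F = 0) : v = v' := by
  have hh' : (qm F).IsHomogeneous 3 := hh.map _
  have hc : coeff (Finsupp.single 0 3) (qm F) ≠ 0 := by
    rw [coeff_map]; simpa using hF.2.1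
  have hpl : ∀ a b : ℚ, eval (fun i => a * (v i : ℚ) + b * (v' i : ℚ)) (qm F) = 0 := by
    intro a b
    have := hom_plane (qm F) hh' (fun i => (v i : ℚ)) (fun i => ((v' i - v i : ℤ) : ℚ))
      (fun s => line_q v (fun i => v' i - v i) F h s) (a + b) b
    rw [← this]
    congr 1; congr 1; funext i; push_cast; ring
  by_cases hD : v 1 * v' 2 - v 2 * v' 1 = 0
  · have h1 := F_axis hF hh _ (by push_cast; ring)
      (by have : (v 1 * v' 2 - v 2 * v' 1 : ℚ) = 0 := by exact_mod_cast hD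
          linear_combination - this)
      (hpl (v' 1) (- v 1))
    have h2 := F_axis hF hh _
      (by have : (v 1 * v' 2 - v 2 * v' 1 : ℚ) = 0 := by exact_mod_cast hD
          linear_combination this)
      (by push_cast; ring)
      (hpl (v' 2) (- v 2))
    have h1' : v' 1 * v 0 - v 1 * v' 0 = 0 := by
      have : (v' 1 * v 0 - v 1 * v' 0 : ℚ) = 0 := by linear_combination h1
      exact_mod_cast this
    have h2' : v' 2 * v 0 - v 2 * v' 0 = 0 := by
      have : (v' 2 * v 0 - v 2 * v' 0 : ℚ) = 0 := by linear_combination h2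
      exact_mod_cast this
    apply Prim_eq hv hv'
    intro i j
    fin_cases i <;> fin_cases j <;> simp only [Fin.zero_eta, Fin.mk_one, Fin.reduceFinMk] <;> linarith
  · exfalso
    have hDq : (v 1 * v' 2 - v 2 * v' 1 : ℚ) ≠ 0 := by exact_mod_cast hD
    refine graph_red (qm F) ((C ((v 0 * v' 2 - v' 0 * v 2 : ℚ) / (v 1 * v' 2 - v 2 * v' 1 : ℚ)) * X 0
      + C ((- v 0 * v' 1 + v' 0 * v 1 : ℚ) / (v 1 * v' 2 - v 2 * v' 1 : ℚ)) * X 1 :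
        MvPolynomial (Fin 2) ℚ)) ?_ ?_ hF.2.2
    · intro x
      rw [← hpl ((x 0 * v' 2 - x 1 * v' 1) / (v 1 * v' 2 - v 2 * v' 1))
        ((v 1 * x 1 - v 2 * x 0) / (v 1 * v' 2 - v 2 * v' 1))]
      congr 1; congr 1; funext i
      fin_cases i
      · simp
        field_simp
        ring
      · change x 0 = (_ : ℚ) * (v 1 : ℚ) + _ * (v' 1 : ℚ)
        rw [div_mul_eq_mul_div, div_mul_eq_mul_div, ← add_div, eq_div_iff hDq]
        ring
      · change x 1 = (_ : ℚ) * (v 2 : ℚ) + _ * (v' 2 : ℚ)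
        rw [div_mul_eq_mul_div, div_mul_eq_mul_div, ← add_div, eq_div_iff hDq]
        ring
    · have := natDegree_of_coeff3 _ hc
      omega

end DG

namespace DG
open MvPolynomial

theorem gamma_count {r : MvPolynomial (Fin 2) ℤ} (hr : r ≠ 0) (w1 w2 : ℤ) (hw : w1^2 + w2^2 ≠ 0)
    (T : Finset (Fin 3 → ℤ))
    (hT : ∀ P ∈ T, ∀ s : ℚ, eval (![(P 1 : ℚ) + s * w1, (P 2 : ℚ) + s * w2]) (qm r) = 0) :
    (T.image (fun P => w2 * P 1 - w1 * P 2)).card ≤ r.totalDegree := by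
  classical
  have hr' : qm r ≠ 0 := by
    intro h; apply hr; apply qm_injective; rw [h]; simp
  obtain ⟨Z, hZ⟩ : ∃ Z, eval Z (qm r) ≠ 0 := by
    by_contra hc
    push Not at hc
    apply hr'
    apply MvPolynomial.funext
    intro x; rw [hc, map_zero]
  have hwq : (w1^2 + w2^2 : ℚ) ≠ 0 := by exact_mod_cast hw
  obtain ⟨p, hp⟩ : ∃ p, p = linep Z ![(w2:ℚ), -(w1:ℚ)] (qm r) := ⟨_, rfl⟩
  have hp0 : p ≠ 0 := by
    intro h
    apply hZ
    have := linep_eval Z ![(w2:ℚ), -(w1:ℚ)] (qm r) 0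
    rw [← hp, h] at this
    simpa using this.symm
  obtain ⟨τ, hτ⟩ : ∃ τ : ℤ → ℚ, τ = fun γ : ℤ => ((γ:ℚ) - (w2 * Z 0 - w1 * Z 1)) / (w1^2 + w2^2) :=
    ⟨_, rfl⟩
  have hτi : Function.Injective τ := by
    intro a b hab
    rw [hτ] at hab
    simp only at hab
    rw [div_left_inj' hwq, sub_left_inj] at hab
    exact_mod_cast hab
  rw [← Finset.card_image_of_injective _ hτi]
  have hd : p.natDegree ≤ r.totalDegree := by
    rw [hp]; exact (linep_natDegree _ _ _).trans (td_qm_le r)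
  refine le_trans ?_ hd
  apply Polynomial.card_le_degree_of_subset_roots
  intro t ht
  rw [Finset.mem_val, Finset.mem_image] at ht
  obtain ⟨γ, hγ, rfl⟩ := ht
  obtain ⟨P, hP, rfl⟩ := Finset.mem_image.1 hγ
  rw [Polynomial.mem_roots hp0, Polynomial.IsRoot.def, hp, linep_eval]
  rw [← hT P hP (((Z 0 - P 1) * w1 + (Z 1 - P 2) * w2) / (w1^2 + w2^2)), hτ]
  congr 1; congr 1; funext i
  fin_cases i
  · simp
    field_simp
    ring
  · simp
    field_simp
    ring

theorem div_window (N h : ℕ) (hh : 1 ≤ h) (x : ℤ) (hx : |x| ≤ N) :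
    x / (h:ℤ) ∈ Finset.Icc (-((N / h : ℕ) : ℤ) - 1) ((N / h : ℕ) : ℤ) := by
  rw [abs_le] at hx
  have hh' : (0:ℤ) < h := by exact_mod_cast hh
  have h1 : (N:ℤ) < h * (((N/h : ℕ):ℤ) + 1) := by
    have := Nat.lt_mul_div_succ N (by omega : 0 < h)
    exact_mod_cast this
  rw [Finset.mem_Icc]
  constructor
  · rw [Int.le_ediv_iff_mul_le hh']
    nlinarith
  · rw [Int.natCast_div]
    exact Int.ediv_le_ediv hh' hx.2

theorem per_v {g : MvPolynomial (Fin 3) ℤ} (hg : Surf g) {v : Fin 3 → ℤ} (hv : Prim v)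
    (hD : Dv v g ≠ 0) (N h : ℕ) (hh : 1 ≤ h) (hhv : ∃ i, (h:ℤ) ≤ |v i|)
    (T : Finset (Fin 3 → ℤ)) (hT : ∀ P ∈ T, Box N P)
    (hTv : ∀ P ∈ T, ∀ s : ℤ, eval (fun i => P i + s * v i) g = 0) :
    T.card ≤ 75 * (2 * (N / h) + 2) := by
  classical
  obtain ⟨⟨u, hu⟩, hs⟩ := hv
  have hw : v 1 ^ 2 + v 2 ^ 2 ≠ 0 := by
    rcases hs with hs | ⟨hs0, hs⟩
    · have : 0 < v 1 ^ 2 + v 2 ^ 2 := by positivity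
      exact this.ne'
    · have : 0 < v 1 ^ 2 + v 2 ^ 2 := by positivity
      exact this.ne'
  have hwq : (v 1 ^ 2 + v 2 ^ 2 : ℚ) ≠ 0 := by exact_mod_cast hw
  have htd := Dv_td hg.1 v
  have hnd := hg.not_dvd hD ((degreeOf_le_totalDegree _ _).trans htd)
  have hr := hg.res_ne_zero hnd
  have hrd := hg.res_deg htd
  obtain ⟨r, hrdef⟩ : ∃ r, r = Polynomial.resultant (finSuccEquiv ℤ 2 g) (finSuccEquiv ℤ 2 (Dv v g)) :=
    ⟨_, rfl⟩
  have hgq : ∀ P ∈ T, ∀ s : ℚ, eval (fun i => (P i : ℚ) + s * (v i : ℚ)) (qm g) = 0 :=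
    fun P hP => line_q P v g (hTv P hP)
  have hDq : ∀ P ∈ T, ∀ s : ℚ, eval (fun i => (P i : ℚ) + s * (v i : ℚ)) (qm (Dv v g)) = 0 := by
    intro P hP
    apply line_q P v
    intro s
    rw [← linep_eval]
    have := linep_deriv P v g
    rw [linep_zero_int P v g (hTv P hP)] at this
    unfold Dv
    rw [← this]; simp
  have hvan : ∀ P ∈ T, ∀ s : ℚ,
      eval (![(P 1 : ℚ) + s * v 1, (P 2 : ℚ) + s * v 2]) (qm r) = 0 := by
    intro P hP s
    have := hg.res_vanish (fun i => (P i : ℚ) + s * (v i : ℚ)) (by rw [aeval_q]; exact hgq P hP s)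
      (by rw [aeval_q]; exact hDq P hP s)
    rw [← hrdef, aeval_q] at this
    rw [← this]
    congr 1; congr 1; funext i; fin_cases i <;> rfl
  rw [← hrdef] at hr hrd
  have hγ := gamma_count hr (v 1) (v 2) hw T hvan
  -- fibres of γ
  have hfib : ∀ γ ∈ T.image (fun P => v 2 * P 1 - v 1 * P 2),
      (T.filter (fun P => v 2 * P 1 - v 1 * P 2 = γ)).card ≤ 3 * (2 * (N / h) + 2) := by
    intro γ _
    obtain ⟨Tγ, hTγ⟩ : ∃ Tγ, Tγ = T.filter (fun P => v 2 * P 1 - v 1 * P 2 = γ) := ⟨_, rfl⟩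
    rw [← hTγ]
    have hmem : ∀ P ∈ Tγ, P ∈ T ∧ v 2 * P 1 - v 1 * P 2 = γ := by
      intro P hP; rw [hTγ, Finset.mem_filter] at hP; exact hP
    obtain ⟨ζ, hζ⟩ : ∃ ζ : (Fin 3 → ℤ) → ℤ,
      ζ = fun P => P 0 * (v 1 ^ 2 + v 2 ^ 2) - v 0 * (P 1 * v 1 + P 2 * v 2) := ⟨_, rfl⟩
    have hz3 : (Tγ.image ζ).card ≤ 3 := by
      have hinj : Function.Injective (fun z : ℤ => (z:ℚ) / (v 1 ^ 2 + v 2 ^ 2)) := by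
        intro a b hab
        simp only at hab
        rw [div_left_inj' hwq] at hab
        exact_mod_cast hab
      rw [← Finset.card_image_of_injective _ hinj]
      apply hg.column ![(γ:ℚ) / (v 1 ^ 2 + v 2 ^ 2) * v 2, - (γ:ℚ) / (v 1 ^ 2 + v 2 ^ 2) * v 1]
      intro z hz
      obtain ⟨z', hz', rfl⟩ := Finset.mem_image.1 hz
      obtain ⟨P, hP, rfl⟩ := Finset.mem_image.1 hz'
      obtain ⟨hPT, hPγ⟩ := hmem P hP
      rw [aeval_q, ← hgq P hPT (- (P 1 * v 1 + P 2 * v 2) / (v 1 ^ 2 + v 2 ^ 2)), hζ]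
      have hPγ' : (γ:ℚ) = v 2 * P 1 - v 1 * P 2 := by exact_mod_cast hPγ.symm
      congr 1; congr 1; funext i
      fin_cases i
      · simp
        field_simp
        ring
      · change (γ:ℚ) / (v 1 ^ 2 + v 2 ^ 2) * v 2 = (P 1 : ℚ) + _ * (v 1 : ℚ)
        rw [hPγ']
        field_simp
        ring
      · change - (γ:ℚ) / (v 1 ^ 2 + v 2 ^ 2) * v 1 = (P 2 : ℚ) + _ * (v 2 : ℚ)
        rw [hPγ']
        field_simp
        ring
    have hfib2 : ∀ z ∈ Tγ.image ζ, (Tγ.filter (fun P => ζ P = z)).card ≤ 2 * (N / h) + 2 := by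
      intro z _
      obtain ⟨i, hi⟩ := hhv
      have hcard : (Finset.Icc (-((N / h : ℕ) : ℤ) - 1) ((N / h : ℕ) : ℤ)).card = 2 * (N / h) + 2 := by
        rw [Int.card_Icc]; omega
      rw [← hcard]
      apply Finset.card_le_card_of_injOn (fun P => P i / (h:ℤ))
      · intro P hP
        rw [Finset.mem_coe, Finset.mem_filter] at hP
        exact div_window N h hh _ (hT P (hmem P hP.1).1 i)
      · intro P hP P' hP' heq
        rw [Finset.mem_coe, Finset.mem_filter] at hP hP'
        have e1 := (hmem P hP.1).2
        have e1' := (hmem P' hP'.1).2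
        have e2 : ζ P = ζ P' := by rw [hP.2, hP'.2]
        rw [hζ] at e2
        simp only at e2
        have m12 : (P 1 - P' 1) * v 2 = (P 2 - P' 2) * v 1 := by linarith
        have m01 : (P 0 - P' 0) * v 1 = (P 1 - P' 1) * v 0 := by
          apply mul_left_cancel₀ hw
          linear_combination v 1 * e2 - v 0 * v 2 * m12
        have m02 : (P 0 - P' 0) * v 2 = (P 2 - P' 2) * v 0 := by
          apply mul_left_cancel₀ hw
          linear_combination v 2 * e2 + v 0 * v 1 * m12
        have hp := par (fun j => P j - P' j) v u hu (by
          intro a b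
          fin_cases a <;> fin_cases b <;> simp only [Fin.zero_eta, Fin.mk_one, Fin.reduceFinMk] <;> linarith)
        obtain ⟨s, hs'⟩ : ∃ s, s = ∑ j, u j * (P j - P' j) := ⟨_, rfl⟩
        rw [← hs'] at hp
        have hs0 : s = 0 := by
          by_contra hne
          have h1 : |P i - P' i| < h := by
            have hh' : (0:ℤ) < h := by exact_mod_cast hh
            have a1 := Int.emod_add_mul_ediv (P i) h
            have a2 := Int.emod_add_mul_ediv (P' i) h
            have b1 := Int.emod_nonneg (P i) hh'.ne'
            have b2 := Int.emod_nonneg (P' i) hh'.ne'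
            have c1 := Int.emod_lt_of_pos (P i) hh'
            have c2 := Int.emod_lt_of_pos (P' i) hh'
            simp only at heq
            rw [heq] at a1
            rw [abs_lt]; constructor <;> linarith
          have h2 := hp i
          rw [h2, abs_mul] at h1
          have : 1 ≤ |s| := Int.one_le_abs hne
          nlinarith [abs_nonneg (v i)]
        funext j
        have := hp j
        rw [hs0, zero_mul] at this
        linarith
    have := Finset.card_le_mul_card_image Tγ (2 * (N / h) + 2) hfib2
    calc Tγ.card ≤ _ := this
      _ ≤ (2 * (N / h) + 2) * 3 := Nat.mul_le_mul_left _ hz3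
      _ = _ := by ring
  have := Finset.card_le_mul_card_image T _ hfib
  calc T.card ≤ _ := this
    _ ≤ 3 * (2 * (N / h) + 2) * 25 := Nat.mul_le_mul_left _ (hγ.trans (by simpa using hrd))
    _ = _ := by ring

end DG

namespace DG
open MvPolynomial

theorem dy_ineq (θ : ℝ) (h1 : 1 < θ) (h2 : θ ≤ 2) (C κ N j : ℕ) (hN : 1 ≤ N) (hj : 2^j ≤ 2 * N) :
    (C:ℝ) * ((2^(j+1) : ℕ):ℝ)^θ * (lg (2^(j+1)) : ℝ)^κ * ((75 * (2 * (N / 2^j) + 2) : ℕ):ℝ)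
      ≤ C * 3600 * 2^κ * (N:ℝ)^θ * (lg N:ℝ)^κ := by
  have hN' : (1:ℝ) ≤ N := by exact_mod_cast hN
  obtain ⟨M, hM⟩ : ∃ M : ℕ, M = 2^(j+1) := ⟨_, rfl⟩
  have hMpos : 0 < M := by rw [hM]; positivity
  have hMpos' : (0:ℝ) < M := by exact_mod_cast hMpos
  have hMj : (M:ℝ) = 2 * 2^j := by rw [hM]; push_cast; ring
  have hM4 : M ≤ 4 * N := by rw [hM, pow_succ]; omega
  have hM4' : (M:ℝ) ≤ 4 * N := by exact_mod_cast hM4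
  rw [← hM]
  have hlg : lg M ≤ 2 * lg N := by
    have a := lg_mono hM4
    have b : lg (4 * N) ≤ lg N + 2 := by
      unfold lg
      have e : 4 * N = N * 2 * 2 := by ring
      rw [e, Nat.log_mul_base (by norm_num) (by omega), Nat.log_mul_base (by norm_num) (by omega)]
    have := lg_ge (N := N)
    omega
  have hlg' : (lg M:ℝ)^κ ≤ 2^κ * (lg N:ℝ)^κ := by
    rw [← mul_pow]
    apply pow_le_pow_left₀ (by positivity)
    exact_mod_cast hlg
  have hMθ : (M:ℝ)^θ ≤ M * (4 * (N:ℝ)^(θ-1)) := by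
    have e : (M:ℝ)^θ = M * (M:ℝ)^(θ-1) := by
      have := Real.rpow_add hMpos' 1 (θ-1)
      rw [Real.rpow_one] at this
      rw [← this]; congr 1; ring
    rw [e]
    apply mul_le_mul_of_nonneg_left _ hMpos'.le
    calc (M:ℝ)^(θ-1) ≤ (4 * N:ℝ)^(θ-1) := Real.rpow_le_rpow hMpos'.le hM4' (by linarith)
      _ = (4:ℝ)^(θ-1) * (N:ℝ)^(θ-1) := Real.mul_rpow (by norm_num) (by positivity)
      _ ≤ 4 * (N:ℝ)^(θ-1) := by
        apply mul_le_mul_of_nonneg_right _ (by positivity)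
        calc (4:ℝ)^(θ-1) ≤ (4:ℝ)^(1:ℝ) := Real.rpow_le_rpow_of_exponent_le (by norm_num) (by linarith)
          _ = 4 := Real.rpow_one _
  have hNθ : (N:ℝ) * (N:ℝ)^(θ-1) = (N:ℝ)^θ := by
    have := Real.rpow_add (by linarith : (0:ℝ) < N) 1 (θ-1)
    rw [Real.rpow_one] at this
    rw [← this]; congr 1; ring
  have hdiv : (M:ℝ) * ((75 * (2 * (N / 2^j) + 2) : ℕ):ℝ) ≤ 900 * N := by
    have a : 2^j * (N / 2^j) ≤ N := Nat.mul_div_le N (2^j)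
    have b : M * (75 * (2 * (N / 2^j) + 2)) ≤ 900 * N := by
      have : M = 2 * 2^j := by rw [hM]; ring
      rw [this]
      nlinarith
    exact_mod_cast b
  calc (C:ℝ) * (M:ℝ)^θ * (lg M : ℝ)^κ * ((75 * (2 * (N / 2^j) + 2) : ℕ):ℝ)
      ≤ C * (M * (4 * (N:ℝ)^(θ-1))) * (2^κ * (lg N:ℝ)^κ) * ((75 * (2 * (N / 2^j) + 2) : ℕ):ℝ) := by
        gcongr
    _ = C * 4 * 2^κ * (N:ℝ)^(θ-1) * (lg N:ℝ)^κ * (M * ((75 * (2 * (N / 2^j) + 2) : ℕ):ℝ)) := by ring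
    _ ≤ C * 4 * 2^κ * (N:ℝ)^(θ-1) * (lg N:ℝ)^κ * (900 * N) := by gcongr
    _ = C * 3600 * 2^κ * ((N:ℝ) * (N:ℝ)^(θ-1)) * (lg N:ℝ)^κ := by ring
    _ = _ := by rw [hNθ]

theorem theta_bounds : (1:ℝ) < 2/Real.sqrt 3 ∧ 2/Real.sqrt 3 ≤ 2 := by
  refine ⟨sqrt3_bounds.1, ?_⟩
  have : (1:ℝ) ≤ Real.sqrt 3 := Real.one_le_sqrt.2 (by norm_num)
  rw [div_le_iff₀ (by linarith)]
  linarith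

def hm (v : Fin 3 → ℤ) : ℕ := Finset.univ.sup fun i => (v i).natAbs

theorem hm_box (v : Fin 3 → ℤ) : Box (hm v) v := by
  intro i
  have : (v i).natAbs ≤ hm v := Finset.le_sup (f := fun i => (v i).natAbs) (Finset.mem_univ i)
  rw [Int.abs_eq_natAbs]; exact_mod_cast this

theorem hm_exists (v : Fin 3 → ℤ) : ∃ i, ((hm v : ℕ):ℤ) = |v i| := by
  obtain ⟨i, -, hi⟩ := Finset.exists_mem_eq_sup (Finset.univ : Finset (Fin 3)) ⟨0, Finset.mem_univ _⟩
    (fun i => (v i).natAbs)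
  refine ⟨i, ?_⟩
  rw [Int.abs_eq_natAbs]
  exact_mod_cast hi

theorem prim_exists {F : MvPolynomial (Fin 3) ℤ} (hF : Surf F) (hh : F.IsHomogeneous 3)
    (d : Fin 3 → ℤ) (hd : d ≠ 0) (hFd : eval d F = 0) :
    ∃ (m : ℤ) (v : Fin 3 → ℤ), m ≠ 0 ∧ Prim v ∧ ∀ i, d i = m * v i := by
  obtain ⟨m, v, u, hm0, hv, hu⟩ := bez d hd
  have hne : v 1 ≠ 0 ∨ v 2 ≠ 0 := by
    by_contra hc
    push Not at hc
    have h0 := F_axis hF hh (fun i => (d i : ℚ)) (by simp [hv, hc.1]) (by simp [hv, hc.2])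
      (by rw [eval_qm, hFd]; simp)
    have h0' : d 0 = 0 := by exact_mod_cast h0
    apply hd
    funext i; fin_cases i
    · exact h0'
    · simp [hv, hc.1]
    · simp [hv, hc.2]
  by_cases hs : 0 < v 1 ∨ v 1 = 0 ∧ 0 < v 2
  · exact ⟨m, v, hm0, ⟨⟨u, hu⟩, hs⟩, hv⟩
  · refine ⟨-m, fun i => - v i, by simpa using hm0, ⟨⟨fun i => - u i, ?_⟩, ?_⟩, ?_⟩
    · simpa using hu
    · simp only; omega
    · intro i; rw [hv i]; ring

theorem Lines : ∃ C κ : ℕ, ∀ g F : MvPolynomial (Fin 3) ℤ, Surf g → Surf F → F.IsHomogeneous 3 →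
    (∀ P v : Fin 3 → ℤ, (∀ s : ℤ, eval (fun i => P i + s * v i) g = 0) → eval v F = 0) →
    (∀ v : Fin 3 → ℤ, v ≠ 0 → Dv v g ≠ 0) → ∀ N : ℕ, 1 ≤ N → ∀ T : Finset (Fin 3 → ℤ),
    (∀ x ∈ T, Box N x) → (∀ x ∈ T, eval x g = 0) →
    (T.card : ℝ) ≤ C * (N:ℝ)^(2/Real.sqrt 3) * (lg N:ℝ)^κ := by
  classical
  obtain ⟨C, κ, hS⟩ := S_thm
  refine ⟨C * (3600 * 2^κ + 1), κ + 1, ?_⟩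
  intro g F hg hF hh hgF hinv N hN T hT hTg
  obtain ⟨θ, hθ⟩ : ∃ θ : ℝ, θ = 2/Real.sqrt 3 := ⟨_, rfl⟩
  have hθb := theta_bounds
  rw [← hθ] at hθb
  simp only [← hθ] at hS ⊢
  obtain ⟨V, hV⟩ : ∃ V : Finset (Fin 3 → ℤ), V =
    (Fintype.piFinset (fun _ : Fin 3 => Finset.Icc (-(2*N:ℤ)) (2*N))).filter
      (fun v => Prim v ∧ eval v F = 0) := ⟨_, rfl⟩
  have hVm : ∀ v, v ∈ V ↔ Box (2*N) v ∧ Prim v ∧ eval v F = 0 := by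
    intro v
    rw [hV, Finset.mem_filter, Fintype.mem_piFinset]
    simp only [Finset.mem_Icc, Box, abs_le]
    push_cast
    rfl
  obtain ⟨L, hL⟩ : ∃ L : (Fin 3 → ℤ) → Finset (Fin 3 → ℤ), L = fun v =>
    T.filter (fun P => ∀ s : ℤ, eval (fun i => P i + s * v i) g = 0) := ⟨_, rfl⟩
  have hLm : ∀ v P, P ∈ L v ↔ P ∈ T ∧ ∀ s : ℤ, eval (fun i => P i + s * v i) g = 0 := by
    intro v P; rw [hL]; simp only; rw [Finset.mem_filter]
  obtain ⟨U, hU⟩ : ∃ U, U = V.biUnion L := ⟨_, rfl⟩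
  -- points off the lines
  have h1 : ((T \ U).card : ℝ) ≤ C * (N:ℝ)^θ * (lg N:ℝ)^κ := by
    apply hS g hg N hN
    · intro x hx; exact hT x (Finset.mem_sdiff.1 hx).1
    · intro x hx; exact hTg x (Finset.mem_sdiff.1 hx).1
    · intro P hP P' hP' hne
      by_contra hc
      push Not at hc
      obtain ⟨hPT, hPU⟩ := Finset.mem_sdiff.1 hP
      have hP'T := (Finset.mem_sdiff.1 hP').1
      have hd : (fun i => P' i - P i) ≠ 0 := by
        intro h0; apply hne; funext i
        have := congrFun h0 i
        simp only [Pi.zero_apply] at this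
        linarith
      have hFd := hgF P (fun i => P' i - P i) hc
      obtain ⟨m, v, hm0, hv, hmv⟩ := prim_exists hF hh _ hd hFd
      have hPv : ∀ s : ℤ, eval (fun i => P i + s * v i) g = 0 := by
        intro s
        have hm0' : (m:ℚ) ≠ 0 := by exact_mod_cast hm0
        have e := line_q P (fun i => P' i - P i) g hc ((s:ℚ) / m)
        have e2 := eval_qm (fun i => P i + s * v i) g
        have e3 : (fun i => ((P i + s * v i : ℤ) : ℚ)) =
            fun i => (P i:ℚ) + (s:ℚ)/m * ((P' i - P i : ℤ):ℚ) := by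
          funext i
          rw [hmv i]; push_cast; field_simp
        rw [e3, e] at e2
        exact_mod_cast e2.symm
      apply hPU
      rw [hU, Finset.mem_biUnion]
      refine ⟨v, (hVm v).2 ⟨?_, hv, hgF P v hPv⟩, (hLm v P).2 ⟨hPT, hPv⟩⟩
      intro i
      have a1 := hT P hPT i
      have a2 := hT P' hP'T i
      have a3 : |P' i - P i| ≤ 2 * N := by
        rw [abs_le] at *; constructor <;> linarith
      have e := hmv i
      rw [e, abs_mul] at a3
      have := Int.one_le_abs hm0
      push_cast
      nlinarith [abs_nonneg (v i)]
  -- points on lines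
  obtain ⟨W, hW⟩ : ∃ W : ℕ → Finset (Fin 3 → ℤ), W = fun j => V.filter (fun v => Nat.log 2 (hm v) = j) :=
    ⟨_, rfl⟩
  have hhm : ∀ v ∈ V, 1 ≤ hm v := by
    intro v hv
    have hp := ((hVm v).1 hv).2.1.2
    by_contra hc
    have h0 : hm v = 0 := by omega
    have hb := hm_box v
    rw [h0] at hb
    have b1 := hb 1
    have b2 := hb 2
    simp at b1 b2
    omega
  have hsub : U ⊆ (Finset.range (lg N)).biUnion (fun j => (W j).biUnion L) := by
    intro P hP
    rw [hU, Finset.mem_biUnion] at hP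
    obtain ⟨v, hv, hPv⟩ := hP
    rw [Finset.mem_biUnion]
    refine ⟨Nat.log 2 (hm v), ?_, Finset.mem_biUnion.2 ⟨v, ?_, hPv⟩⟩
    · rw [Finset.mem_range]
      have : hm v ≤ N * 2 := by
        obtain ⟨i, hi⟩ := hm_exists v
        have := ((hVm v).1 hv).1 i
        rw [← hi] at this
        push_cast at this
        omega
      have := Nat.log_mono_right (b := 2) this
      rw [Nat.log_mul_base (by norm_num) (by omega)] at this
      unfold lg; omega
    · rw [hW]; simp only; rw [Finset.mem_filter]; exact ⟨hv, rfl⟩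
  have hWj : ∀ j, (((W j).biUnion L).card : ℝ) ≤ C * 3600 * 2^κ * (N:ℝ)^θ * (lg N:ℝ)^κ := by
    intro j
    rcases (W j).eq_empty_or_nonempty with he | ⟨v0, hv0⟩
    · rw [he]; simp; positivity
    have hWm : ∀ v ∈ W j, v ∈ V ∧ 2^j ≤ hm v ∧ hm v < 2^(j+1) := by
      intro v hv
      rw [hW] at hv
      simp only at hv
      rw [Finset.mem_filter] at hv
      have := hhm v hv.1
      refine ⟨hv.1, ?_, ?_⟩
      · rw [← hv.2]; exact Nat.pow_log_le_self 2 (by omega)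
      · rw [← hv.2]; exact Nat.lt_pow_succ_log_self (by norm_num) _
    have hj : 2^j ≤ 2 * N := by
      obtain ⟨a, b, -⟩ := hWm v0 hv0
      obtain ⟨i, hi⟩ := hm_exists v0
      have := ((hVm v0).1 a).1 i
      rw [← hi] at this
      exact b.trans (by exact_mod_cast this)
    have hcW : ((W j).card : ℝ) ≤ C * ((2^(j+1) : ℕ):ℝ)^θ * (lg (2^(j+1)) : ℝ)^κ := by
      apply hS F hF (2^(j+1)) Nat.one_le_two_pow
      · intro v hv i
        have := hm_box v i
        have h2 := (hWm v hv).2.2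
        have h3 : ((hm v : ℕ):ℤ) ≤ ((2^(j+1) : ℕ):ℤ) := by exact_mod_cast h2.le
        linarith
      · intro v hv; exact ((hVm v).1 (hWm v hv).1).2.2
      · intro v hv v' hv' hne
        by_contra hc
        push Not at hc
        exact hne (F_line hF hh ((hVm v).1 (hWm v hv).1).2.1 ((hVm v').1 (hWm v' hv').1).2.1 hc)
    have hLc : ∀ v ∈ W j, (L v).card ≤ 75 * (2 * (N / 2^j) + 2) := by
      intro v hv
      obtain ⟨a, b, -⟩ := hWm v hv
      have hpr := ((hVm v).1 a).2.1
      refine per_v hg hpr (hinv v ?_) N (2^j) Nat.one_le_two_pow ?_ (L v) ?_ ?_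
      · rintro rfl
        have := hpr.2
        simp at this
      · obtain ⟨i, hi⟩ := hm_exists v
        refine ⟨i, ?_⟩
        rw [← hi]; exact_mod_cast b
      · intro P hP; exact hT P ((hLm v P).1 hP).1
      · intro P hP; exact ((hLm v P).1 hP).2
    have hc := Finset.card_biUnion_le_card_mul (W j) L _ hLc
    calc (((W j).biUnion L).card : ℝ) ≤ ((W j).card : ℝ) * ((75 * (2 * (N / 2^j) + 2) : ℕ):ℝ) := by
          exact_mod_cast hc
      _ ≤ _ := mul_le_mul_of_nonneg_right hcW (by positivity)
      _ ≤ _ := dy_ineq θ hθb.1 hθb.2 C κ N j hN hj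
  have h2 : (U.card : ℝ) ≤ lg N * (C * 3600 * 2^κ * (N:ℝ)^θ * (lg N:ℝ)^κ) := by
    calc (U.card : ℝ) ≤ (((Finset.range (lg N)).biUnion (fun j => (W j).biUnion L)).card : ℝ) := by
          exact_mod_cast Finset.card_le_card hsub
      _ ≤ ((∑ j ∈ Finset.range (lg N), ((W j).biUnion L).card : ℕ) : ℝ) := by
          exact_mod_cast Finset.card_biUnion_le
      _ = ∑ j ∈ Finset.range (lg N), (((W j).biUnion L).card : ℝ) := by push_cast; rfl
      _ ≤ ∑ j ∈ Finset.range (lg N), (C * 3600 * 2^κ * (N:ℝ)^θ * (lg N:ℝ)^κ) :=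
          Finset.sum_le_sum (fun j _ => hWj j)
      _ = _ := by rw [Finset.sum_const, Finset.card_range, nsmul_eq_mul]
  have h3 : T.card ≤ (T \ U).card + U.card := by
    have := Finset.card_le_card (Finset.subset_union_left (s₁ := T) (s₂ := U))
    rw [← Finset.sdiff_union_self_eq_union] at this
    exact this.trans (Finset.card_union_le _ _)
  have h3' : (T.card:ℝ) ≤ (T \ U).card + U.card := by exact_mod_cast h3
  have hl1 : (1:ℝ) ≤ lg N := by
    have := lg_ge (N := N)
    exact_mod_cast (by omega : 1 ≤ lg N)
  have hnn : 0 ≤ C * (N:ℝ)^θ * (lg N:ℝ)^κ := by positivity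
  calc (T.card:ℝ) ≤ _ := h3'
    _ ≤ C * (N:ℝ)^θ * (lg N:ℝ)^κ + lg N * (C * 3600 * 2^κ * (N:ℝ)^θ * (lg N:ℝ)^κ) := add_le_add h1 h2
    _ ≤ C * (N:ℝ)^θ * (lg N:ℝ)^κ * lg N + lg N * (C * 3600 * 2^κ * (N:ℝ)^θ * (lg N:ℝ)^κ) := by
        have := mul_le_mul_of_nonneg_left hl1 hnn
        linarith
    _ = _ := by push_cast; ring

end DG

namespace DG
open MvPolynomial

/-- cubic form with nonzero value at `e₀` and not vanishing on a rational hyperplane -/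
def NR {k : ℕ} (G : MvPolynomial (Fin (k+1)) ℚ) : Prop :=
  G.IsHomogeneous 3 ∧ eval (Pi.single 0 1) G ≠ 0 ∧
    ∀ ρ : (Fin k → ℚ) →ₗ[ℚ] ℚ, ∃ x' : Fin k → ℚ, eval (Fin.cons (ρ x') x' : Fin (k+1) → ℚ) G ≠ 0

def Inv {k : ℕ} (G : MvPolynomial (Fin k) ℚ) (v : Fin k → ℚ) : Prop :=
  ∀ (x : Fin k → ℚ) (s : ℚ), eval (fun i => x i + s * v i) G = eval x G

noncomputable def lin {k : ℕ} (ρ : (Fin k → ℚ) →ₗ[ℚ] ℚ) : MvPolynomial (Fin k) ℚ :=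
  ∑ i, C (ρ (Pi.single i 1)) * X i

theorem lin_eval {k : ℕ} (ρ : (Fin k → ℚ) →ₗ[ℚ] ℚ) (x : Fin k → ℚ) : eval x (lin ρ) = ρ x := by
  unfold lin
  rw [LinearMap.pi_apply_eq_sum_univ ρ x]
  simp only [map_sum, map_mul, eval_C, eval_X, smul_eq_mul]
  apply Finset.sum_congr rfl
  intro i _
  rw [mul_comm]
  congr 2
  funext j
  rw [Pi.single_apply]
  simp only [eq_comm]

theorem lin_inj {k : ℕ} : Function.Injective (lin (k := k)) := by
  intro a b h
  apply LinearMap.ext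
  intro x
  rw [← lin_eval, ← lin_eval, h]

theorem NR_of_irr {k : ℕ} (G : MvPolynomial (Fin (k+1)) ℚ) (h3 : G.IsHomogeneous 3)
    (he : eval (Pi.single 0 1) G ≠ 0) (hi : Irreducible G) : NR G := by
  refine ⟨h3, he, ?_⟩
  intro ρ
  by_contra hc
  push Not at hc
  refine graph_red G (lin ρ) ?_ ?_ hi
  · intro x'; rw [lin_eval]; exact hc x'
  · have := natDegree_of_coeff3 G (by rwa [← hom_coeff3 G h3])
    omega

theorem NR.irr {k : ℕ} {G : MvPolynomial (Fin (k+1)) ℚ} (h : NR G) : Irreducible G := by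
  apply irr_of G h.1.totalDegree_le (by rw [← hom_coeff3 G h.1]; exact h.2.1)
  intro ρ c
  by_contra hc
  push Not at hc
  obtain ⟨ρ', hρ'⟩ : ∃ ρ' : (Fin k → ℚ) →ₗ[ℚ] ℚ, ∀ x, ρ' x = ∑ i, ρ i * x i :=
    ⟨∑ i, ρ i • LinearMap.proj i, fun x => by simp⟩
  obtain ⟨x', hx'⟩ := h.2.2 ρ'
  apply hx'
  have := line_all (Fin.cons (ρ' x') x' : Fin (k+1) → ℚ) (Fin.cons c (fun _ => 0) : Fin (k+1) → ℚ) G (by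
    intro s hs
    have hs' : (s:ℚ) ≠ 0 := by positivity
    have e := hc (fun i => (s:ℚ)⁻¹ * x' i)
    have e2 := hom_eval G h.1 (s:ℚ) (Fin.cons (c + ∑ i, ρ i * ((s:ℚ)⁻¹ * x' i)) (fun i => (s:ℚ)⁻¹ * x' i))
    rw [e, mul_zero] at e2
    refine Eq.trans ?_ e2
    congr 1; congr 1; funext i
    refine Fin.cases ?_ (fun j => ?_) i
    · simp only [Fin.cons_zero]
      rw [hρ', mul_add, Finset.mul_sum]
      have : ∑ i, (s:ℚ) * (ρ i * ((s:ℚ)⁻¹ * x' i)) = ∑ i, ρ i * x' i := by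
        apply Finset.sum_congr rfl; intros; field_simp
      rw [this]; ring
    · simp only [Fin.cons_succ]; field_simp; try ring) 0
  simpa using this

/-- restriction to the hyperplane `x_{i0} = t y_{j0}` -/
noncomputable def ins {k : ℕ} (i0 : Fin (k+1)) (j0 : Fin k) (t : ℚ) (G : MvPolynomial (Fin (k+1)) ℚ) :
    MvPolynomial (Fin k) ℚ :=
  aeval (i0.insertNth (C t * X j0) X : Fin (k+1) → MvPolynomial (Fin k) ℚ) G

theorem ins_eval {k : ℕ} (i0 : Fin (k+1)) (j0 : Fin k) (t : ℚ) (G : MvPolynomial (Fin (k+1)) ℚ)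
    (y : Fin k → ℚ) : eval y (ins i0 j0 t G) = eval (i0.insertNth (t * y j0) y : Fin (k+1) → ℚ) G := by
  unfold ins
  rw [eval_aeval']
  congr 1; congr 1; funext i
  refine Fin.succAboveCases i0 ?_ (fun j => ?_) i
  · simp
  · simp

theorem ins_hom {k : ℕ} (i0 : Fin (k+1)) (j0 : Fin k) (t : ℚ) (G : MvPolynomial (Fin (k+1)) ℚ)
    (hG : G.IsHomogeneous 3) : (ins i0 j0 t G).IsHomogeneous 3 := by
  have := hG.aeval (i0.insertNth (C t * X j0) X : Fin (k+1) → MvPolynomial (Fin k) ℚ) (n := 1) (by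
    intro i
    refine Fin.succAboveCases i0 ?_ (fun j => ?_) i
    · simp only [Fin.insertNth_apply_same]
      have := (isHomogeneous_C (Fin k) t).mul (isHomogeneous_X ℚ j0)
      simpa using this
    · simp only [Fin.insertNth_apply_succAbove]
      exact isHomogeneous_X ℚ j)
  rw [one_mul] at this
  exact this

theorem ins_e0 {k : ℕ} (i1 : Fin (k+1)) (j0 : Fin (k+1)) (t : ℚ) (ht : t = 0 ∨ j0 ≠ 0) :
    (i1.succ.insertNth (t * (Pi.single 0 1 : Fin (k+1) → ℚ) j0) (Pi.single 0 1 : Fin (k+1) → ℚ)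
      : Fin (k+2) → ℚ) = Pi.single 0 1 := by
  funext i
  refine Fin.succAboveCases i1.succ ?_ (fun j => ?_) i
  · rw [Fin.insertNth_apply_same, Pi.single_eq_of_ne (Fin.succ_ne_zero _)]
    rcases ht with ht | ht
    · rw [ht, zero_mul]
    · rw [Pi.single_eq_of_ne ht, mul_zero]
  · rw [Fin.insertNth_apply_succAbove]
    refine Fin.cases ?_ (fun l => ?_) j
    · rw [Fin.succ_succAbove_zero]; simp
    · rw [Fin.succ_succAbove_succ, Pi.single_eq_of_ne (Fin.succ_ne_zero _),
        Pi.single_eq_of_ne (Fin.succ_ne_zero _)]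

/-- reduction modulo the direction `w` -/
noncomputable def red {k : ℕ} (w : Fin (k+1) → ℚ) (i0 : Fin (k+1)) (x : Fin (k+1) → ℚ) : Fin k → ℚ :=
  fun j => x (i0.succAbove j) - x i0 / w i0 * w (i0.succAbove j)

theorem red_eval {k : ℕ} (w : Fin (k+1) → ℚ) (i0 : Fin (k+1)) (hw : w i0 ≠ 0) (j0 : Fin k)
    (G : MvPolynomial (Fin (k+1)) ℚ) (hI : Inv G w) (x : Fin (k+1) → ℚ) :
    eval (red w i0 x) (ins i0 j0 0 G) = eval x G := by
  rw [ins_eval, ← hI x (- (x i0 / w i0))]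
  congr 1; congr 1; funext i
  refine Fin.succAboveCases i0 ?_ (fun j => ?_) i
  · rw [Fin.insertNth_apply_same]; field_simp; ring
  · rw [Fin.insertNth_apply_succAbove]; unfold red; ring

theorem inv_index {k : ℕ} {G : MvPolynomial (Fin (k+1)) ℚ} (h : NR G) (w : Fin (k+1) → ℚ) (hw : w ≠ 0)
    (hI : Inv G w) : ∃ i1 : Fin k, w i1.succ ≠ 0 := by
  by_contra hc
  push Not at hc
  have h0 : w 0 ≠ 0 := by
    intro h0; apply hw; funext i
    refine Fin.cases h0 (fun j => hc j) i
  have e1 := hI (fun _ => 0) 1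
  have e2 := hom_eval G h.1 0 (fun _ => 0)
  have e3 := hom_eval G h.1 (w 0) (Pi.single 0 1)
  have e4 : (fun i => w 0 * (Pi.single 0 1 : Fin (k+1) → ℚ) i) = fun i => 0 + 1 * w i := by
    funext i
    refine Fin.cases (by simp) (fun j => by simp [hc j]) i
  rw [e4, e1] at e3
  simp only [mul_zero] at e2
  rw [e2] at e3
  have := h.2.1
  have h3 : w 0 ^ 3 ≠ 0 := pow_ne_zero _ h0
  apply mul_ne_zero h3 this
  rw [← e3]; simp

theorem NR_inv {k : ℕ} {G : MvPolynomial (Fin (k+2)) ℚ} (h : NR G) (w : Fin (k+2) → ℚ)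
    (i1 : Fin (k+1)) (hw : w i1.succ ≠ 0) (hI : Inv G w) : NR (ins i1.succ 0 0 G) := by
  refine ⟨ins_hom _ _ _ _ h.1, ?_, ?_⟩
  · rw [ins_eval, ins_e0 _ _ _ (Or.inl rfl)]; exact h.2.1
  · intro ρ
    by_contra hc
    push Not at hc
    -- linear map giving the tail of the reduction
    obtain ⟨τ, hτ⟩ : ∃ τ : (Fin (k+1) → ℚ) →ₗ[ℚ] (Fin k → ℚ), ∀ x' j,
        τ x' j = x' (i1.succAbove j) - x' i1 / w i1.succ * w (i1.succAbove j).succ :=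
      ⟨LinearMap.pi (fun j => LinearMap.proj (i1.succAbove j) -
        (w (i1.succAbove j).succ / w i1.succ) • LinearMap.proj i1), fun x' j => by
          simp; ring⟩
    obtain ⟨x', hx'⟩ := h.2.2 (ρ.comp τ + (w 0 / w i1.succ) • LinearMap.proj i1)
    apply hx'
    rw [← red_eval w i1.succ hw 0 G hI]
    refine Eq.trans ?_ (hc (τ x'))
    congr 1; congr 1; funext j
    unfold red
    refine Fin.cases ?_ (fun l => ?_) j
    · rw [Fin.succ_succAbove_zero]
      simp only [Fin.cons_zero, Fin.cons_succ, LinearMap.add_apply, LinearMap.comp_apply,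
        LinearMap.smul_apply, LinearMap.proj_apply, smul_eq_mul]
      ring
    · rw [Fin.succ_succAbove_succ]
      simp only [Fin.cons_succ]
      rw [hτ]

theorem NR_bin {B : MvPolynomial (Fin 2) ℚ} (h : NR (k := 1) B) (y : Fin 2 → ℚ) (hy : eval y B = 0) :
    y = 0 := by
  have h1 : y 1 = 0 := by
    by_contra h1
    obtain ⟨x', hx'⟩ := h.2.2 ((y 0 / y 1) • LinearMap.proj 0)
    apply hx'
    have := hom_eval B h.1 (x' 0 / y 1) y
    rw [hy, mul_zero] at this
    refine Eq.trans ?_ this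
    congr 1; congr 1; funext i
    fin_cases i
    · simp; ring
    · change x' 0 = x' 0 / y 1 * y 1
      field_simp
  have := hom_eval B h.1 (y 0) (Pi.single 0 1)
  have e : (fun i => y 0 * (Pi.single 0 1 : Fin 2 → ℚ) i) = y := by
    funext i; fin_cases i
    · simp
    · simp [h1]
  rw [e, hy] at this
  have h0 : y 0 = 0 := by
    rcases mul_eq_zero.1 this.symm with h2 | h2
    · exact pow_eq_zero_iff (by norm_num) |>.1 h2
    · exact absurd h2 h.2.1
  funext i; fin_cases i
  · exact h0
  · exact h1

end DG

namespace DG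
open MvPolynomial

noncomputable def lsub {k l : ℕ} (L : (Fin l → ℚ) →ₗ[ℚ] (Fin k → ℚ)) (G : MvPolynomial (Fin k) ℚ) :
    MvPolynomial (Fin l) ℚ := aeval (fun i => lin ((LinearMap.proj i).comp L)) G

theorem lsub_eval {k l : ℕ} (L : (Fin l → ℚ) →ₗ[ℚ] (Fin k → ℚ)) (G : MvPolynomial (Fin k) ℚ)
    (x : Fin l → ℚ) : eval x (lsub L G) = eval (L x) G := by
  unfold lsub
  rw [eval_aeval']
  congr 1; congr 1; funext i
  rw [lin_eval]; rfl

theorem lsub_hom {k l : ℕ} (L : (Fin l → ℚ) →ₗ[ℚ] (Fin k → ℚ)) (G : MvPolynomial (Fin k) ℚ)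
    (hG : G.IsHomogeneous 3) : (lsub L G).IsHomogeneous 3 := by
  have := hG.aeval (fun i => lin ((LinearMap.proj i).comp L)) (n := 1) (by
    intro i
    unfold lin
    apply IsHomogeneous.sum
    intro j _
    have := (isHomogeneous_C (Fin l) (((LinearMap.proj i).comp L) (Pi.single j 1))).mul (isHomogeneous_X ℚ j)
    rw [zero_add] at this
    exact this)
  rw [one_mul] at this
  exact this

/-- a cubic form vanishes on few graphs `x₀ = ρ(x')` -/
theorem roots_le {k : ℕ} (G : MvPolynomial (Fin (k+1)) ℚ) (hG : G.IsHomogeneous 3)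
    (he : eval (Pi.single 0 1) G ≠ 0) (A : Finset ((Fin k → ℚ) →ₗ[ℚ] ℚ))
    (hA : ∀ ρ ∈ A, ∀ x' : Fin k → ℚ, eval (Fin.cons (ρ x') x' : Fin (k+1) → ℚ) G = 0) : A.card ≤ 3 := by
  classical
  have h3 := natDegree_of_coeff3 G (by rwa [← hom_coeff3 G hG])
  have h0 : finSuccEquiv ℚ k G ≠ 0 := by
    intro h; rw [h] at h3; simp at h3
  have h1 : A.card ≤ (finSuccEquiv ℚ k G).roots.toFinset.card := by
    apply Finset.card_le_card_of_injOn lin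
    · intro ρ hρ
      simp only [Finset.mem_coe, Multiset.mem_toFinset]
      rw [Polynomial.mem_roots h0]
      apply graph_root
      intro x'
      rw [lin_eval]; exact hA ρ hρ x'
    · exact lin_inj.injOn
  have h2 := Multiset.toFinset_card_le (finSuccEquiv ℚ k G).roots
  have h4 := Polynomial.card_roots' (finSuccEquiv ℚ k G)
  have h5 := natDegree_fse_le G
  have h6 := hG.totalDegree_le
  omega

theorem pencil {m : ℕ} (G : MvPolynomial (Fin (m+4)) ℚ) (h : NR (k := m+3) G)
    (hno : ∀ w, w ≠ 0 → ¬ Inv G w) : ∃ t : ℕ, t ≤ 54 ∧ NR (k := m+2) (ins 1 1 (t:ℚ) G) := by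
  classical
  by_contra hc
  push Not at hc
  have hβ : ∀ t : ℕ, t ≤ 54 → ∃ β : (Fin (m+2) → ℚ) →ₗ[ℚ] ℚ, ∀ y' : Fin (m+2) → ℚ,
      eval (Fin.cons (β y') (Fin.cons ((t:ℚ) * y' 0) y' : Fin (m+3) → ℚ) : Fin (m+4) → ℚ) G = 0 := by
    intro t ht
    by_contra hcon
    push Not at hcon
    apply hc t ht
    refine ⟨ins_hom _ _ _ _ h.1, ?_, ?_⟩
    · rw [ins_eval]
      have := ins_e0 (k := m+2) 0 1 (t:ℚ) (Or.inr (by simp))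
      rw [Fin.succ_zero_eq_one] at this
      rw [this]; exact h.2.1
    · intro ρ
      obtain ⟨y', hy'⟩ := hcon ρ
      refine ⟨y', ?_⟩
      rw [ins_eval]
      intro h0
      apply hy'
      refine Eq.trans ?_ h0
      congr 1; congr 1; funext i
      refine Fin.succAboveCases 1 ?_ (fun j => ?_) i
      · rw [Fin.insertNth_apply_same]; rfl
      · rw [Fin.insertNth_apply_succAbove]
        refine Fin.cases ?_ (fun l => ?_) j
        · rfl
        · rw [Fin.one_succAbove_succ]; simp
  choose! β hβ using hβ
  obtain ⟨κ, hκ⟩ : ∃ κ : (Fin (m+1) → ℚ) →ₗ[ℚ] (Fin (m+2) → ℚ), ∀ x, κ x = Fin.cons 0 x :=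
    ⟨LinearMap.pi (Fin.cons 0 (fun j => LinearMap.proj j)), fun x => by
      funext i; refine Fin.cases ?_ (fun j => ?_) i <;> simp⟩
  -- G0
  obtain ⟨L0, hL0⟩ : ∃ L0 : (Fin (m+2) → ℚ) →ₗ[ℚ] (Fin (m+4) → ℚ), ∀ x,
      L0 x = Fin.cons (x 0) (Fin.cons 0 (Fin.cons 0 (Fin.tail x) : Fin (m+2) → ℚ) : Fin (m+3) → ℚ) :=
    ⟨LinearMap.pi (Fin.cons (LinearMap.proj 0) (Fin.cons 0 (Fin.cons 0 (fun j => LinearMap.proj j.succ) : Fin (m+2) → _)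
      : Fin (m+3) → _)), fun x => by
      funext i; refine Fin.cases ?_ (fun j => Fin.cases ?_ (fun j => Fin.cases ?_ (fun j => ?_) j) j) i <;> first | rfl | simp [Fin.tail]⟩
  have hA := roots_le (lsub L0 G) (lsub_hom _ _ h.1) (by
    rw [lsub_eval, hL0]
    have e : (Fin.cons ((Pi.single 0 1 : Fin (m+2) → ℚ) 0) (Fin.cons 0 (Fin.cons 0 (Fin.tail (Pi.single 0 1 : Fin (m+2) → ℚ)) : Fin (m+2) → ℚ) : Fin (m+3) → ℚ) : Fin (m+4) → ℚ) = Pi.single 0 1 := by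
      funext i; refine Fin.cases ?_ (fun j => Fin.cases ?_ (fun j => Fin.cases ?_ (fun j => ?_) j) j) i <;> first | rfl | simp [Fin.tail]
    rw [e]; exact h.2.1) ((Finset.range 55).image fun t => (β t).comp κ) (by
    intro ρ hρ x'
    obtain ⟨t, ht, rfl⟩ := Finset.mem_image.1 hρ
    have ht' : t ≤ 54 := by have := Finset.mem_range.1 ht; omega
    rw [lsub_eval, hL0]
    have := hβ t ht' (Fin.cons 0 x')
    refine Eq.trans ?_ this
    congr 1; congr 1; funext i
    refine Fin.cases ?_ (fun j => Fin.cases ?_ (fun j => ?_) j) i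
    · simp [hκ]
    · simp
    · simp)
  obtain ⟨ρ, -, hρ⟩ := Finset.exists_lt_card_fiber_of_mul_lt_card_of_maps_to (s := Finset.range 55)
    (t := (Finset.range 55).image fun t => (β t).comp κ) (f := fun t => (β t).comp κ) (n := 18)
    (fun t ht => Finset.mem_image_of_mem _ ht) (by rw [Finset.card_range]; omega)
  obtain ⟨A, hAd⟩ : ∃ A, A = (Finset.range 55).filter (fun t => (β t).comp κ = ρ) := ⟨_, rfl⟩
  rw [← hAd] at hρ
  have hAm : ∀ t ∈ A, t ≤ 54 ∧ ∀ x, β t (Fin.cons 0 x) = ρ x := by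
    intro t ht
    rw [hAd, Finset.mem_filter, Finset.mem_range] at ht
    refine ⟨by omega, fun x => ?_⟩
    rw [← hκ, ← ht.2]; rfl
  -- P
  obtain ⟨LP, hLP⟩ : ∃ L0 : (Fin (m+4) → ℚ) →ₗ[ℚ] (Fin (m+4) → ℚ), ∀ x,
      L0 x = Fin.cons (x 0 - ρ (fun j => x j.succ.succ.succ)) (Fin.cons (x 1) (Fin.cons (x 2) (fun _ => 0) : Fin (m+2) → ℚ) : Fin (m+3) → ℚ) :=
    ⟨LinearMap.pi (Fin.cons (LinearMap.proj 0 - ρ.comp (LinearMap.pi fun j : Fin (m+1) => (LinearMap.proj j.succ.succ.succ : (Fin (m+4) → ℚ) →ₗ[ℚ] ℚ)))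
      (Fin.cons (LinearMap.proj 1) (Fin.cons (LinearMap.proj 2) (fun j => 0) : Fin (m+2) → _)
      : Fin (m+3) → _)), fun x => by
      funext i; refine Fin.cases ?_ (fun j => Fin.cases ?_ (fun j => Fin.cases ?_ (fun j => ?_) j) j) i
      · rfl
      · rfl
      · rfl
      · rfl⟩
  obtain ⟨P, hPd⟩ : ∃ P, P = lsub LP G := ⟨_, rfl⟩
  have hPe : ∀ x, eval x P = eval (LP x) G := by intro x; rw [hPd, lsub_eval]
  have hP3 : P.IsHomogeneous 3 := by rw [hPd]; exact lsub_hom _ _ h.1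
  have hPe0 : eval (Pi.single 0 1) P = eval (Pi.single 0 1) G := by
    rw [hPe, hLP]
    congr 1; congr 1
    have hz : (fun j : Fin (m+1) => (Pi.single 0 1 : Fin (m+4) → ℚ) j.succ.succ.succ) = 0 := by
      funext j; simp
    rw [hz, map_zero]
    funext i; refine Fin.cases ?_ (fun j => Fin.cases ?_ (fun j => Fin.cases ?_ (fun j => ?_) j) j) i <;> first | rfl | simp
  have hirr := h.irr
  have hnd : (finSuccEquiv ℚ (m+3) G).natDegree ≠ 0 := by
    have := natDegree_of_coeff3 G (by rw [← hom_coeff3 G h.1]; exact h.2.1)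
    omega
  by_cases hdvd : G ∣ P
  · obtain ⟨Q, hQ⟩ := hdvd
    have hPne : P ≠ 0 := by
      intro h0; rw [h0, map_zero] at hPe0; exact h.2.1 hPe0.symm
    have hQne : Q ≠ 0 := by rintro rfl; rw [mul_zero] at hQ; exact hPne hQ
    have htd := totalDegree_mul_of_isDomain hirr.ne_zero hQne
    rw [← hQ, hP3.totalDegree hPne, h.1.totalDegree hirr.ne_zero] at htd
    have hQ0 : Q.totalDegree = 0 := by omega
    rw [totalDegree_eq_zero_iff_eq_C] at hQ0
    have hPG : P = G := by
      rw [hQ, map_mul] at hPe0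
      have : eval (Pi.single 0 1) Q = 1 := by
        have := h.2.1
        field_simp at hPe0
        exact hPe0
      rw [hQ0, eval_C] at this
      rw [hQ, hQ0, this]; simp
    obtain ⟨e, he⟩ : ∃ e : Fin (m+1) → ℚ, e = Pi.single 0 1 := ⟨_, rfl⟩
    refine hno (Fin.cons (ρ e) (Fin.cons 0 (Fin.cons 0 e : Fin (m+2) → ℚ) : Fin (m+3) → ℚ)) ?_ ?_
    · intro h0
      have := congrFun h0 (0 : Fin (m+1)).succ.succ.succ
      simp only [Fin.cons_succ] at this
      rw [he] at this
      simp at this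
    · intro x s
      rw [← hPG, hPe, hPe, hLP, hLP]
      congr 1; congr 1
      have e1 : (fun j : Fin (m+1) => x j.succ.succ.succ + s * (Fin.cons (ρ e) (Fin.cons 0 (Fin.cons 0 e : Fin (m+2) → ℚ) : Fin (m+3) → ℚ) : Fin (m+4) → ℚ) j.succ.succ.succ) = (fun j => x j.succ.succ.succ) + s • e := by
        funext j; simp
      rw [e1, map_add, map_smul]
      funext i; refine Fin.cases ?_ (fun j => Fin.cases ?_ (fun j => Fin.cases ?_ (fun j => ?_) j) j) i
      · simp
      · simp only [Fin.cons_succ, Fin.cons_zero]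
        change x 1 + s * 0 = x 1
        ring
      · simp only [Fin.cons_succ, Fin.cons_zero]
        change x 2 + s * 0 = x 2
        ring
      · simp
  · obtain ⟨R, hR⟩ : ∃ R, R = Polynomial.resultant (finSuccEquiv ℚ (m+3) G) (finSuccEquiv ℚ (m+3) P) := ⟨_, rfl⟩
    have hR0 : R ≠ 0 := by
      rw [hR]
      apply res_ne_zero
      · exact (MulEquiv.irreducible_iff (finSuccEquiv ℚ (m+3))).2 hirr
      · exact hnd
      · intro hd; apply hdvd
        have := map_dvd (finSuccEquiv ℚ (m+3)).symm hd
        simpa using this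
    have hRd : R.totalDegree ≤ 18 := by
      rw [hR]
      refine (res_totalDegree 3 _ _ (fun i => (totalDegree_coeff_fse_le G i).trans h.1.totalDegree_le)
        (fun i => (totalDegree_coeff_fse_le P i).trans hP3.totalDegree_le) _ _).trans ?_
      have h1 := (natDegree_fse_le G).trans h.1.totalDegree_le
      have h2 := (natDegree_fse_le P).trans hP3.totalDegree_le
      omega
    have hRv : ∀ t ∈ A, ∀ y : Fin (m+2) → ℚ, eval (Fin.cons ((t:ℚ) * y 0) y : Fin (m+3) → ℚ) R = 0 := by
      intro t ht y
      obtain ⟨ht1, ht2⟩ := hAm t ht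
      obtain ⟨x, hx⟩ : ∃ x : Fin (m+4) → ℚ, x = Fin.cons (β t y) (Fin.cons ((t:ℚ) * y 0) y : Fin (m+3) → ℚ) := ⟨_, rfl⟩
      have hGx : eval x G = 0 := by rw [hx]; exact hβ t ht1 y
      have hPx : eval x P = 0 := by
        rw [hPe, hLP]
        have := hβ t ht1 (Fin.cons (y 0) (fun _ => 0))
        refine Eq.trans ?_ this
        congr 1; congr 1
        have e2 : y = Fin.cons (y 0) (fun _ => 0) + Fin.cons 0 (Fin.tail y) := by
          funext i; refine Fin.cases ?_ (fun j => ?_) i <;> simp [Fin.tail]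
        have e3 : β t y = β t (Fin.cons (y 0) (fun _ => 0)) + ρ (Fin.tail y) := by
          rw [← ht2, ← map_add, ← e2]
        have e4 : (fun j : Fin (m+1) => x j.succ.succ.succ) = Fin.tail y := by
          funext j; rw [hx]; simp [Fin.tail]
        rw [e4]
        funext i; refine Fin.cases ?_ (fun j => Fin.cases ?_ (fun j => Fin.cases ?_ (fun j => ?_) j) j) i
        · rw [hx]; simp [e3]
        · rw [hx]; simp
        · simp only [Fin.cons_succ, Fin.cons_zero]; rw [hx]; rfl
        · simp
      have := res_vanish (aeval (Fin.tail x) : MvPolynomial (Fin (m+3)) ℚ →ₐ[ℚ] ℚ).toRingHom (x 0)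
        (finSuccEquiv ℚ (m+3) G) (finSuccEquiv ℚ (m+3) P) hnd (by
          rw [← aeval_fse]; exact hGx) (by
          rw [← aeval_fse]; exact hPx)
      rw [← hR] at this
      have e5 : Fin.tail x = (Fin.cons ((t:ℚ) * y 0) y : Fin (m+3) → ℚ) := by rw [hx]; simp
      rw [← e5]
      exact this
    have hX : R * X 1 ≠ 0 := mul_ne_zero hR0 (X_ne_zero _)
    obtain ⟨Z, hZ⟩ : ∃ Z, eval Z (R * X 1) ≠ 0 := by
      by_contra hcon
      push Not at hcon
      apply hX
      apply MvPolynomial.funext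
      intro x; rw [hcon x, map_zero]
    rw [map_mul, eval_X] at hZ
    have hZ1 : Z 1 ≠ 0 := right_ne_zero_of_mul hZ
    apply left_ne_zero_of_mul hZ
    have hl : linep Z (Pi.single 0 1) R = 0 := by
      apply Polynomial.eq_zero_of_natDegree_lt_card_of_eval_eq_zero' _ (A.image fun t : ℕ => (t:ℚ) * Z 1 - Z 0)
      · intro s hs
        obtain ⟨t, ht, rfl⟩ := Finset.mem_image.1 hs
        rw [linep_eval]
        have := hRv t ht (Fin.tail Z)
        refine Eq.trans ?_ this
        congr 1; congr 1; funext i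
        refine Fin.cases ?_ (fun j => ?_) i
        · simp [Fin.tail]
        · simp [Fin.tail]
      · rw [Finset.card_image_of_injective]
        · have := linep_natDegree Z (Pi.single 0 1) R
          omega
        · intro a b hab
          have : (a:ℚ) * Z 1 = b * Z 1 := by linarith
          exact_mod_cast mul_right_cancel₀ hZ1 this
    have := linep_eval Z (Pi.single 0 1) R 0
    rw [hl] at this
    simpa using this.symm

end DG

namespace DG
open MvPolynomial

def lc {k : ℕ} (b : Fin 3 → Fin k → ℤ) (y : Fin 3 → ℚ) : Fin k → ℚ := fun i => ∑ j, (b j i:ℚ) * y j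

def Good {k : ℕ} (T : ℕ) (G : MvPolynomial (Fin (k+1)) ℚ) (b : Fin 3 → Fin (k+1) → ℤ)
    (σ : Fin 3 → Fin (k+1)) : Prop :=
  (∀ j i, |b j i| ≤ T) ∧ (∀ i j, b j (σ i) = if i = j then 1 else 0) ∧ b 0 = Pi.single 0 1 ∧
    ∀ ρ : (Fin 2 → ℚ) →ₗ[ℚ] ℚ, ∃ y : Fin 2 → ℚ, eval (lc b (Fin.cons (ρ y) y : Fin 3 → ℚ)) G ≠ 0

theorem Good.mono {k : ℕ} {T T' : ℕ} {G : MvPolynomial (Fin (k+1)) ℚ} {b : Fin 3 → Fin (k+1) → ℤ}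
    {σ : Fin 3 → Fin (k+1)} (h : Good T G b σ) (hT : T ≤ T') : Good T' G b σ :=
  ⟨fun j i => (h.1 j i).trans (by exact_mod_cast hT), h.2⟩

theorem lc_sigma {k : ℕ} {b : Fin 3 → Fin k → ℤ} {σ : Fin 3 → Fin k}
    (h : ∀ i j, b j (σ i) = if i = j then 1 else 0) (y : Fin 3 → ℚ) (i : Fin 3) : lc b y (σ i) = y i := by
  unfold lc
  simp [h]

theorem lc_ins {k : ℕ} (i0 : Fin (k+1)) (j0 : Fin k) (t : ℕ) (b : Fin 3 → Fin k → ℤ) (y : Fin 3 → ℚ) :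
    lc (fun j => (i0.insertNth ((t:ℤ) * b j j0) (b j) : Fin (k+1) → ℤ)) y =
      i0.insertNth ((t:ℚ) * lc b y j0) (lc b y) := by
  funext i
  refine Fin.succAboveCases i0 ?_ (fun j => ?_) i
  · rw [Fin.insertNth_apply_same]
    unfold lc
    simp only [Fin.insertNth_apply_same]
    push_cast
    rw [Finset.mul_sum]
    apply Finset.sum_congr rfl; intros; ring
  · rw [Fin.insertNth_apply_succAbove]
    unfold lc
    simp only [Fin.insertNth_apply_succAbove]

theorem ins_e0Z {k : ℕ} (i1 : Fin (k+1)) (j0 : Fin (k+1)) (t : ℤ) (ht : t = 0 ∨ j0 ≠ 0) :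
    (i1.succ.insertNth (t * (Pi.single 0 1 : Fin (k+1) → ℤ) j0) (Pi.single 0 1 : Fin (k+1) → ℤ)
      : Fin (k+2) → ℤ) = Pi.single 0 1 := by
  funext i
  refine Fin.succAboveCases i1.succ ?_ (fun j => ?_) i
  · rw [Fin.insertNth_apply_same, Pi.single_eq_of_ne (Fin.succ_ne_zero _)]
    rcases ht with ht | ht
    · rw [ht, zero_mul]
    · rw [Pi.single_eq_of_ne ht, mul_zero]
  · rw [Fin.insertNth_apply_succAbove]
    refine Fin.cases ?_ (fun l => ?_) j
    · rw [Fin.succ_succAbove_zero]; simp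
    · rw [Fin.succ_succAbove_succ, Pi.single_eq_of_ne (Fin.succ_ne_zero _),
        Pi.single_eq_of_ne (Fin.succ_ne_zero _)]

theorem Good.lift {k : ℕ} {T : ℕ} {G : MvPolynomial (Fin (k+2)) ℚ} (i1 j0 : Fin (k+1)) (t : ℕ)
    (ht : t = 0 ∨ j0 ≠ 0) {b : Fin 3 → Fin (k+1) → ℤ} {σ : Fin 3 → Fin (k+1)}
    (h : Good T (ins i1.succ j0 (t:ℚ) G) b σ) :
    Good ((t+1)*T) G (fun j => (i1.succ.insertNth ((t:ℤ) * b j j0) (b j) : Fin (k+2) → ℤ))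
      (fun i => i1.succ.succAbove (σ i)) := by
  obtain ⟨h1, h2, h3, h4⟩ := h
  refine ⟨?_, ?_, ?_, ?_⟩
  · intro j i
    refine Fin.succAboveCases i1.succ ?_ (fun l => ?_) i
    · simp only [Fin.insertNth_apply_same]
      rw [abs_mul, Nat.abs_cast]
      have := h1 j j0
      push_cast
      have h0 := abs_nonneg (b j j0)
      nlinarith [(Nat.cast_nonneg t : (0:ℤ) ≤ t)]
    · simp only [Fin.insertNth_apply_succAbove]
      have := h1 j l
      push_cast
      nlinarith [(Nat.cast_nonneg t : (0:ℤ) ≤ t), abs_nonneg (b j l)]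
  · intro i j
    simp only [Fin.insertNth_apply_succAbove]
    exact h2 i j
  · simp only
    rw [h3]
    apply ins_e0Z
    rcases ht with ht | ht
    · left; exact_mod_cast ht
    · right; exact ht
  · intro ρ
    obtain ⟨y, hy⟩ := h4 ρ
    refine ⟨y, ?_⟩
    rw [lc_ins, ← ins_eval]
    exact hy

theorem std_lc (y : Fin 3 → ℚ) : lc (fun j : Fin 3 => (Pi.single j 1 : Fin 3 → ℤ)) y = y := by
  funext i
  unfold lc
  simp [Pi.single_apply]

theorem std_good {G : MvPolynomial (Fin 3) ℚ} (h : NR (k := 2) G) :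
    Good (k := 2) 1 G (fun j : Fin 3 => (Pi.single j 1 : Fin 3 → ℤ)) id := by
  refine ⟨?_, ?_, rfl, ?_⟩
  · intro j i
    simp only [Pi.single_apply]
    split_ifs <;> simp
  · intro i j
    simp [Pi.single_apply]
  · intro ρ
    obtain ⟨y, hy⟩ := h.2.2 ρ
    exact ⟨y, by rw [std_lc]; exact hy⟩

theorem Bert (m : ℕ) : ∃ T : ℕ, ∀ G : MvPolynomial (Fin (m+3)) ℚ, NR (k := m+2) G →
    ∃ b σ, Good (k := m+2) T G b σ := by
  induction m with
  | zero => exact ⟨1, fun G h => ⟨_, _, std_good h⟩⟩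
  | succ m ih =>
    obtain ⟨T, hT⟩ := ih
    refine ⟨55 * T, fun G h => ?_⟩
    by_cases hI : ∃ w, w ≠ 0 ∧ Inv G w
    · obtain ⟨w, hw, hI⟩ := hI
      obtain ⟨i1, hi1⟩ := inv_index h w hw hI
      obtain ⟨b, σ, hg⟩ := hT _ (NR_inv h w i1 hi1 hI)
      have := Good.lift (T := T) (G := G) i1 0 0 (Or.inl rfl) (b := b) (σ := σ) (by
        rw [Nat.cast_zero]; exact hg)
      exact ⟨_, _, this.mono (by omega)⟩
    · push Not at hI
      obtain ⟨t, ht, hn⟩ := pencil G h hI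
      obtain ⟨b, σ, hg⟩ := hT _ hn
      have := Good.lift (T := T) (G := G) 0 1 t (Or.inr (by simp)) (b := b) (σ := σ) hg
      exact ⟨_, _, this.mono (Nat.mul_le_mul_right _ (by omega))⟩

def Bin {k : ℕ} (G : MvPolynomial (Fin (k+1)) ℚ) : Prop :=
  ∃ j : Fin (k+1), j ≠ 0 ∧ ∀ x x' : Fin (k+1) → ℚ, eval x G = 0 → eval x' G = 0 →
    (∀ i, i ≠ 0 → i ≠ j → x i = x' i) → x = x'

theorem Bin.lift {k : ℕ} {G : MvPolynomial (Fin (k+2)) ℚ} (w : Fin (k+2) → ℚ)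
    (i1 : Fin (k+1)) (hw : w i1.succ ≠ 0) (hI : Inv G w) (h : Bin (ins i1.succ 0 0 G)) : Bin G := by
  obtain ⟨j, hj, hB⟩ := h
  refine ⟨i1.succ.succAbove j, ?_, ?_⟩
  · intro h0
    apply hj
    have := Fin.succ_succAbove_zero i1
    exact Fin.succAbove_right_injective (h0.trans this.symm)
  · intro x x' hx hx' he
    have e0 : x i1.succ = x' i1.succ := he _ (Fin.succ_ne_zero _) (Fin.succAbove_ne _ _).symm
    have := hB (red w i1.succ x) (red w i1.succ x') (by rw [red_eval w i1.succ hw 0 G hI]; exact hx)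
      (by rw [red_eval w i1.succ hw 0 G hI]; exact hx') (by
        intro l hl hlj
        unfold red
        rw [e0, he (i1.succ.succAbove l)]
        · intro h0
          apply hl
          exact Fin.succAbove_right_injective (h0.trans (Fin.succ_succAbove_zero i1).symm)
        · intro h0; exact hlj (Fin.succAbove_right_injective h0))
    funext i
    refine Fin.succAboveCases i1.succ e0 (fun l => ?_) i
    have := congrFun this l
    unfold red at this
    rw [e0] at this
    linarith

theorem Inv.ins {k : ℕ} {G : MvPolynomial (Fin (k+1)) ℚ} (i0 : Fin (k+1)) (j0 : Fin k) (u : Fin k → ℚ)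
    (h : Inv G (i0.insertNth 0 u)) : Inv (ins i0 j0 0 G) u := by
  intro x s
  rw [ins_eval, ins_eval]
  refine Eq.trans ?_ (h _ s)
  congr 1; congr 1; funext i
  refine Fin.succAboveCases i0 ?_ (fun l => ?_) i
  · simp
  · simp

theorem Comb (m : ℕ) : ∃ T : ℕ, ∀ G : MvPolynomial (Fin (m+3)) ℚ, NR (k := m+2) G →
    Bin (k := m+2) G ∨ ∃ b σ, Good (k := m+2) T G b σ ∧ ∀ v, v ≠ 0 → ¬ Inv G (lc b v) := by
  induction m with
  | zero =>
    refine ⟨1, fun G h => ?_⟩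
    by_cases hI : ∃ w, w ≠ 0 ∧ Inv G w
    · left
      obtain ⟨w, hw, hI⟩ := hI
      obtain ⟨i1, hi1⟩ := inv_index h w hw hI
      have hN := NR_inv (k := 1) h w i1 hi1 hI
      apply Bin.lift (k := 1) w i1 hi1 hI
      refine ⟨1, by simp, ?_⟩
      intro x x' hx hx' _
      rw [NR_bin hN x hx, NR_bin hN x' hx']
    · push Not at hI
      right
      refine ⟨_, _, std_good h, ?_⟩
      intro v hv
      rw [std_lc]
      exact hI v hv
  | succ m ih =>
    obtain ⟨T, hT⟩ := ih
    obtain ⟨T', hT'⟩ := Bert (m+1)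
    refine ⟨T + T', fun G h => ?_⟩
    by_cases hI : ∃ w, w ≠ 0 ∧ Inv G w
    · obtain ⟨w, hw, hI⟩ := hI
      obtain ⟨i1, hi1⟩ := inv_index h w hw hI
      rcases hT _ (NR_inv h w i1 hi1 hI) with hB | ⟨b, σ, hg, hv⟩
      · left; exact hB.lift w i1 hi1 hI
      · right
        have := Good.lift (T := T) (G := G) i1 0 0 (Or.inl rfl) (b := b) (σ := σ) (by
          rw [Nat.cast_zero]; exact hg)
        refine ⟨_, _, this.mono (by omega), ?_⟩
        intro v hv0 hIv
        rw [lc_ins] at hIv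
        apply hv v hv0
        apply Inv.ins
        simpa using hIv
    · push Not at hI
      right
      obtain ⟨b, σ, hg⟩ := hT' G h
      refine ⟨b, σ, hg.mono (by omega), ?_⟩
      intro v hv
      apply hI
      intro h0
      apply hv
      funext i
      rw [← lc_sigma hg.2.1 v i, h0]
      rfl

end DG

namespace DG
open MvPolynomial

theorem linep_coeff3 {k : ℕ} (G : MvPolynomial (Fin k) ℚ) (hG : G.IsHomogeneous 3) (c v : Fin k → ℚ) :
    (linep c v G).coeff 3 = eval v G := by
  have key : linep c v G = (linep v c G).reflect 3 := by
    rw [← sub_eq_zero]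
    apply poly_zero_nat
    intro s hs
    have hs' : (s:ℚ) ≠ 0 := by positivity
    have hs'' : (s:ℚ)⁻¹ ≠ 0 := inv_ne_zero hs'
    let _ := invertibleOfNonzero hs''
    have h1 := Polynomial.eval₂_reflect_mul_pow (RingHom.id ℚ) ((s:ℚ)⁻¹) 3 (linep v c G)
      ((linep_natDegree _ _ _).trans hG.totalDegree_le)
    rw [invOf_eq_inv, inv_inv] at h1
    change Polynomial.eval _ _ * _ = Polynomial.eval _ _ at h1
    rw [linep_eval] at h1
    have h2 := hom_eval G hG (s:ℚ) (fun i => v i + (s:ℚ)⁻¹ * c i)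
    rw [← h1] at h2
    have e : (fun i => (s:ℚ) * (v i + (s:ℚ)⁻¹ * c i)) = fun i => c i + s * v i := by
      funext i; field_simp; ring
    rw [e] at h2
    rw [Polynomial.eval_sub, linep_eval, h2]
    field_simp
    ring
  rw [key, Polynomial.coeff_reflect, Polynomial.revAt_le le_rfl, Nat.sub_self,
    Polynomial.coeff_zero_eq_eval_zero, linep_eval]
  congr 2; funext i; ring

theorem szQ {n : ℕ} (p : MvPolynomial (Fin (n+1)) ℚ) (hp : p ≠ 0) (S : Finset ℤ)
    (T : Finset (Fin (n+1) → ℤ)) (hT : ∀ x ∈ T, (∀ i, x i ∈ S) ∧ eval (fun i => (x i:ℚ)) p = 0) :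
    T.card ≤ p.totalDegree * S.card ^ n := by
  classical
  rcases T.eq_empty_or_nonempty with rfl | ⟨x0, hx0⟩
  · simp
  have hS : 0 < S.card := Finset.card_pos.2 ⟨x0 0, (hT x0 hx0).1 0⟩
  have hSc : (S.image (fun a : ℤ => (a:ℚ))).card = S.card :=
    Finset.card_image_of_injective _ Int.cast_injective
  have h := schwartz_zippel_totalDegree hp (S.image (fun a : ℤ => (a:ℚ)))
  have hc : T.card ≤ (Finset.filter (fun f => eval f p = 0) (Fintype.piFinset fun _ => (S.image (fun a : ℤ => (a:ℚ))))).card := by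
    apply Finset.card_le_card_of_injOn (fun x i => (x i:ℚ))
    · intro x hx
      simp only [Finset.mem_coe, Finset.mem_filter, Fintype.mem_piFinset]
      exact ⟨fun i => Finset.mem_image_of_mem _ ((hT x hx).1 i), (hT x hx).2⟩
    · intro x _ y _ hxy
      funext i
      have := congrFun hxy i
      simp only [Int.cast_inj] at this
      exact this
  have hS' : (0:ℚ≥0) < (S.image (fun a : ℤ => (a:ℚ))).card := by rw [hSc]; exact_mod_cast hS
  rw [div_le_div_iff₀ (by positivity) hS'] at h
  rw [hSc] at h
  have h' : (Finset.filter (fun f => eval f p = 0) (Fintype.piFinset fun _ => (S.image (fun a : ℤ => (a:ℚ))))).card * S.card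
      ≤ p.totalDegree * S.card ^ (n+1) := by exact_mod_cast h
  have h2 : T.card * S.card ≤ (p.totalDegree * S.card ^ n) * S.card := by
    calc _ ≤ _ := Nat.mul_le_mul_right _ hc
      _ ≤ _ := h'
      _ = _ := by ring
  exact Nat.le_of_mul_le_mul_right h2 hS

theorem lc_add {k : ℕ} (b : Fin 3 → Fin k → ℤ) (y z : Fin 3 → ℚ) (s : ℚ) :
    lc b (fun i => y i + s * z i) = fun i => lc b y i + s * lc b z i := by
  funext i
  unfold lc
  rw [Finset.mul_sum, ← Finset.sum_add_distrib]
  apply Finset.sum_congr rfl; intros; ring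

theorem lc_smul {k : ℕ} (b : Fin 3 → Fin k → ℤ) (z : Fin 3 → ℚ) (s : ℚ) :
    lc b (fun i => s * z i) = fun i => s * lc b z i := by
  funext i
  unfold lc
  rw [Finset.mul_sum]
  apply Finset.sum_congr rfl; intros; ring

theorem lc_e0 {k : ℕ} (b : Fin 3 → Fin (k+1) → ℤ) (hb : b 0 = Pi.single 0 1) :
    lc b (Pi.single 0 1) = Pi.single 0 1 := by
  funext i
  unfold lc
  simp only [Pi.single_apply, mul_ite, mul_one, mul_zero, Finset.sum_ite_eq', Finset.mem_univ, if_true]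
  rw [hb, Pi.single_apply]
  push_cast
  rfl

/-- the slice `y ↦ f (c + b y)` -/
noncomputable def gc {k : ℕ} (f : MvPolynomial (Fin k) ℤ) (b : Fin 3 → Fin k → ℤ) (c : Fin k → ℤ) :
    MvPolynomial (Fin 3) ℤ := aeval (fun i => C (c i) + ∑ j, C (b j i) * X j) f

theorem gc_eval {k : ℕ} (f : MvPolynomial (Fin k) ℤ) (b : Fin 3 → Fin k → ℤ) (c : Fin k → ℤ)
    (y : Fin 3 → ℤ) : eval y (gc f b c) = eval (fun i => c i + ∑ j, b j i * y j) f := by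
  unfold gc
  rw [eval_aeval']
  congr 2; funext i; simp

theorem gc_evalq {k : ℕ} (f : MvPolynomial (Fin k) ℤ) (b : Fin 3 → Fin k → ℤ) (c : Fin k → ℤ)
    (y : Fin 3 → ℚ) : eval y (qm (gc f b c)) = eval (fun i => (c i:ℚ) + lc b y i) (qm f) := by
  rw [← aeval_q, ← aeval_q]
  unfold gc
  have : (aeval y).comp (aeval (fun i => C (c i) + ∑ j, C (b j i) * X j)) =
    (aeval (fun i => (c i:ℚ) + lc b y i) : MvPolynomial (Fin k) ℤ →ₐ[ℤ] ℚ) := by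
    apply algHom_ext
    intro i
    simp [lc]
  rw [← this]; rfl

theorem gc_td {k : ℕ} (f : MvPolynomial (Fin k) ℤ) (b : Fin 3 → Fin k → ℤ) (c : Fin k → ℤ) :
    (gc f b c).totalDegree ≤ f.totalDegree := by
  apply td_aeval_le
  intro i
  refine (totalDegree_add _ _).trans (max_le ?_ ?_)
  · rw [totalDegree_C]; omega
  · apply totalDegree_finsetSum_le
    intro j _
    refine (totalDegree_mul _ _).trans ?_
    rw [totalDegree_C, totalDegree_X]

theorem gc_hom {k : ℕ} (f : MvPolynomial (Fin k) ℤ) (hf : f.IsHomogeneous 3) (b : Fin 3 → Fin k → ℤ) :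
    (gc f b 0).IsHomogeneous 3 := by
  have := hf.aeval (fun i => C ((0 : Fin k → ℤ) i) + ∑ j, C (b j i) * X j : Fin k → MvPolynomial (Fin 3) ℤ) (n := 1) (by
    intro i
    simp only [Pi.zero_apply, map_zero, zero_add]
    apply IsHomogeneous.sum
    intro j _
    have := (isHomogeneous_C (Fin 3) (b j i)).mul (isHomogeneous_X ℤ j)
    rw [zero_add] at this
    exact this)
  rw [one_mul] at this
  exact this

theorem qm_hom {k : ℕ} {f : MvPolynomial (Fin k) ℤ} (hf : f.IsHomogeneous 3) : (qm f).IsHomogeneous 3 :=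
  hf.map _

theorem gc_surf {k T : ℕ} (f : MvPolynomial (Fin (k+1)) ℤ) (hf : f.IsHomogeneous 3)
    (he : eval (Pi.single 0 1) (qm f) ≠ 0) (b : Fin 3 → Fin (k+1) → ℤ) (σ : Fin 3 → Fin (k+1))
    (hg : Good T (qm f) b σ) (c : Fin (k+1) → ℤ) : Surf (gc f b c) := by
  have hq := qm_hom hf
  have htd := (gc_td f b c).trans hf.totalDegree_le
  have hco : coeff (Finsupp.single 0 3) (qm (gc f b c)) ≠ 0 := by
    rw [coeff3_of_fse]
    have e : (finSuccEquiv ℚ 2 (qm (gc f b c))).map (constantCoeff : MvPolynomial (Fin 2) ℚ →+* ℚ) = linep (fun i => (c i:ℚ)) (Pi.single 0 1) (qm f) := by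
      rw [← sub_eq_zero]
      apply poly_zero_nat
      intro s _
      rw [Polynomial.eval_sub, linep_eval, sub_eq_zero, Polynomial.eval_map]
      have := aeval_fse (Fin.cons (s:ℚ) (fun _ => 0) : Fin 3 → ℚ) (qm (gc f b c))
      have e2 : (Fin.cons (s:ℚ) (fun _ => 0) : Fin 3 → ℚ) = fun i => (s:ℚ) * (Pi.single 0 1 : Fin 3 → ℚ) i := by
        funext i; refine Fin.cases ?_ (fun j => ?_) i <;> simp
      have e3 := gc_evalq f b c (Fin.cons (s:ℚ) (fun _ => 0) : Fin 3 → ℚ)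
      rw [e2, lc_smul, lc_e0 b hg.2.2.1, ← e2] at e3
      refine Eq.trans ?_ e3
      refine Eq.trans ?_ this.symm
      congr 1
      apply RingHom.ext
      intro p
      simp only [Fin.tail_cons]
      change constantCoeff p = aeval (fun _ => (0:ℚ)) p
      induction p using MvPolynomial.induction_on with
      | C a => simp
      | add p q hp hq => simp_all
      | mul_X p i hp => simp
    have e4 := congrArg (fun p => Polynomial.coeff p 3) e
    simp only [Polynomial.coeff_map] at e4
    rw [linep_coeff3 _ hq, constantCoeff_eq] at e4
    rw [e4]; exact he
  refine ⟨htd, ?_, ?_⟩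
  · intro h0
    apply hco
    rw [coeff_map, h0, map_zero]
  · apply irr_of (k := 2) _ ((td_qm_le _).trans htd) hco
    intro ρ c0
    by_contra hc
    push Not at hc
    obtain ⟨ρ', hρ'⟩ : ∃ ρ' : (Fin 2 → ℚ) →ₗ[ℚ] ℚ, ∀ x, ρ' x = ∑ i, ρ i * x i :=
      ⟨∑ i, ρ i • LinearMap.proj i, fun x => by simp⟩
    obtain ⟨y, hy⟩ := hg.2.2.2 ρ'
    apply hy
    have := line_all (lc b (Fin.cons (ρ' y) y : Fin 3 → ℚ))
      (fun i => (c i:ℚ) + lc b (Fin.cons c0 (fun _ => 0) : Fin 3 → ℚ) i) (qm f) (by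
      intro s hs
      have hs' : (s:ℚ) ≠ 0 := by positivity
      have e := hc (fun i => (s:ℚ)⁻¹ * y i)
      have e1 := gc_evalq f b c (Fin.cons (c0 + ∑ i, ρ i * ((s:ℚ)⁻¹ * y i)) (fun i => (s:ℚ)⁻¹ * y i) : Fin 3 → ℚ)
      have e2 := hom_eval (qm f) hq (s:ℚ) (fun i => (c i:ℚ) + lc b (Fin.cons (c0 + ∑ i, ρ i * ((s:ℚ)⁻¹ * y i)) (fun i => (s:ℚ)⁻¹ * y i) : Fin 3 → ℚ) i)
      rw [← e1, e, mul_zero] at e2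
      refine Eq.trans ?_ e2
      congr 2; funext i
      have e3 : (Fin.cons (ρ' y) y : Fin 3 → ℚ) = fun i => (s:ℚ) * (Fin.cons (c0 + ∑ i, ρ i * ((s:ℚ)⁻¹ * y i)) (fun i => (s:ℚ)⁻¹ * y i) : Fin 3 → ℚ) i
          + (-(s:ℚ)) * (Fin.cons c0 (fun _ => 0) : Fin 3 → ℚ) i := by
        funext i
        refine Fin.cases ?_ (fun j => ?_) i
        · simp only [Fin.cons_zero]
          rw [hρ', mul_add, Finset.mul_sum]
          have : ∑ i, (s:ℚ) * (ρ i * ((s:ℚ)⁻¹ * y i)) = ∑ i, ρ i * y i := by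
            apply Finset.sum_congr rfl; intros; field_simp
          rw [this]; ring
        · simp only [Fin.cons_succ]; field_simp; try ring
      rw [e3, lc_add, lc_smul]
      ring) 0
    simpa using this

theorem gc_lines {k : ℕ} (f : MvPolynomial (Fin (k+1)) ℤ) (hf : f.IsHomogeneous 3)
    (b : Fin 3 → Fin (k+1) → ℤ) (c : Fin (k+1) → ℤ) (P v : Fin 3 → ℤ)
    (h : ∀ s : ℤ, eval (fun i => P i + s * v i) (gc f b c) = 0) : eval v (gc f b 0) = 0 := by
  have h1 := line_q P v _ h
  have h2 := hom_plane (qm f) (qm_hom hf) (fun i => (c i:ℚ) + lc b (fun i => (P i:ℚ)) i)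
    (lc b (fun i => (v i:ℚ))) (by
      intro s
      have := h1 s
      rw [gc_evalq, lc_add] at this
      refine Eq.trans ?_ this
      congr 2; funext i; ring) 0 1
  have h3 : eval (fun i => (v i:ℚ)) (qm (gc f b 0)) = 0 := by
    rw [gc_evalq]
    refine Eq.trans ?_ h2
    congr 2; funext i; simp
  rw [eval_qm] at h3
  exact_mod_cast h3

end DG

namespace DG
open MvPolynomial

def InvC {k : ℕ} (G : MvPolynomial (Fin k) ℚ) (b : Fin 3 → Fin k → ℤ) (c : Fin k → ℤ) (v : Fin 3 → ℚ) : Prop :=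
  ∀ (y : Fin 3 → ℚ) (s : ℚ), eval (fun i => (c i:ℚ) + lc b y i + s * lc b v i) G =
    eval (fun i => (c i:ℚ) + lc b y i) G

theorem InvC_of_Dv {k : ℕ} (f : MvPolynomial (Fin k) ℤ) (b : Fin 3 → Fin k → ℤ) (c : Fin k → ℤ)
    (v : Fin 3 → ℤ) (h : Dv v (gc f b c) = 0) : InvC (qm f) b c (fun i => (v i:ℚ)) := by
  intro y s
  have h1 := linep_deriv y (fun i => (v i:ℚ)) (qm (gc f b c))
  have h2 : (∑ i, C (v i:ℚ) * pderiv i (qm (gc f b c))) = qm (Dv v (gc f b c)) := by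
    unfold Dv qm
    simp only [map_sum, map_mul, map_C, pderiv_map]
    rfl
  rw [h2, h] at h1
  have h3 : linep y (fun i => (v i:ℚ)) (qm (0 : MvPolynomial (Fin 3) ℤ)) = 0 := by
    unfold linep qm; simp
  rw [h3] at h1
  have h4 := Polynomial.natDegree_eq_zero_of_derivative_eq_zero h1
  rw [Polynomial.natDegree_eq_zero] at h4
  obtain ⟨a, ha⟩ := h4
  have e1 := linep_eval y (fun i => (v i:ℚ)) (qm (gc f b c)) s
  have e2 := linep_eval y (fun i => (v i:ℚ)) (qm (gc f b c)) 0
  rw [← ha, Polynomial.eval_C, gc_evalq, lc_add] at e1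
  rw [← ha, Polynomial.eval_C, gc_evalq, lc_add] at e2
  rw [e1] at e2
  refine Eq.trans ?_ (e2.trans ?_)
  · congr 2; funext i; ring
  · congr 2; funext i; ring

theorem InvC.zero {k : ℕ} {G : MvPolynomial (Fin k) ℚ} (hG : G.IsHomogeneous 3) {b : Fin 3 → Fin k → ℤ}
    {c : Fin k → ℤ} {v : Fin 3 → ℚ} (h : InvC G b c v) : InvC G b 0 v := by
  intro y s
  have key : linep (fun i => lc b y i + s * lc b v i) (fun i => (c i:ℚ)) G
      - linep (fun i => lc b y i) (fun i => (c i:ℚ)) G = 0 := by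
    apply poly_zero_nat
    intro μ hμ
    have hμ' : (μ:ℚ) ≠ 0 := by positivity
    rw [Polynomial.eval_sub, linep_eval, linep_eval, sub_eq_zero]
    have h1 := h (fun i => (μ:ℚ)⁻¹ * y i) ((μ:ℚ)⁻¹ * s)
    rw [lc_smul] at h1
    have h2 := hom_eval G hG (μ:ℚ) (fun i => (c i:ℚ) + (μ:ℚ)⁻¹ * lc b y i + (μ:ℚ)⁻¹ * s * lc b v i)
    have h3 := hom_eval G hG (μ:ℚ) (fun i => (c i:ℚ) + (μ:ℚ)⁻¹ * lc b y i)
    rw [h1, ← h3] at h2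
    refine Eq.trans ?_ (h2.trans ?_)
    · congr 2; funext i; field_simp; ring
    · congr 2; funext i; field_simp; ring
  have := congrArg (Polynomial.eval 0) key
  rw [Polynomial.eval_sub, linep_eval, linep_eval, Polynomial.eval_zero, sub_eq_zero] at this
  simpa using this

theorem InvC.unique {k T : ℕ} {G : MvPolynomial (Fin (k+1)) ℚ} (hG : G.IsHomogeneous 3)
    (he : eval (Pi.single 0 1) G ≠ 0) {b : Fin 3 → Fin (k+1) → ℤ} {σ : Fin 3 → Fin (k+1)}
    (hg : Good T G b σ) {v w : Fin 3 → ℚ} (hv : InvC G b 0 v) (hw : InvC G b 0 w) (i j : Fin 3) :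
    v i * w j = v j * w i := by
  have h0 : eval (fun _ => (0:ℚ)) G = 0 := by
    have := hom_eval G hG 0 (fun _ => 0)
    simpa using this
  have hpl : ∀ α β : ℚ, eval (lc b (fun i => α * v i + β * w i)) G = 0 := by
    intro α β
    have h1 := hw (fun i => α * v i) β
    have h2 := hv (fun i => 0 * v i) α
    rw [lc_smul] at h1 h2
    rw [lc_add, lc_smul]
    simp only [Pi.zero_apply, Int.cast_zero, zero_add, zero_mul] at h1 h2
    rw [h1, h2, h0]
  have hax : ∀ α β : ℚ, α * v 1 + β * w 1 = 0 → α * v 2 + β * w 2 = 0 → α * v 0 + β * w 0 = 0 := by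
    intro α β h1 h2
    have h3 := hpl α β
    have e : (fun i => α * v i + β * w i) = fun i => (α * v 0 + β * w 0) * (Pi.single 0 1 : Fin 3 → ℚ) i := by
      funext i
      fin_cases i
      · simp
      · simpa using h1
      · simpa using h2
    rw [e, lc_smul, lc_e0 b hg.2.2.1, hom_eval G hG] at h3
    rcases mul_eq_zero.1 h3 with h4 | h4
    · exact pow_eq_zero_iff (by norm_num) |>.1 h4
    · exact absurd h4 he
  have hD : v 1 * w 2 - v 2 * w 1 = 0 := by
    by_contra hD
    obtain ⟨D, hDd⟩ : ∃ D, D = v 1 * w 2 - v 2 * w 1 := ⟨_, rfl⟩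
    rw [← hDd] at hD
    obtain ⟨y, hy⟩ := hg.2.2.2 (((w 2 * v 0 - v 2 * w 0) / D) • LinearMap.proj 0 +
      ((v 1 * w 0 - w 1 * v 0) / D) • LinearMap.proj 1)
    apply hy
    have := hpl ((y 0 * w 2 - y 1 * w 1) / D) ((v 1 * y 1 - v 2 * y 0) / D)
    refine Eq.trans ?_ this
    congr 3; funext i
    fin_cases i
    · simp; field_simp; ring
    · change y 0 = _ * v 1 + _ * w 1
      field_simp; rw [hDd]; ring
    · change y 1 = _ * v 2 + _ * w 2
      field_simp; rw [hDd]; ring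
  have h1 := hax (w 2) (-v 2) (by linarith) (by ring)
  have h2 := hax (w 1) (-v 1) (by ring) (by linarith)
  fin_cases i <;> fin_cases j <;> simp only [Fin.zero_eta, Fin.mk_one, Fin.reduceFinMk] <;> linarith

theorem InvC.scale {k : ℕ} {G : MvPolynomial (Fin k) ℚ} {b : Fin 3 → Fin k → ℤ}
    {c : Fin k → ℤ} {v w : Fin 3 → ℚ} (h : InvC G b c v) (hv : v ≠ 0) (hm : ∀ i j, v i * w j = v j * w i) :
    InvC G b c w := by
  obtain ⟨i, hi⟩ := Function.ne_iff.1 hv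
  have hi' : v i ≠ 0 := hi
  have e : w = fun j => (w i / v i) * v j := by
    funext j
    have := hm i j
    field_simp; linarith
  intro y s
  rw [e, lc_smul, ← h y (s * (w i / v i))]
  congr 2; funext i; ring

/-- projection killing the coordinates in the range of `σ` -/
noncomputable def prj {k : ℕ} (σ : Fin 3 → Fin k) (c : Fin k → ℤ) (y : Fin 3 → ℤ) : Fin k → ℤ :=
  fun i => c i + ∑ j, if σ j = i then y j else 0

theorem sigma_inj {k : ℕ} {b : Fin 3 → Fin k → ℤ} {σ : Fin 3 → Fin k}
    (h : ∀ i j, b j (σ i) = if i = j then 1 else 0) : Function.Injective σ := by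
  intro i j hij
  have h1 := h i j
  have h2 := h j j
  rw [hij, h2] at h1
  by_contra hne
  simp [hne] at h1

theorem prj_sigma {k : ℕ} {σ : Fin 3 → Fin k} (hσ : Function.Injective σ) (c : Fin k → ℤ)
    (hc : ∀ j, c (σ j) = 0) (y : Fin 3 → ℤ) (j : Fin 3) : prj σ c y (σ j) = y j := by
  unfold prj
  rw [hc, zero_add]
  simp [hσ.eq_iff]

theorem prj_off {k : ℕ} {σ : Fin 3 → Fin k} (c : Fin k → ℤ)
    (y : Fin 3 → ℤ) (i : Fin k) (hi : i ∉ Set.range σ) : prj σ c y i = c i := by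
  unfold prj
  rw [Finset.sum_eq_zero, add_zero]
  intro j _
  rw [if_neg]
  intro h; exact hi ⟨j, h⟩

/-- extension trick: multiply a set of `c`'s with a 3-dimensional box -/
theorem prj_count {k : ℕ} {σ : Fin 3 → Fin k} (hσ : Function.Injective σ) (M : ℕ)
    (Z : Finset (Fin k → ℤ)) (hZ : ∀ c ∈ Z, Box M c ∧ ∀ j, c (σ j) = 0) :
    ∃ W : Finset (Fin k → ℤ), W.card = Z.card * (2*M+1)^3 ∧
      ∀ x ∈ W, (∀ i, x i ∈ Finset.Icc (-(M:ℤ)) M) ∧ ∃ c ∈ Z, ∀ i, i ∉ Set.range σ → x i = c i := by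
  classical
  refine ⟨(Z ×ˢ (Fintype.piFinset fun _ : Fin 3 => Finset.Icc (-(M:ℤ)) M)).image (fun p => prj σ p.1 p.2), ?_, ?_⟩
  · rw [Finset.card_image_of_injOn, Finset.card_product, Fintype.card_piFinset]
    · simp only [card_Icc_box, Finset.prod_const, Finset.card_univ, Fintype.card_fin]
    · rintro ⟨c, y⟩ h1 ⟨c', y'⟩ h2 h
      simp only [Finset.coe_product, Set.mem_prod, Finset.mem_coe] at h1 h2
      simp only at h
      have hc := (hZ c h1.1).2
      have hc' := (hZ c' h2.1).2
      have hy : y = y' := by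
        funext j
        rw [← prj_sigma hσ c hc y j, h, prj_sigma hσ c' hc']
      have hcc : c = c' := by
        funext i
        by_cases hi : i ∈ Set.range σ
        · obtain ⟨j, rfl⟩ := hi
          rw [hc, hc']
        · rw [← prj_off c y i hi, h, prj_off c' y' i hi]
      rw [hy, hcc]
  · intro x hx
    obtain ⟨⟨c, y⟩, hp, rfl⟩ := Finset.mem_image.1 hx
    rw [Finset.mem_product, Fintype.mem_piFinset] at hp
    refine ⟨?_, c, hp.1, fun i hi => prj_off c y i hi⟩
    intro i
    by_cases hi : i ∈ Set.range σ
    · obtain ⟨j, rfl⟩ := hi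
      simp only
      rw [prj_sigma hσ c (hZ c hp.1).2]
      exact hp.2 j
    · simp only
      rw [prj_off c y i hi, Finset.mem_Icc]
      exact abs_le.1 ((hZ c hp.1).1 i)

theorem c_count {k : ℕ} {σ : Fin 3 → Fin (k+3)} (hσ : Function.Injective σ) (M : ℕ)
    (Z : Finset (Fin (k+3) → ℤ)) (hZ : ∀ c ∈ Z, Box M c ∧ ∀ j, c (σ j) = 0) :
    Z.card ≤ (2*M+1)^k := by
  classical
  obtain ⟨W, hW, hWm⟩ := prj_count hσ M Z hZ
  have h1 : W.card ≤ (Fintype.piFinset fun _ : Fin (k+3) => Finset.Icc (-(M:ℤ)) M).card := by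
    apply Finset.card_le_card
    intro x hx
    rw [Fintype.mem_piFinset]
    exact (hWm x hx).1
  rw [Fintype.card_piFinset] at h1
  simp only [card_Icc_box, Finset.prod_const, Finset.card_univ, Fintype.card_fin] at h1
  rw [hW, pow_add] at h1
  exact Nat.le_of_mul_le_mul_right h1 (by positivity)

theorem bad_count {k T : ℕ} {G : MvPolynomial (Fin (k+4)) ℚ} (hG : G.IsHomogeneous 3)
    (he : eval (Pi.single 0 1) G ≠ 0) {b : Fin 3 → Fin (k+4) → ℤ} {σ : Fin 3 → Fin (k+4)}
    (hg : Good (k := k+3) T G b σ) (hno : ∀ v, v ≠ 0 → ¬ Inv G (lc b v)) (M : ℕ)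
    (Z : Finset (Fin (k+4) → ℤ)) (hZ : ∀ c ∈ Z, Box M c ∧ ∀ j, c (σ j) = 0)
    (hbad : ∀ c ∈ Z, ∃ v, v ≠ 0 ∧ InvC G b c v) : Z.card ≤ 3 * (2*M+1)^k := by
  classical
  rcases Z.eq_empty_or_nonempty with rfl | ⟨c0, hc0⟩
  · simp
  obtain ⟨w, hw, hwI⟩ := hbad c0 hc0
  have hall : ∀ c ∈ Z, InvC G b c w := by
    intro c hc
    obtain ⟨v, hv, hvI⟩ := hbad c hc
    exact hvI.scale hv (hvI.zero hG |>.unique hG he hg (hwI.zero hG))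
  have hnot := hno w hw
  unfold Inv at hnot
  push Not at hnot
  obtain ⟨x, s, hxs⟩ := hnot
  have hσ := sigma_inj hg.2.1
  obtain ⟨W, hW, hWm⟩ := prj_count hσ M Z hZ
  obtain ⟨P, hP⟩ : ∃ P : Fin 3 → ℚ, P = fun j => x (σ j) := ⟨_, rfl⟩
  -- substitution polynomials
  obtain ⟨φ, hφ⟩ : ∃ φ : (Fin (k+4) → ℚ) → Fin (k+4) → MvPolynomial (Fin (k+4)) ℚ,
      φ = fun A i => (if i ∈ Set.range σ then 0 else X i) + C (A i) := ⟨_, rfl⟩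
  have hφe : ∀ A z, eval z (aeval (φ A) G) = eval (fun i => (if i ∈ Set.range σ then 0 else z i) + A i) G := by
    intro A z
    rw [eval_aeval', hφ]
    congr 2; funext i
    by_cases hi : i ∈ Set.range σ
    · simp only [hi, if_true, map_add, map_zero, eval_C]
    · simp only [hi, if_false, map_add, eval_X, eval_C]
  have hφd : ∀ A, (aeval (φ A) G).totalDegree ≤ 3 := by
    intro A
    refine (td_aeval_le _ ?_ G).trans hG.totalDegree_le
    intro i
    rw [hφ]
    refine (totalDegree_add _ _).trans (max_le ?_ ?_)
    · by_cases hi : i ∈ Set.range σ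
      · simp only [hi, if_true, totalDegree_zero]; omega
      · simp only [hi, if_false, totalDegree_X]; omega
    · rw [totalDegree_C]; omega
  obtain ⟨h, hh⟩ : ∃ h, h = aeval (φ (fun i => lc b P i + s * lc b w i)) G - aeval (φ (lc b P)) G := ⟨_, rfl⟩
  have hh0 : h ≠ 0 := by
    intro h0
    apply hxs
    rw [hh] at h0
    have := congrArg (eval (fun i => x i - lc b P i)) h0
    rw [map_sub, hφe, hφe, map_zero, sub_eq_zero] at this
    have hx0 : ∀ i, (if i ∈ Set.range σ then 0 else x i - lc b P i) = x i - lc b P i := by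
      intro i
      by_cases hi : i ∈ Set.range σ
      · obtain ⟨j, rfl⟩ := hi
        rw [lc_sigma hg.2.1, hP]; simp
      · rw [if_neg hi]
    simp only [hx0] at this
    refine Eq.trans ?_ (this.trans ?_)
    · congr 2; funext i; ring
    · congr 2; funext i; ring
  have hhd : h.totalDegree ≤ 3 := by
    rw [hh]; exact (totalDegree_sub _ _).trans (max_le (hφd _) (hφd _))
  have h1 := szQ (n := k+3) h hh0 (Finset.Icc (-(M:ℤ)) M) W (by
    intro x hx
    obtain ⟨hx1, c, hc, hx2⟩ := hWm x hx
    refine ⟨hx1, ?_⟩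
    have e := hall c hc P s
    rw [hh, map_sub, hφe, hφe, sub_eq_zero]
    have hx0 : ∀ i, (if i ∈ Set.range σ then (0:ℚ) else (x i:ℚ)) = c i := by
      intro i
      by_cases hi : i ∈ Set.range σ
      · obtain ⟨j, rfl⟩ := hi
        rw [(hZ c hc).2 j]; simp
      · rw [if_neg hi, hx2 i hi]
    simp only [hx0]
    refine Eq.trans ?_ e
    congr 2; funext i; ring)
  rw [hW, card_Icc_box, pow_add, ← mul_assoc] at h1
  refine (Nat.le_of_mul_le_mul_right h1 (by positivity)).trans ?_
  exact Nat.mul_le_mul_right _ hhd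

end DG

namespace DG
open MvPolynomial

def cx {k : ℕ} (b : Fin 3 → Fin k → ℤ) (σ : Fin 3 → Fin k) (x : Fin k → ℤ) : Fin k → ℤ :=
  fun i => x i - ∑ j, b j i * x (σ j)

theorem cx_box {k T N : ℕ} {b : Fin 3 → Fin k → ℤ} {σ : Fin 3 → Fin k} (hb : ∀ j i, |b j i| ≤ T)
    {x : Fin k → ℤ} (hx : Box N x) : Box ((1+3*T)*N) (cx b σ x) := by
  intro i
  unfold cx
  have h1 : |∑ j, b j i * x (σ j)| ≤ ∑ j : Fin 3, (T:ℤ) * N := by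
    refine (Finset.abs_sum_le_sum_abs _ _).trans (Finset.sum_le_sum ?_)
    intro j _
    rw [abs_mul]
    exact mul_le_mul (hb j i) (hx _) (abs_nonneg _) (by positivity)
  rw [Finset.sum_const, Finset.card_univ, Fintype.card_fin, nsmul_eq_mul] at h1
  have h2 := hx i
  have h3 := abs_sub (x i) (∑ j, b j i * x (σ j))
  push_cast at *
  nlinarith

theorem cx_sigma {k : ℕ} {b : Fin 3 → Fin k → ℤ} {σ : Fin 3 → Fin k}
    (h : ∀ i j, b j (σ i) = if i = j then 1 else 0) (x : Fin k → ℤ) (j : Fin 3) : cx b σ x (σ j) = 0 := by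
  unfold cx
  simp [h]

/-- the fibre over `c` as a set of points on the slice -/
theorem fibre {k N : ℕ} {f : MvPolynomial (Fin k) ℤ} {b : Fin 3 → Fin k → ℤ} {σ : Fin 3 → Fin k}
    (A : Finset (Fin k → ℤ)) (hA : ∀ x ∈ A, Box N x ∧ eval x f = 0) (c : Fin k → ℤ)
    (hc : ∀ x ∈ A, cx b σ x = c) :
    ∃ B : Finset (Fin 3 → ℤ), A.card = B.card ∧ ∀ y ∈ B, Box N y ∧ eval y (gc f b c) = 0 := by
  classical
  refine ⟨A.image (fun x j => x (σ j)), ?_, ?_⟩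
  · rw [Finset.card_image_of_injOn]
    intro x hx x' hx' h
    have e : cx b σ x = cx b σ x' := by rw [hc x hx, hc x' hx']
    simp only at h
    funext i
    have e1 := congrFun e i
    unfold cx at e1
    have : ∑ j, b j i * x (σ j) = ∑ j, b j i * x' (σ j) := by
      apply Finset.sum_congr rfl
      intro j _
      rw [congrFun h j]
    rw [this] at e1
    linarith
  · intro y hy
    obtain ⟨x, hx, rfl⟩ := Finset.mem_image.1 hy
    refine ⟨fun j => (hA x hx).1 (σ j), ?_⟩
    rw [gc_eval, ← hc x hx]
    refine Eq.trans ?_ (hA x hx).2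
    congr 2; funext i
    unfold cx; ring

theorem GoodCount : ∃ κ : ℕ, ∀ m T : ℕ, ∃ C : ℝ, 0 ≤ C ∧ ∀ (f : MvPolynomial (Fin (m+4)) ℤ) b σ,
    f.IsHomogeneous 3 → eval (Pi.single 0 1) (qm f) ≠ 0 → Good (k := m+3) T (qm f) b σ →
    (∀ v, v ≠ 0 → ¬ Inv (qm f) (lc b v)) → ∀ N, 1 ≤ N → ∀ A : Finset (Fin (m+4) → ℤ),
    (∀ x ∈ A, Box N x ∧ eval x f = 0) →
    (A.card : ℝ) ≤ C * (N:ℝ)^((m:ℝ)+1+2/√3) * (lg N:ℝ)^κ := by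
  obtain ⟨C, κ, hL⟩ := Lines
  refine ⟨κ, fun m T => ⟨(3*(1+3*T))^(m+1) * C + 81 * (3*(1+3*T))^m, by positivity, ?_⟩⟩
  intro f b σ hf he hg hno N hN A hA
  classical
  obtain ⟨D, hD⟩ : ∃ D : ℕ, D = 3*(1+3*T) := ⟨_, rfl⟩
  obtain ⟨M, hM⟩ : ∃ M : ℕ, M = (1+3*T)*N := ⟨_, rfl⟩
  have hMD : 2*M+1 ≤ D*N := by
    rw [hM, hD]
    have : 1 ≤ (1+3*T)*N := Nat.mul_pos (by omega) hN
    nlinarith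
  have hσ := sigma_inj hg.2.1
  obtain ⟨A1, hA1⟩ : ∃ A1, A1 = A.filter (fun x => ∀ v, v ≠ 0 → Dv v (gc f b (cx b σ x)) ≠ 0) := ⟨_, rfl⟩
  obtain ⟨A2, hA2⟩ : ∃ A2, A2 = A.filter (fun x => ¬ ∀ v, v ≠ 0 → Dv v (gc f b (cx b σ x)) ≠ 0) := ⟨_, rfl⟩
  have hAA : A.card = A1.card + A2.card := by
    rw [hA1, hA2, Finset.card_filter_add_card_filter_not]
  have hZ : ∀ B : Finset (Fin (m+4) → ℤ), B ⊆ A → ∀ c ∈ B.image (cx b σ), Box M c ∧ ∀ j, c (σ j) = 0 := by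
    intro B hB c hc
    obtain ⟨x, hx, rfl⟩ := Finset.mem_image.1 hc
    rw [hM]
    exact ⟨cx_box hg.1 (hA x (hB hx)).1, cx_sigma hg.2.1 x⟩
  have hs1 : A1 ⊆ A := by rw [hA1]; exact Finset.filter_subset _ _
  have hs2 : A2 ⊆ A := by rw [hA2]; exact Finset.filter_subset _ _
  obtain ⟨E, hE⟩ : ∃ E : ℝ, E = C * (N:ℝ)^(2/√3) * (lg N:ℝ)^κ := ⟨_, rfl⟩
  have hE0 : 0 ≤ E := by rw [hE]; positivity
  have hsF := gc_surf (k := m+3) f hf he b σ hg 0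
  -- good part
  have h1 : A1.card ≤ ⌊E⌋₊ * (A1.image (cx b σ)).card := by
    apply Finset.card_le_mul_card_image
    intro c hc
    obtain ⟨B, hB, hBm⟩ := fibre (f := f) (b := b) (σ := σ) (N := N) (A1.filter (fun x => cx b σ x = c))
      (fun x hx => hA x (hs1 (Finset.mem_filter.1 hx).1)) c (fun x hx => (Finset.mem_filter.1 hx).2)
    rw [hB]
    apply Nat.le_floor
    rw [hE]
    obtain ⟨x, hx, rfl⟩ := Finset.mem_image.1 hc
    rw [hA1, Finset.mem_filter] at hx
    exact hL (gc f b (cx b σ x)) (gc f b 0) (gc_surf (k := m+3) f hf he b σ hg _) hsF (gc_hom f hf b)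
      (fun P v h => gc_lines (k := m+3) f hf b _ P v h) hx.2 N hN B (fun y hy => (hBm y hy).1)
      (fun y hy => (hBm y hy).2)
  have h2 : (A1.image (cx b σ)).card ≤ (2*M+1)^(m+1) := c_count (k := m+1) hσ M _ (hZ A1 hs1)
  -- bad part
  have h3 : A2.card ≤ 3*(2*N+1)^2 * (A2.image (cx b σ)).card := by
    apply Finset.card_le_mul_card_image
    intro c hc
    obtain ⟨B, hB, hBm⟩ := fibre (f := f) (b := b) (σ := σ) (N := N) (A2.filter (fun x => cx b σ x = c))
      (fun x hx => hA x (hs2 (Finset.mem_filter.1 hx).1)) c (fun x hx => (Finset.mem_filter.1 hx).2)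
    rw [hB]
    exact (gc_surf (k := m+3) f hf he b σ hg c).t0 B hBm
  have h4 : (A2.image (cx b σ)).card ≤ 3 * (2*M+1)^m := by
    apply bad_count (qm_hom hf) he hg hno M _ (hZ A2 hs2)
    intro c hc
    obtain ⟨x, hx, rfl⟩ := Finset.mem_image.1 hc
    rw [hA2, Finset.mem_filter] at hx
    have := hx.2
    push Not at this
    obtain ⟨v, hv, hvD⟩ := this
    refine ⟨fun i => (v i:ℚ), ?_, InvC_of_Dv f b _ v hvD⟩
    intro h0
    apply hv
    funext i
    have := congrFun h0 i
    simpa using this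
  -- conclusion
  have hNr : (1:ℝ) ≤ N := by exact_mod_cast hN
  have hN0 : (0:ℝ) < N := by linarith
  have hlg : (1:ℝ) ≤ (lg N:ℝ)^κ := by
    apply one_le_pow₀
    have := lg_ge (N := N)
    exact_mod_cast (by omega : 1 ≤ lg N)
  have hX : (N:ℝ)^((m:ℝ)+1+2/√3) = (N:ℝ)^(m+1) * (N:ℝ)^(2/√3) := by
    rw [Real.rpow_add hN0]
    congr 1
    exact_mod_cast Real.rpow_natCast (N:ℝ) (m+1)
  have hθ : (N:ℝ) ≤ (N:ℝ)^(2/√3) := by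
    conv_lhs => rw [← Real.rpow_one (N:ℝ)]
    exact Real.rpow_le_rpow_of_exponent_le hNr theta_bounds.1.le
  have g1 : (A1.card:ℝ) ≤ (D:ℝ)^(m+1) * C * ((N:ℝ)^(m+1) * (N:ℝ)^(2/√3)) * (lg N:ℝ)^κ := by
    have e1 : (A1.card:ℝ) ≤ (⌊E⌋₊:ℝ) * (D*N)^(m+1) := by
      have : A1.card ≤ ⌊E⌋₊ * (D*N)^(m+1) :=
        h1.trans (Nat.mul_le_mul_left _ (h2.trans (Nat.pow_le_pow_left hMD _)))
      exact_mod_cast this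
    calc (A1.card:ℝ) ≤ (⌊E⌋₊:ℝ) * (D*N)^(m+1) := e1
      _ ≤ E * (D*N)^(m+1) := by gcongr; exact Nat.floor_le hE0
      _ = _ := by rw [hE, mul_pow]; ring
  have g2 : (A2.card:ℝ) ≤ 81 * (D:ℝ)^m * ((N:ℝ)^(m+1) * (N:ℝ)^(2/√3)) * (lg N:ℝ)^κ := by
    have e1 : (A2.card:ℝ) ≤ 3*(3*N)^2 * (3*(D*N)^m) := by
      have : A2.card ≤ 3*(3*N)^2 * (3*(D*N)^m) := by
        refine h3.trans (Nat.mul_le_mul (Nat.mul_le_mul_left _ (Nat.pow_le_pow_left (by omega) _)) ?_)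
        exact h4.trans (Nat.mul_le_mul_left _ (Nat.pow_le_pow_left hMD _))
      exact_mod_cast this
    calc (A2.card:ℝ) ≤ 3*(3*N)^2 * (3*(D*N)^m) := e1
      _ = 81 * (D:ℝ)^m * ((N:ℝ)^(m+1) * N) * 1 := by rw [mul_pow]; ring
      _ ≤ _ := by gcongr
  rw [hX, hAA]
  push_cast
  have hDr : (D:ℝ) = 3*(1+3*T) := by rw [hD]; push_cast; ring
  rw [← hDr]
  calc (A1.card:ℝ) + A2.card ≤ _ := add_le_add g1 g2
    _ = _ := by ring

theorem BinCount {k : ℕ} (f : MvPolynomial (Fin (k+2)) ℤ) (h : Bin (k := k+1) (qm f)) (N : ℕ)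
    (A : Finset (Fin (k+2) → ℤ)) (hA : ∀ x ∈ A, Box N x ∧ eval x f = 0) : A.card ≤ (2*N+1)^k := by
  classical
  obtain ⟨j, hj, hB⟩ := h
  obtain ⟨l, rfl⟩ := Fin.exists_succ_eq.2 hj
  have h1 : A.card ≤ (Fintype.piFinset fun _ : Fin k => Finset.Icc (-(N:ℤ)) N).card := by
    apply Finset.card_le_card_of_injOn (fun x i => x (l.succAbove i).succ)
    · intro x hx
      simp only [Finset.mem_coe, Fintype.mem_piFinset, Finset.mem_Icc]
      intro i
      exact abs_le.1 ((hA x hx).1 _)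
    · intro x hx x' hx' hxx
      have := hB (fun i => (x i:ℚ)) (fun i => (x' i:ℚ)) (by rw [eval_qm, (hA x hx).2]; simp)
        (by rw [eval_qm, (hA x' hx').2]; simp) (by
          intro i hi0 hij
          obtain ⟨i, rfl⟩ := Fin.exists_succ_eq.2 hi0
          obtain ⟨i, rfl⟩ := Fin.exists_succAbove_eq (x := i) (y := l) (fun h => hij (by rw [h]))
          have := congrFun hxx i
          simp only at this
          rw [this])
      funext i
      have := congrFun this i
      simp only [Int.cast_inj] at this
      exact this
  rw [Fintype.card_piFinset] at h1
  simpa only [card_Icc_box, Finset.prod_const, Finset.card_univ, Fintype.card_fin] using h1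

end DG

namespace DG
open MvPolynomial

noncomputable def shear {k : ℕ} {R : Type*} [CommRing R] (a : Fin k → R) : Fin (k+1) → MvPolynomial (Fin (k+1)) R :=
  Fin.cons (X 0) (fun j => X j.succ + C (a j) * X 0)

theorem shear_comp {k : ℕ} {R : Type*} [CommRing R] (a b : Fin k → R) (h : ∀ i, b i = - a i) :
    (aeval (shear a)).comp (aeval (shear b)) = AlgHom.id R (MvPolynomial (Fin (k+1)) R) := by
  apply algHom_ext
  intro i
  refine Fin.cases ?_ (fun j => ?_) i
  · simp [shear]
  · simp [shear, h, algebraMap_eq]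

noncomputable def shearEquiv {k : ℕ} {R : Type*} [CommRing R] (a : Fin k → R) :
    MvPolynomial (Fin (k+1)) R ≃ₐ[R] MvPolynomial (Fin (k+1)) R :=
  AlgEquiv.ofAlgHom (aeval (shear a)) (aeval (shear (fun i => - a i)))
    (shear_comp a (fun i => - a i) (fun _ => rfl)) (shear_comp (fun i => - a i) a (fun i => by simp))

theorem shear_eval {k : ℕ} (a : Fin k → ℤ) (f : MvPolynomial (Fin (k+1)) ℤ) (z : Fin (k+1) → ℤ) :
    eval z (aeval (shear a) f) = eval (Fin.cons (z 0) (fun j => z j.succ + a j * z 0)) f := by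
  rw [eval_aeval']
  congr 2; funext i
  refine Fin.cases ?_ (fun j => ?_) i <;> simp [shear]

theorem shear_hom {k : ℕ} (a : Fin k → ℤ) (f : MvPolynomial (Fin (k+1)) ℤ) (hf : f.IsHomogeneous 3) :
    (aeval (shear a) f).IsHomogeneous 3 := by
  have := hf.aeval (shear a) (n := 1) (by
    intro i
    refine Fin.cases ?_ (fun j => ?_) i
    · exact isHomogeneous_X ℤ _
    · simp only [shear, Fin.cons_succ]
      apply IsHomogeneous.add (isHomogeneous_X ℤ _)
      have := (isHomogeneous_C (Fin (k+1)) (a j)).mul (isHomogeneous_X ℤ 0)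
      rw [zero_add] at this
      exact this)
  rw [one_mul] at this
  exact this

theorem shear_irr {k : ℕ} (a : Fin k → ℤ) (f : MvPolynomial (Fin (k+1)) ℤ) (hf : Irreducible (qm f)) :
    Irreducible (qm (aeval (shear a) f)) := by
  have e : qm (aeval (shear a) f) = shearEquiv (fun i => (a i:ℚ)) (qm f) := by
    change qm (aeval (shear a) f) = aeval (shear (fun i => (a i:ℚ))) (qm f)
    apply MvPolynomial.funext
    intro x
    rw [eval_aeval', ← aeval_q, ← aeval_q]
    have : (aeval x).comp (aeval (shear a)) =
      (aeval (fun i => eval x (shear (fun i => (a i:ℚ)) i)) : MvPolynomial (Fin (k+1)) ℤ →ₐ[ℤ] ℚ) := by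
      apply algHom_ext
      intro i
      refine Fin.cases ?_ (fun j => ?_) i <;> simp [shear]
    rw [← this]; rfl
  rw [e]
  exact (MulEquiv.irreducible_iff (shearEquiv (fun i => (a i:ℚ)))).2 hf

theorem exists_a {k : ℕ} (f : MvPolynomial (Fin (k+1)) ℤ) (hf : f.IsHomogeneous 3) (h0 : f ≠ 0) :
    ∃ a : Fin k → ℤ, (∀ i, |a i| ≤ 3) ∧ eval (Fin.cons 1 a : Fin (k+1) → ℤ) f ≠ 0 := by
  by_contra hc
  push Not at hc
  obtain ⟨p, hp⟩ : ∃ p : MvPolynomial (Fin k) ℤ, p = aeval (Fin.cons 1 X : Fin (k+1) → MvPolynomial (Fin k) ℤ) f := ⟨_, rfl⟩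
  have hpd : p.totalDegree ≤ 3 := by
    rw [hp]
    refine (td_aeval_le _ ?_ f).trans hf.totalDegree_le
    intro i
    refine Fin.cases ?_ (fun j => ?_) i
    · simp
    · simp
  have hp0 : p = 0 := by
    apply eq_zero_of_eval_zero_at_prod_finset p (fun _ => Finset.Icc 0 3)
    · intro i
      have := degreeOf_le_totalDegree p i
      simp only [Int.card_Icc]
      norm_num
      omega
    · intro x hx
      rw [hp, eval_aeval']
      refine Eq.trans ?_ (hc x ?_)
      · congr 2; funext i
        refine Fin.cases ?_ (fun j => ?_) i <;> simp
      · intro i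
        have := Finset.mem_Icc.1 (hx i)
        rw [abs_le]; omega
  have hq : qm f * X 0 = 0 := by
    apply MvPolynomial.funext
    intro x
    rw [map_mul, eval_X, map_zero]
    by_cases hx : x 0 = 0
    · rw [hx, mul_zero]
    · have h1 := hom_eval (qm f) (qm_hom hf) (x 0) (Fin.cons 1 (fun j => (x 0)⁻¹ * x j.succ))
      have h2 : eval (Fin.cons 1 (fun j => (x 0)⁻¹ * x j.succ) : Fin (k+1) → ℚ) (qm f) = 0 := by
        rw [← aeval_q]
        have : (aeval (fun j => (x 0)⁻¹ * x j.succ)).comp (aeval (Fin.cons 1 X : Fin (k+1) → MvPolynomial (Fin k) ℤ)) =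
          (aeval (Fin.cons 1 (fun j => (x 0)⁻¹ * x j.succ) : Fin (k+1) → ℚ) : MvPolynomial (Fin (k+1)) ℤ →ₐ[ℤ] ℚ) := by
          apply algHom_ext
          intro i
          refine Fin.cases ?_ (fun j => ?_) i <;> simp
        rw [← this]
        change aeval _ (aeval _ f) = 0
        rw [← hp, hp0, map_zero]
      rw [h2, mul_zero] at h1
      have h3 : eval x (qm f) = 0 := by
        refine Eq.trans ?_ h1
        congr 2; funext i
        refine Fin.cases ?_ (fun j => ?_) i
        · simp
        · simp only [Fin.cons_succ]; field_simp
      rw [h3, zero_mul]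
  rcases mul_eq_zero.1 hq with h | h
  · apply h0
    apply qm_injective
    rw [h]; simp
  · exact X_ne_zero _ h

theorem lg4 (N : ℕ) (hN : 1 ≤ N) : lg (4*N) ≤ 2 * lg N := by
  unfold lg
  have : 4 * N = N * 2 * 2 := by ring
  rw [this, Nat.log_mul_base (by norm_num) (by omega), Nat.log_mul_base (by norm_num) (by omega)]
  omega

theorem Core : ∃ κ : ℕ, ∀ m : ℕ, ∃ C : ℝ, 0 ≤ C ∧ ∀ (f : MvPolynomial (Fin (m+4)) ℤ),
    f.IsHomogeneous 3 → Irreducible (qm f) → ∀ N, 1 ≤ N → ∀ A : Finset (Fin (m+4) → ℤ),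
    (∀ x ∈ A, Box N x ∧ eval x f = 0) →
    (A.card : ℝ) ≤ C * (N:ℝ)^((m:ℝ)+1+2/√3) * (lg N:ℝ)^κ := by
  obtain ⟨κ, hκ⟩ := GoodCount
  refine ⟨κ, fun m => ?_⟩
  obtain ⟨T, hT⟩ := Comb (m+1)
  obtain ⟨C, hC0, hC⟩ := hκ m T
  refine ⟨C * (4:ℝ)^((m:ℝ)+1+2/√3) * 2^κ + 9^(m+2), by positivity, ?_⟩
  intro f hf hi N hN A hA
  classical
  have hf0 : f ≠ 0 := by
    rintro rfl
    apply hi.ne_zero; simp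
  obtain ⟨a, ha, hae⟩ := exists_a (k := m+3) f hf hf0
  obtain ⟨g, hg⟩ : ∃ g, g = aeval (shear a) f := ⟨_, rfl⟩
  have hgh : g.IsHomogeneous 3 := by rw [hg]; exact shear_hom a f hf
  have hgi : Irreducible (qm g) := by rw [hg]; exact shear_irr a f hi
  have hge : eval (Pi.single 0 1) (qm g) ≠ 0 := by
    have e : (Pi.single 0 1 : Fin (m+4) → ℚ) = fun i => (((Pi.single 0 1 : Fin (m+4) → ℤ) i : ℤ):ℚ) := by
      funext i
      refine Fin.cases ?_ (fun j => ?_) i <;> simp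
    rw [e, eval_qm, hg, shear_eval]
    intro h
    apply hae
    have h' : eval (Fin.cons ((Pi.single 0 1 : Fin (m+4) → ℤ) 0) (fun j => (Pi.single 0 1 : Fin (m+4) → ℤ) j.succ + a j * (Pi.single 0 1 : Fin (m+4) → ℤ) 0) : Fin (m+4) → ℤ) f = 0 := by exact_mod_cast h
    refine Eq.trans ?_ h'
    congr 2; funext i
    refine Fin.cases ?_ (fun j => ?_) i <;> simp
  have hNR : NR (k := m+3) (qm g) := NR_of_irr _ (qm_hom hgh) hge hgi
  obtain ⟨B, hB⟩ : ∃ B : Finset (Fin (m+4) → ℤ), B = A.image (fun x => Fin.cons (x 0) (fun j => x j.succ - a j * x 0)) := ⟨_, rfl⟩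
  have hBc : A.card = B.card := by
    rw [hB, Finset.card_image_of_injective]
    intro x x' h
    simp only at h
    have h0 := congrFun h 0
    simp only [Fin.cons_zero] at h0
    funext i
    refine Fin.cases h0 (fun j => ?_) i
    have h1 := congrFun h j.succ
    simp only [Fin.cons_succ, h0] at h1
    linarith
  have hBm : ∀ x ∈ B, Box (4*N) x ∧ eval x g = 0 := by
    intro z hz
    rw [hB] at hz
    obtain ⟨x, hx, rfl⟩ := Finset.mem_image.1 hz
    obtain ⟨h1, h2⟩ := hA x hx
    constructor
    · intro i
      refine Fin.cases ?_ (fun j => ?_) i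
      · have := h1 0
        simp only [Fin.cons_zero]; push_cast; omega
      · simp only [Fin.cons_succ]
        have e1 := h1 j.succ
        have e2 := h1 0
        have e3 := ha j
        have e4 := abs_sub (x j.succ) (a j * x 0)
        rw [abs_mul] at e4
        have e5 : |a j| * |x 0| ≤ 3 * N := mul_le_mul e3 e2 (abs_nonneg _) (by norm_num)
        push_cast; linarith
    · rw [hg, shear_eval]
      refine Eq.trans ?_ h2
      congr 2; funext i
      refine Fin.cases ?_ (fun j => ?_) i <;> simp
  have hNr : (1:ℝ) ≤ N := by exact_mod_cast hN
  have hN0 : (0:ℝ) < N := by linarith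
  have hlg : (1:ℝ) ≤ (lg N:ℝ)^κ := by
    apply one_le_pow₀
    have := lg_ge (N := N)
    exact_mod_cast (by omega : 1 ≤ lg N)
  rw [hBc]
  rcases hT (qm g) hNR with hbin | ⟨b, σ, hgood, hno⟩
  · have h1 := BinCount (k := m+2) g hbin (4*N) B hBm
    have h2 : (B.card:ℝ) ≤ (9*N)^(m+2) := by
      have : B.card ≤ (9*N)^(m+2) := h1.trans (Nat.pow_le_pow_left (by omega) _)
      exact_mod_cast this
    have h3 : (N:ℝ)^(m+2) ≤ (N:ℝ)^((m:ℝ)+1+2/√3) := by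
      rw [← Real.rpow_natCast]
      apply Real.rpow_le_rpow_of_exponent_le hNr
      push_cast
      have := theta_bounds.1
      linarith
    calc (B.card:ℝ) ≤ (9*N)^(m+2) := h2
      _ = 9^(m+2) * (N:ℝ)^(m+2) * 1 := by rw [mul_pow]; ring
      _ ≤ 9^(m+2) * (N:ℝ)^((m:ℝ)+1+2/√3) * (lg N:ℝ)^κ := by gcongr
      _ ≤ _ := by
        gcongr
        have : 0 ≤ C * (4:ℝ)^((m:ℝ)+1+2/√3) * 2^κ := by positivity
        linarith
  · have h1 := hC g b σ hgh hge hgood hno (4*N) (by omega) B hBm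
    have h2 : (lg (4*N):ℝ)^κ ≤ (2 * lg N)^κ := by
      apply pow_le_pow_left₀ (by positivity)
      exact_mod_cast lg4 N hN
    have h3 : (((4*N:ℕ)):ℝ)^((m:ℝ)+1+2/√3) = (4:ℝ)^((m:ℝ)+1+2/√3) * (N:ℝ)^((m:ℝ)+1+2/√3) := by
      push_cast
      rw [Real.mul_rpow (by norm_num) hN0.le]
    rw [h3] at h1
    calc (B.card:ℝ) ≤ _ := h1
      _ ≤ C * ((4:ℝ)^((m:ℝ)+1+2/√3) * (N:ℝ)^((m:ℝ)+1+2/√3)) * (2 * lg N)^κ := by gcongr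
      _ = (C * (4:ℝ)^((m:ℝ)+1+2/√3) * 2^κ) * (N:ℝ)^((m:ℝ)+1+2/√3) * (lg N:ℝ)^κ := by rw [mul_pow]; ring
      _ ≤ _ := by
        gcongr
        have : (0:ℝ) ≤ 9^(m+2) := by positivity
        linarith

theorem lg_log (H : ℝ) (hH : 2 ≤ H) : (lg ⌊H⌋₊ : ℝ) ≤ 10 * Real.log H := by
  have hl2 : (0.69:ℝ) < Real.log 2 := by have := Real.log_two_gt_d9; linarith
  have hH2 : Real.log 2 ≤ Real.log H := Real.log_le_log (by norm_num) hH
  have hN : ⌊H⌋₊ ≠ 0 := by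
    have : 2 ≤ ⌊H⌋₊ := Nat.le_floor (by exact_mod_cast hH)
    omega
  have h1 : (2:ℝ)^(Nat.log 2 ⌊H⌋₊) ≤ H := by
    have h2 := Nat.pow_log_le_self 2 hN
    have h3 : ((2^(Nat.log 2 ⌊H⌋₊) : ℕ):ℝ) ≤ (⌊H⌋₊:ℝ) := by exact_mod_cast h2
    have h4 := Nat.floor_le (show (0:ℝ) ≤ H by linarith)
    push_cast at h3
    linarith
  have h2 := Real.log_le_log (by positivity) h1
  rw [Real.log_pow] at h2
  unfold lg
  push_cast
  have h5 : (Nat.log 2 ⌊H⌋₊ : ℝ) * 0.69 ≤ Real.log H := by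
    refine le_trans ?_ h2
    gcongr
  nlinarith

end DG


theorem dimension_growth_projective_deg_three :
    ∃ κ : ℝ, ∀ n : ℕ, 2 < n → ∃ c : ℝ,
      ∀ (f : MvPolynomial (Fin (n + 1)) ℤ) (d : ℕ),
      f.IsHomogeneous d → d = 3 →
      Irreducible (MvPolynomial.map (Int.castRingHom ℚ) f) →
      ∀ H : ℝ, 2 ≤ H →
      ∀ S : Set (Projectivization ℚ (Fin (n + 1) → ℚ)),
        S = {p | ∃ (x : Fin (n + 1) → ℤ) (hx : (fun i => (x i : ℚ)) ≠ 0),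
              Projectivization.mk ℚ (fun i => (x i : ℚ)) hx = p ∧
              Finset.univ.gcd x = 1 ∧
              MvPolynomial.eval x f = 0 ∧
              ∀ i, (|x i| : ℝ) ≤ H} →
        S.Finite ∧ (S.ncard : ℝ) ≤ c * H ^ (((n : ℝ) - 1) - 1 + 2 / Real.sqrt 3) * Real.log H ^ κ := by
  obtain ⟨κ, hκ⟩ := DG.Core
  refine ⟨(κ:ℝ), ?_⟩
  intro n hn
  obtain ⟨m, rfl⟩ : ∃ m, n = m + 3 := ⟨n - 3, by omega⟩
  obtain ⟨C, hC0, hC⟩ := hκ m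
  refine ⟨C * 10^κ, ?_⟩
  intro f d hf hd hi H hH S hS
  subst hd
  classical
  obtain ⟨N, hN⟩ : ∃ N, N = ⌊H⌋₊ := ⟨_, rfl⟩
  have hN2 : 2 ≤ N := by rw [hN]; exact Nat.le_floor (by exact_mod_cast hH)
  have hNH : (N:ℝ) ≤ H := by rw [hN]; exact Nat.floor_le (by linarith)
  obtain ⟨A, hA⟩ : ∃ A : Finset (Fin (m+4) → ℤ), A = (Fintype.piFinset fun _ : Fin (m+4) => Finset.Icc (-(N:ℤ)) N).filter
    (fun x => MvPolynomial.eval x f = 0) := ⟨_, rfl⟩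
  have hAm : ∀ x ∈ A, DG.Box N x ∧ MvPolynomial.eval x f = 0 := by
    intro x hx
    rw [hA, Finset.mem_filter, Fintype.mem_piFinset] at hx
    exact ⟨fun i => abs_le.2 (Finset.mem_Icc.1 (hx.1 i)), hx.2⟩
  have hrep : ∀ p : Projectivization ℚ (Fin (m+3+1) → ℚ), ∃ x : Fin (m+4) → ℤ, p ∈ S → x ∈ A ∧ ∃ hx : (fun i => (x i : ℚ)) ≠ 0,
      Projectivization.mk ℚ (fun i => (x i : ℚ)) hx = p := by
    intro p
    by_cases hp : p ∈ S
    · have hp' := hp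
      rw [hS] at hp'
      obtain ⟨x, hx, hxp, -, hx0, hxH⟩ := hp'
      refine ⟨x, fun _ => ⟨?_, hx, hxp⟩⟩
      rw [hA, Finset.mem_filter, Fintype.mem_piFinset]
      refine ⟨fun i => ?_, hx0⟩
      rw [Finset.mem_Icc, ← abs_le]
      have h1 : ((x i).natAbs : ℝ) ≤ H := by
        rw [Nat.cast_natAbs]; push_cast; exact hxH i
      have h2 : (x i).natAbs ≤ N := by rw [hN]; exact Nat.le_floor h1
      rw [Int.abs_eq_natAbs]
      exact_mod_cast h2
    · exact ⟨0, fun h => absurd h hp⟩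
  choose r hr using hrep
  have hinj : Set.InjOn r S := by
    intro p hp q hq hpq
    obtain ⟨-, hx, h1⟩ := hr p hp
    obtain ⟨-, hx', h2⟩ := hr q hq
    rw [← h1, ← h2]
    congr 1
    funext i
    rw [hpq]
  have hmaps : Set.MapsTo r S (A : Set (Fin (m+4) → ℤ)) := fun p hp => (hr p hp).1
  refine ⟨Set.Finite.of_injOn hmaps hinj A.finite_toSet, ?_⟩
  have hcard : S.ncard ≤ A.card := by
    rw [← Set.ncard_coe_finset A]
    exact Set.ncard_le_ncard_of_injOn r hmaps hinj A.finite_toSet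
  have h1 := hC f hf hi N (by omega) A hAm
  have hexp : (((m+3:ℕ):ℝ) - 1) - 1 + 2 / Real.sqrt 3 = (m:ℝ) + 1 + 2/Real.sqrt 3 := by push_cast; ring
  rw [hexp, Real.rpow_natCast]
  have hth := DG.theta_bounds.1
  have hlog : 0 ≤ Real.log H := Real.log_nonneg (by linarith)
  have h2 : (DG.lg N:ℝ)^κ ≤ (10 * Real.log H)^κ := by
    apply pow_le_pow_left₀ (by positivity)
    rw [hN]; exact DG.lg_log H hH
  have h3 : (N:ℝ)^((m:ℝ)+1+2/Real.sqrt 3) ≤ H^((m:ℝ)+1+2/Real.sqrt 3) := by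
    apply Real.rpow_le_rpow (by positivity) hNH (by positivity)
  calc (S.ncard:ℝ) ≤ A.card := by exact_mod_cast hcard
    _ ≤ _ := h1
    _ ≤ C * H^((m:ℝ)+1+2/Real.sqrt 3) * (10 * Real.log H)^κ := by gcongr
    _ = _ := by rw [mul_pow]; ring
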